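/- Let τ ∈ ℂ be such that τ² is a primitive ℓ-th root of unity with ℓ odd, ℓ ≥ 3. Then the negligible morphisms between even objects form the unique nonzero proper ideal of the even Temperley–Lieb category TL^{ev}(τ). -/

import Mathlib

/-!
Common definitions: the Temperley–Lieb category over a field `K` with loop
parameter `d`.

An `(m,n)`-Temperley–Lieb diagram is a noncrossing perfect matching of `m`
marked points on the top edge and `n` marked points on the bottom edge of a
rectangle.  We encode it as a fixed-point-free involution of
`Fin m ⊕ Fin n` (`Sum.inl i` is the `i`-th top point, `Sum.inr j` the `j`-th
bottom point) which is noncrossing with respect to the boundary order of the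
points (top points from left to right, then bottom points from right to left).
-/

open scoped Classical

namespace TL

/-- The position of a marked point in the linear boundary order of the
rectangle: top points `0, …, m-1` from left to right, then bottom points
from right to left. -/
def bIdx (m n : ℕ) : Fin m ⊕ Fin n → ℕ
  | Sum.inl i => (i : ℕ)
  | Sum.inr j => m + (n - 1 - (j : ℕ))

/-- An `(m,n)`-Temperley–Lieb diagram: a noncrossing perfect matching
(= fixed-point-free involution) of the `m` top points and `n` bottom points. -/
structure Diagram (m n : ℕ) where
  pair : Fin m ⊕ Fin n → Fin m ⊕ Fin n
  involutive : Function.Involutive pair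
  fixedPointFree : ∀ x, pair x ≠ x
  noncrossing : ∀ x y, ¬ (bIdx m n x < bIdx m n y ∧ bIdx m n y < bIdx m n (pair x) ∧
      bIdx m n (pair x) < bIdx m n (pair y))

noncomputable instance (m n : ℕ) : Fintype (Diagram m n) :=
  Fintype.ofInjective (fun D => D.pair)
    (fun a b h => by cases a; cases b; simpa using h)

/-- `Hom K m n` is the `K`-vector space of morphisms from `m` to `n`:
the free vector space on the set of `(m,n)`-TL diagrams, realized as the
space of `K`-valued functions on the (finite) set of diagrams. -/
abbrev Hom (K : Type) [Field K] (m n : ℕ) : Type := Diagram m n → K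

variable {K : Type} [Field K]

/-- The basis vector of `Hom K m n` corresponding to a single diagram. -/
noncomputable def single {m n : ℕ} (p : Diagram m n) : Hom K m n :=
  fun c => if c = p then 1 else 0

/-! ### Composition -/

/-- The marked points of the picture obtained by stacking an `(l,m)`-diagram
on top of an `(m,n)`-diagram: `l` top points, `m` middle points, `n` bottom
points. -/
abbrev Pt (l m n : ℕ) := Fin l ⊕ (Fin m ⊕ Fin n)

/-- One strand of the stacked picture: either a strand of the top diagram `a`
(on the `l` top and `m` middle points) or a strand of the bottom diagram `b`
(on the `m` middle and `n` bottom points). -/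
def Step {l m n : ℕ} (a : Diagram l m) (b : Diagram m n) : Pt l m n → Pt l m n → Prop :=
  fun x y =>
    (∃ u : Fin l ⊕ Fin m, Sum.map id Sum.inl u = x ∧ Sum.map id Sum.inl (a.pair u) = y) ∨
    (∃ u : Fin m ⊕ Fin n, Sum.inr u = x ∧ Sum.inr (b.pair u) = y)

/-- Connectivity in the stacked picture: two marked points are connected if
they are joined by a path of strands. -/
def Conn {l m n : ℕ} (a : Diagram l m) (b : Diagram m n) : Pt l m n → Pt l m n → Prop :=
  Relation.EqvGen (Step a b)

/-- The points of the middle layer whose connected component stays entirely in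
the middle layer; these components are exactly the closed loops produced when
stacking. -/
def ClosedMid {l m n : ℕ} (a : Diagram l m) (b : Diagram m n) : Set (Pt l m n) :=
  {x | (∃ j : Fin m, x = Sum.inr (Sum.inl j)) ∧
    ∀ y, Conn a b x y → ∃ j : Fin m, y = Sum.inr (Sum.inl j)}

/-- The number of closed loops produced when stacking `a` on top of `b`:
the number of connected components consisting entirely of middle points. -/
noncomputable def numLoops {l m n : ℕ} (a : Diagram l m) (b : Diagram m n) : ℕ :=
  Nat.card (Quotient (⟨fun x y : ClosedMid a b => Conn a b x.1 y.1,
    ⟨fun _ => Relation.EqvGen.refl _, fun h => Relation.EqvGen.symm _ _ h,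
      fun h h' => Relation.EqvGen.trans _ _ _ h h'⟩⟩ : Setoid (ClosedMid a b)))

/-- Composition of two diagrams `b ∘ a` (stack `a` on top of `b`, delete the
`r` closed loops, multiply by `d ^ r`), expressed as an element of
`Hom K l n`: the result is `d ^ r` times the unique `(l,n)`-diagram inducing
the same pairing of the outer points as the connectivity of the stacked
picture. -/
noncomputable def compD (d : K) {l m n : ℕ} (b : Diagram m n) (a : Diagram l m) :
    Hom K l n :=
  fun c =>
    if ∀ x : Fin l ⊕ Fin n,
        Conn a b (Sum.map id Sum.inr x) (Sum.map id Sum.inr (c.pair x))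
    then d ^ numLoops a b else 0

/-- Composition `b ∘ a : Hom K l n` of `b : Hom K m n` with `a : Hom K l m`
(bilinear extension of composition of diagrams). -/
noncomputable def comp (d : K) {l m n : ℕ} (b : Hom K m n) (a : Hom K l m) :
    Hom K l n :=
  fun c => ∑ p : Diagram m n, ∑ q : Diagram l m, b p * a q * compD d p q c

/-! ### Tensor product -/

/-- Relabelling of the marked points of a horizontal juxtaposition of an
`(m,n)`-diagram (placed on the left) and an `(m',n')`-diagram (on the right). -/
def tEquiv (m n m' n' : ℕ) :
    (Fin (m + m') ⊕ Fin (n + n')) ≃ ((Fin m ⊕ Fin n) ⊕ (Fin m' ⊕ Fin n')) :=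
  (Equiv.sumCongr finSumFinEquiv.symm finSumFinEquiv.symm).trans
    (Equiv.sumSumSumComm _ _ _ _)

/-- The pairing of the horizontal juxtaposition of two diagrams. -/
def tensorPair {m n m' n' : ℕ} (a : Diagram m n) (b : Diagram m' n') :
    Fin (m + m') ⊕ Fin (n + n') → Fin (m + m') ⊕ Fin (n + n') :=
  fun x => (tEquiv m n m' n').symm (Sum.map a.pair b.pair (tEquiv m n m' n' x))

/-- The tensor product (horizontal juxtaposition) of two diagrams, as an
element of `Hom K (m+m') (n+n')`: the basis vector of the unique diagram whose
pairing is the juxtaposed pairing. -/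
noncomputable def tensorD {m n m' n' : ℕ} (a : Diagram m n) (b : Diagram m' n') :
    Hom K (m + m') (n + n') :=
  fun c => if c.pair = tensorPair a b then 1 else 0

/-- The tensor product of morphisms (bilinear extension of horizontal
juxtaposition of diagrams). -/
noncomputable def tensor {m n m' n' : ℕ} (x : Hom K m n) (y : Hom K m' n') :
    Hom K (m + m') (n + n') :=
  fun c => ∑ p : Diagram m n, ∑ q : Diagram m' n', x p * y q * tensorD p q c

/-! ### Identity, cup and cap -/

/-- The identity diagram `1_n`: `n` vertical strands. -/
def idD (n : ℕ) : Diagram n n where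
  pair := Sum.elim Sum.inr Sum.inl
  involutive := by rintro (i | i) <;> rfl
  fixedPointFree := by rintro (i | i) <;> simp
  noncrossing := by
    rintro (i | i) (j | j) <;>
      · simp only [Sum.elim_inl, Sum.elim_inr, bIdx]
        have hi := i.isLt; have hj := j.isLt; omega

/-- The identity morphism `1_n ∈ T_n`. -/
noncomputable def idHom (K : Type) [Field K] (n : ℕ) : Hom K n n :=
  fun c => if c = idD n then 1 else 0

/-- The cap `∩`: the unique `(0,2)`-TL diagram. -/
def capD : Diagram 0 2 where
  pair := fun x => match x with
    | Sum.inl i => i.elim0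
    | Sum.inr j => Sum.inr ⟨1 - (j : ℕ), by omega⟩
  involutive := by intro x; revert x; decide
  fixedPointFree := by decide
  noncrossing := by decide

/-- The cup `∪`: the unique `(2,0)`-TL diagram. -/
def cupD : Diagram 2 0 where
  pair := fun x => match x with
    | Sum.inl j => Sum.inl ⟨1 - (j : ℕ), by omega⟩
    | Sum.inr i => i.elim0
  involutive := by intro x; revert x; decide
  fixedPointFree := by decide
  noncrossing := by decide

/-- The cap `∩` as a morphism in `Hom K 0 2`. -/
noncomputable def capHom (K : Type) [Field K] : Hom K 0 2 :=
  fun c => if c = capD then 1 else 0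

/-- The cup `∪` as a morphism in `Hom K 2 0`. -/
noncomputable def cupHom (K : Type) [Field K] : Hom K 2 0 :=
  fun c => if c = cupD then 1 else 0

/-! ### The Markov trace -/

/-- The strands of the picture obtained from an `(n,n)`-diagram `p` by closing
it up: joining, for each `i`, the `i`-th top point to the `i`-th bottom point
(by nested arcs passing to the right of the rectangle). -/
def closeStep {n : ℕ} (p : Diagram n n) : (Fin n ⊕ Fin n) → (Fin n ⊕ Fin n) → Prop :=
  fun x y => p.pair x = y ∨ Sum.elim Sum.inr Sum.inl x = y

/-- The number `c(p)` of closed loops of the closure of an `(n,n)`-diagram. -/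
noncomputable def trLoops {n : ℕ} (p : Diagram n n) : ℕ :=
  Nat.card (Quotient (Relation.EqvGen.setoid (closeStep p)))

/-- The Markov trace `Tr_n : T_n → K`, sending a diagram `p` to
`d ^ c(p)`. -/
noncomputable def Tr (d : K) {n : ℕ} (x : Hom K n n) : K :=
  ∑ p : Diagram n n, x p * d ^ trLoops p

/-! ### Conditional expectations -/

/-- The conditional expectation `ε_n : T_{n+1} → T_n`,
`a ↦ (1_n ⊗ ∪) ∘ (a ⊗ 1_1) ∘ (1_n ⊗ ∩)` (closing up the last strand). -/
noncomputable def eps (d : K) (n : ℕ) (a : Hom K (n + 1) (n + 1)) : Hom K n n :=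
  let u : Hom K n (n + 2) := tensor (idHom K n) (capHom K)
  let v : Hom K (n + 2) (n + 2) := @tensor K _ (n + 1) (n + 1) 1 1 a (idHom K 1)
  let w : Hom K (n + 2) n := tensor (idHom K n) (cupHom K)
  comp d w (comp d v u)

/-- The iterated conditional expectation `ε_{n,n+m} = ε_n ∘ ε_{n+1} ∘ ⋯ ∘ ε_{n+m-1} :
T_{n+m} → T_n`. -/
noncomputable def epsIter (d : K) (n : ℕ) : (m : ℕ) → Hom K (n + m) (n + m) → Hom K n n
  | 0, a => a
  | m + 1, a => epsIter d n m (eps d (n + m) a)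

/-! ### Tensor powers of cup and cap -/

/-- `∩^{⊗k} ∈ Hom(0, 2k)`. -/
noncomputable def capPow (K : Type) [Field K] : (k : ℕ) → Hom K 0 (2 * k)
  | 0 => idHom K 0
  | k + 1 => tensor (capPow K k) (capHom K)

/-- `∪^{⊗k} ∈ Hom(2k, 0)`. -/
noncomputable def cupPow (K : Type) [Field K] : (k : ℕ) → Hom K (2 * k) 0
  | 0 => idHom K 0
  | k + 1 => tensor (cupPow K k) (cupHom K)

/-! ### Ideals -/

/-- An ideal of the Temperley–Lieb category over `(K, d)`: a family of vector
subspaces `J m n ⊆ Hom K m n` closed under composition with arbitrary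
morphisms on either side and under tensor product with arbitrary morphisms on
either side. -/
structure IsIdeal (d : K) (J : ∀ m n : ℕ, Set (Hom K m n)) : Prop where
  zero_mem : ∀ m n : ℕ, (0 : Hom K m n) ∈ J m n
  add_mem : ∀ (m n : ℕ), ∀ x ∈ J m n, ∀ y ∈ J m n, x + y ∈ J m n
  smul_mem : ∀ (m n : ℕ) (c : K), ∀ x ∈ J m n, c • x ∈ J m n
  comp_mem_left : ∀ {l m n : ℕ} (b : Hom K m n) (a : Hom K l m),
    a ∈ J l m → comp d b a ∈ J l n
  comp_mem_right : ∀ {l m n : ℕ} (b : Hom K m n) (a : Hom K l m),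
    b ∈ J m n → comp d b a ∈ J l n
  tensor_mem_left : ∀ {m n m' n' : ℕ} (x : Hom K m n) (y : Hom K m' n'),
    x ∈ J m n → tensor x y ∈ J (m + m') (n + n')
  tensor_mem_right : ∀ {m n m' n' : ℕ} (x : Hom K m n) (y : Hom K m' n'),
    y ∈ J m' n' → tensor x y ∈ J (m + m') (n + n')

/-- An ideal is nonzero if some `J m n` contains a nonzero morphism. -/
def IdealNonzero (J : ∀ m n : ℕ, Set (Hom K m n)) : Prop :=
  ∃ (m n : ℕ) (x : Hom K m n), x ∈ J m n ∧ x ≠ 0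

/-- An ideal is proper if it does not contain all morphisms. -/
def IdealProper (J : ∀ m n : ℕ, Set (Hom K m n)) : Prop :=
  ∃ m n : ℕ, J m n ≠ Set.univ

/-- The negligible morphisms: `a ∈ Hom(m,n)` with `Tr_m (b ∘ a) = 0` for all
`b ∈ Hom(n,m)`. -/
def Negl (d : K) (m n : ℕ) : Set (Hom K m n) :=
  {a | ∀ b : Hom K n m, Tr d (comp d b a) = 0}

/-- The ideal generated by a morphism `x ∈ Hom K a b`: the smallest ideal
containing `x`, i.e. the intersection of all ideals containing `x`. -/
def genIdeal (d : K) {a b : ℕ} (x : Hom K a b) (m n : ℕ) : Set (Hom K m n) :=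
  {y | ∀ J : ∀ m' n' : ℕ, Set (Hom K m' n'), IsIdeal d J → x ∈ J a b → y ∈ J m n}

/-! ### Jones–Wenzl idempotents -/

/-- The diagram `E_i ∈ T_n` (here `i` is 0-indexed, `i + 1 < n`): it joins the
`i`-th and `(i+1)`-st top points, the `i`-th and `(i+1)`-st bottom points, and
joins the `j`-th top point vertically to the `j`-th bottom point for all other
`j`; encoded as a pairing function. -/
def eiPair (n i : ℕ) : Fin n ⊕ Fin n → Fin n ⊕ Fin n
  | Sum.inl j =>
      if (j : ℕ) = i then
        Sum.inl ⟨((j : ℕ) + 1) % n, Nat.mod_lt _ (Nat.lt_of_le_of_lt (Nat.zero_le _) j.isLt)⟩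
      else if (j : ℕ) = i + 1 then
        Sum.inl ⟨(j : ℕ) - 1, Nat.lt_of_le_of_lt (Nat.sub_le _ _) j.isLt⟩
      else Sum.inr j
  | Sum.inr j =>
      if (j : ℕ) = i then
        Sum.inr ⟨((j : ℕ) + 1) % n, Nat.mod_lt _ (Nat.lt_of_le_of_lt (Nat.zero_le _) j.isLt)⟩
      else if (j : ℕ) = i + 1 then
        Sum.inr ⟨(j : ℕ) - 1, Nat.lt_of_le_of_lt (Nat.sub_le _ _) j.isLt⟩
      else Sum.inl j

/-- The morphism `E_i ∈ T_n` (0-indexed `i`). -/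
noncomputable def EHom (K : Type) [Field K] (n i : ℕ) : Hom K n n :=
  fun c => if c.pair = eiPair n i then 1 else 0

/-- A Jones–Wenzl idempotent in `T_n`: a nonzero idempotent `p` with
`E_i ∘ p = p ∘ E_i = 0` for all `i` (1-indexed `1 ≤ i ≤ n-1`; here `i` is
0-indexed, so `i + 2 ≤ n`). -/
def IsJonesWenzl (d : K) (n : ℕ) (p : Hom K n n) : Prop :=
  p ≠ 0 ∧ comp d p p = p ∧
    ∀ i : ℕ, i + 2 ≤ n → comp d (EHom K n i) p = 0 ∧ comp d p (EHom K n i) = 0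

/-- The quantum integers `[k] ∈ K`: `[0] = 0`, `[1] = 1`,
`[k+1] = d·[k] − [k−1]`. -/
def qInt (d : K) : ℕ → K
  | 0 => 0
  | 1 => 1
  | k + 2 => d * qInt d (k + 1) - qInt d k


/-- An ideal of the even Temperley–Lieb category `TL^{ev}(τ)`: a family of
subspaces of the Hom spaces between even objects, closed under composition and
tensor product with arbitrary morphisms between even objects. -/
structure IsIdealEv (d : ℂ) (J : ∀ m n : ℕ, Set (Hom ℂ m n)) : Prop where
  zero_mem : ∀ m n : ℕ, Even m → Even n → (0 : Hom ℂ m n) ∈ J m n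
  add_mem : ∀ m n : ℕ, Even m → Even n → ∀ x ∈ J m n, ∀ y ∈ J m n, x + y ∈ J m n
  smul_mem : ∀ m n : ℕ, Even m → Even n → ∀ (c : ℂ), ∀ x ∈ J m n, c • x ∈ J m n
  comp_mem_left : ∀ {l m n : ℕ}, Even l → Even m → Even n →
    ∀ (b : Hom ℂ m n) (a : Hom ℂ l m), a ∈ J l m → comp d b a ∈ J l n
  comp_mem_right : ∀ {l m n : ℕ}, Even l → Even m → Even n →
    ∀ (b : Hom ℂ m n) (a : Hom ℂ l m), b ∈ J m n → comp d b a ∈ J l n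
  tensor_mem_left : ∀ {m n m' n' : ℕ}, Even m → Even n → Even m' → Even n' →
    ∀ (x : Hom ℂ m n) (y : Hom ℂ m' n'), x ∈ J m n → tensor x y ∈ J (m + m') (n + n')
  tensor_mem_right : ∀ {m n m' n' : ℕ}, Even m → Even n → Even m' → Even n' →
    ∀ (x : Hom ℂ m n) (y : Hom ℂ m' n'), y ∈ J m' n' → tensor x y ∈ J (m + m') (n + n')

/-- A nonzero ideal of `TL^{ev}`. -/
def IdealNonzeroEv (J : ∀ m n : ℕ, Set (Hom ℂ m n)) : Prop :=
  ∃ (m n : ℕ), Even m ∧ Even n ∧ ∃ x : Hom ℂ m n, x ∈ J m n ∧ x ≠ 0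

/-- A proper ideal of `TL^{ev}`. -/
def IdealProperEv (J : ∀ m n : ℕ, Set (Hom ℂ m n)) : Prop :=
  ∃ m n : ℕ, Even m ∧ Even n ∧ J m n ≠ Set.univ

section
/-! ### Noncrossing matchings on a linearly ordered set -/

/-- `p` is a noncrossing perfect matching of `X` with respect to the order given by `pos`. -/
structure IsNC {X : Type} (pos : X → ℕ) (p : X → X) : Prop where
  inv : ∀ x, p (p x) = x
  fpf : ∀ x, p x ≠ x
  nc : ∀ x y, ¬ (pos x < pos y ∧ pos y < pos (p x) ∧ pos (p x) < pos (p y))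

lemma xor_aux {P1 P2 P3 P4 Q1 Q2 Q3 Q4 : Prop} (h1 : (P3 ↔ P4) ↔ (Q3 ↔ Q4))
    (h2 : (P3 ↔ P1) ↔ (Q3 ↔ Q1)) (h3 : (P4 ↔ P2) ↔ (Q4 ↔ Q2)) :
    (P1 ↔ P2) ↔ (Q1 ↔ Q2) := by
  grind

lemma sep_aux {A B C D : ℕ} (a1 : B ≠ A) (a2 : B ≠ C) (a3 : D ≠ A) (a4 : D ≠ C)
    (b1 : ¬ (A < B ∧ B < C ∧ C < D)) (b2 : ¬ (A < D ∧ D < C ∧ C < B))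
    (b3 : ¬ (C < B ∧ B < A ∧ A < D)) (b4 : ¬ (C < D ∧ D < A ∧ A < B))
    (b5 : ¬ (B < A ∧ A < D ∧ D < C)) (b6 : ¬ (B < C ∧ C < D ∧ D < A))
    (b7 : ¬ (D < A ∧ A < B ∧ B < C)) (b8 : ¬ (D < C ∧ C < B ∧ B < A)) :
    (A < B ↔ A < D) ↔ (C < B ↔ C < D) := by
  grind

/-- The separation form of the noncrossing condition. -/
lemma IsNC.sep {X : Type} {pos : X → ℕ} (hpos : Function.Injective pos) {p : X → X}
    (h : IsNC pos p) {x y : X} (h1 : y ≠ x) (h2 : y ≠ p x) :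
    (pos x < pos y ↔ pos x < pos (p y)) ↔ (pos (p x) < pos y ↔ pos (p x) < pos (p y)) := by
  have a1 := hpos.ne h1
  have a2 := hpos.ne h2
  have a3 : pos (p y) ≠ pos x := hpos.ne (fun e => h2 (by rw [← e, h.inv]))
  have a4 : pos (p y) ≠ pos (p x) := hpos.ne (fun e => h1 (by rw [← h.inv y, e, h.inv]))
  have b1 := h.nc x y
  have b2 := h.nc x (p y)
  have b3 := h.nc (p x) y
  have b4 := h.nc (p x) (p y)
  have b5 := h.nc y x
  have b6 := h.nc y (p x)
  have b7 := h.nc (p y) x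
  have b8 := h.nc (p y) (p x)
  simp only [h.inv] at b1 b2 b3 b4 b5 b6 b7 b8
  exact sep_aux a1 a2 a3 a4 b1 b2 b3 b4 b5 b6 b7 b8

lemma IsNC.of_sep {X : Type} {pos : X → ℕ} {p : X → X} (h1 : ∀ x, p (p x) = x)
    (h2 : ∀ x, p x ≠ x)
    (h : ∀ x y, y ≠ x → y ≠ p x →
      ((pos x < pos y ↔ pos x < pos (p y)) ↔ (pos (p x) < pos y ↔ pos (p x) < pos (p y)))) :
    IsNC pos p where
  inv := h1
  fpf := h2
  nc := fun x y ⟨a, b, c⟩ => by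
    have := h x y (by rintro rfl; omega) (by rintro rfl; omega)
    have e1 : pos x < pos (p y) := by omega
    have e2 : ¬ pos (p x) < pos y := by omega
    simp only [a, e1, e2, c] at this
    tauto

/-- The matching obtained from `p` by joining `x₀` to `y₀` and the former partners of `x₀`
and `y₀` to each other. -/
noncomputable def surg {X : Type} (p : X → X) (x₀ y₀ : X) : X → X := fun z =>
  if z = x₀ then y₀ else if z = y₀ then x₀ else
    if z = p x₀ then p y₀ else if z = p y₀ then p x₀ else p z

section surgery
variable {X : Type} {p : X → X} {x₀ y₀ : X}

lemma surg_x : surg p x₀ y₀ x₀ = y₀ := by simp [surg]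

lemma surg_y : surg p x₀ y₀ y₀ = x₀ := by
  by_cases h : y₀ = x₀
  · simp [surg, h]
  · simp [surg, h]

variable (hinv : ∀ x, p (p x) = x) (hfpf : ∀ x, p x ≠ x) (hxy : p x₀ ≠ y₀)
include hinv hfpf hxy

omit hinv in
lemma surg_u : surg p x₀ y₀ (p x₀) = p y₀ := by
  unfold surg; rw [if_neg (hfpf _), if_neg hxy, if_pos rfl]

omit hfpf in
lemma ne_of_pair_ne : p y₀ ≠ x₀ := fun e => hxy (by rw [← e, hinv])

lemma surg_v : surg p x₀ y₀ (p y₀) = p x₀ := by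
  unfold surg; rw [if_neg (ne_of_pair_ne hinv hxy), if_neg (hfpf _)]
  by_cases h : p y₀ = p x₀
  · rw [if_pos h, h]
  · rw [if_neg h, if_pos rfl]

omit hinv hfpf hxy in
lemma surg_other {z : X} (h1 : z ≠ x₀) (h2 : z ≠ y₀) (h3 : z ≠ p x₀) (h4 : z ≠ p y₀) :
    surg p x₀ y₀ z = p z := by
  unfold surg; rw [if_neg h1, if_neg h2, if_neg h3, if_neg h4]

omit hxy hfpf in
lemma pair_other {z : X} (h1 : z ≠ x₀) (h2 : z ≠ y₀) (h3 : z ≠ p x₀) (h4 : z ≠ p y₀) :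
    p z ≠ x₀ ∧ p z ≠ y₀ ∧ p z ≠ p x₀ ∧ p z ≠ p y₀ := by
  refine ⟨fun e => h3 ?_, fun e => h4 ?_, fun e => h1 ?_, fun e => h2 ?_⟩
  · rw [← e, hinv]
  · rw [← e, hinv]
  · rw [← hinv z, e, hinv]
  · rw [← hinv z, e, hinv]

omit hinv hfpf hxy in
lemma surg_cases (p : X → X) (x₀ y₀ z : X) : x₀ = z ∨ y₀ = z ∨ p x₀ = z ∨ p y₀ = z ∨
    (z ≠ x₀ ∧ z ≠ y₀ ∧ z ≠ p x₀ ∧ z ≠ p y₀) := by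
  grind

lemma surg_isNC (hne : x₀ ≠ y₀) {pos : X → ℕ} (hpos : Function.Injective pos) (h : IsNC pos p)
    (hbtw : ∀ z, pos x₀ < pos z → pos z < pos y₀ → pos x₀ < pos (p z) ∧ pos (p z) < pos y₀)
    (hlt : pos x₀ < pos y₀) :
    IsNC pos (surg p x₀ y₀) := by
  have su := surg_u hfpf hxy
  have sv := surg_v hinv hfpf hxy
  have hvx := ne_of_pair_ne hinv hxy
  have nu : ¬ (pos x₀ < pos (p x₀) ∧ pos (p x₀) < pos y₀) := fun ⟨a, b⟩ => by
    have := hbtw _ a b; rw [hinv] at this; omega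
  have nv : ¬ (pos x₀ < pos (p y₀) ∧ pos (p y₀) < pos y₀) := fun ⟨a, b⟩ => by
    have := hbtw _ a b; rw [hinv] at this; omega
  have n1 := hpos.ne (hfpf x₀)
  have n2 := hpos.ne (hfpf y₀)
  have n3 := hpos.ne hxy
  have n4 := hpos.ne hvx
  have huv : p x₀ ≠ p y₀ := fun e => hne (by rw [← hinv x₀, e, hinv])
  have n5 := hpos.ne huv
  have hbtw' : ∀ z, z ≠ x₀ → z ≠ y₀ → z ≠ p x₀ → z ≠ p y₀ →
      ((pos z < pos x₀ ↔ pos z < pos y₀) ↔ (pos (p z) < pos x₀ ↔ pos (p z) < pos y₀)) := by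
    intro z h1 h2 h3 h4
    obtain ⟨k1, k2, k3, k4⟩ := pair_other hinv h1 h2 h3 h4
    have := hbtw z
    have t2 := hbtw (p z)
    rw [hinv] at t2
    have := hpos.ne h1
    have := hpos.ne h2
    have := hpos.ne k1
    have := hpos.ne k2
    omega
  have huv' : ∀ z, z ≠ x₀ → z ≠ y₀ → z ≠ p x₀ → z ≠ p y₀ →
      ((pos z < pos (p x₀) ↔ pos z < pos (p y₀)) ↔
        (pos (p z) < pos (p x₀) ↔ pos (p z) < pos (p y₀))) := by
    intro z h1 h2 h3 h4
    have t := hbtw' z h1 h2 h3 h4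
    have t1 := h.sep hpos (x := z) (y := x₀) h1.symm (fun e => h3 (by rw [e, hinv]))
    have t2 := h.sep hpos (x := z) (y := y₀) h2.symm (fun e => h4 (by rw [e, hinv]))
    exact xor_aux t t1 t2
  have flip : ∀ {a b c e : X}, a ≠ c → a ≠ e → b ≠ c → b ≠ e →
      ((pos a < pos c ↔ pos a < pos e) ↔ (pos b < pos c ↔ pos b < pos e)) →
      ((pos c < pos a ↔ pos c < pos b) ↔ (pos e < pos a ↔ pos e < pos b)) := by
    intro a b c e h1 h2 h3 h4
    have := hpos.ne h1
    have := hpos.ne h2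
    have := hpos.ne h3
    have := hpos.ne h4
    omega
  apply IsNC.of_sep
  · intro z
    rcases surg_cases p x₀ y₀ z with rfl | rfl | rfl | rfl | ⟨h1, h2, h3, h4⟩
    · rw [surg_x, surg_y]
    · rw [surg_y, surg_x]
    · rw [su, sv]
    · rw [sv, su]
    · obtain ⟨k1, k2, k3, k4⟩ := pair_other hinv h1 h2 h3 h4
      rw [surg_other h1 h2 h3 h4, surg_other k1 k2 k3 k4, hinv]
  · intro z
    rcases surg_cases p x₀ y₀ z with rfl | rfl | rfl | rfl | ⟨h1, h2, h3, h4⟩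
    · rw [surg_x]; exact hne.symm
    · rw [surg_y]; exact hne
    · rw [su]; exact huv.symm
    · rw [sv]; exact huv
    · rw [surg_other h1 h2 h3 h4]; exact hfpf z
  · intro x y hyx hypx
    rcases surg_cases p x₀ y₀ x with rfl | rfl | rfl | rfl | ⟨h1, h2, h3, h4⟩ <;>
    rcases surg_cases p x₀ y₀ y with rfl | rfl | rfl | rfl | ⟨k1, k2, k3, k4⟩ <;>
    simp only [surg_x, surg_y, su, sv, ne_eq, not_true_eq_false] at hyx hypx ⊢ <;>
    try omega
    · rw [surg_other k1 k2 k3 k4]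
      obtain ⟨j1, j2, j3, j4⟩ := pair_other hinv k1 k2 k3 k4
      exact flip k1 k2 j1 j2 (hbtw' _ k1 k2 k3 k4)
    · rw [surg_other k1 k2 k3 k4]
      obtain ⟨j1, j2, j3, j4⟩ := pair_other hinv k1 k2 k3 k4
      exact (flip k1 k2 j1 j2 (hbtw' _ k1 k2 k3 k4)).symm
    · rw [surg_other k1 k2 k3 k4]
      obtain ⟨j1, j2, j3, j4⟩ := pair_other hinv k1 k2 k3 k4
      exact flip k3 k4 j3 j4 (huv' _ k1 k2 k3 k4)
    · rw [surg_other k1 k2 k3 k4]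
      obtain ⟨j1, j2, j3, j4⟩ := pair_other hinv k1 k2 k3 k4
      exact (flip k3 k4 j3 j4 (huv' _ k1 k2 k3 k4)).symm
    · rw [surg_other h1 h2 h3 h4]
      exact hbtw' _ h1 h2 h3 h4
    · rw [surg_other h1 h2 h3 h4, iff_comm (a := pos x < pos y₀),
        iff_comm (a := pos (p x) < pos y₀)]
      exact hbtw' _ h1 h2 h3 h4
    · rw [surg_other h1 h2 h3 h4]
      exact huv' _ h1 h2 h3 h4
    · rw [surg_other h1 h2 h3 h4, iff_comm (a := pos x < pos (p y₀)),
        iff_comm (a := pos (p x) < pos (p y₀))]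
      exact huv' _ h1 h2 h3 h4
    · rw [surg_other h1 h2 h3 h4] at hypx ⊢
      rw [surg_other k1 k2 k3 k4]
      exact h.sep hpos hyx hypx

end surgery

/-! ### Connectivity in a glued picture -/

/-- Connectivity of points under two pairings. -/
def cs {X : Type} (p q : X → X) : Setoid X := Relation.EqvGen.setoid fun x y => p x = y ∨ q x = y

section conn
variable {X : Type} {p q : X → X} {x₀ y₀ : X}

lemma cs_p (p q : X → X) (x : X) : (cs p q).r x (p x) := .rel _ _ (.inl rfl)

lemma cs_q (p q : X → X) (x : X) : (cs p q).r x (q x) := .rel _ _ (.inr rfl)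

lemma cs_map {Y : Type} {p' q' : Y → Y} (f : X → Y)
    (hp : ∀ x, (cs p' q').r (f x) (f (p x))) (hq : ∀ x, (cs p' q').r (f x) (f (q x))) {x y : X}
    (h : (cs p q).r x y) : (cs p' q').r (f x) (f y) := by
  induction h with
  | rel x y h =>
    rcases h with rfl | rfl
    · exact hp x
    · exact hq x
  | refl x => exact .refl _
  | symm x y _ ih => exact .symm _ _ ih
  | trans x y z _ _ ih1 ih2 => exact .trans _ _ _ ih1 ih2

/-- A set stable under both pairings is stable under connectivity. -/
lemma cs_stable {S : X → Prop} (hp : ∀ x, S x ↔ S (p x)) (hq : ∀ x, S x ↔ S (q x)) {x y : X}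
    (h : (cs p q).r x y) : S x ↔ S y := by
  induction h with
  | rel x y h =>
    rcases h with rfl | rfl
    · exact hp x
    · exact hq x
  | refl x => rfl
  | symm x y _ ih => exact ih.symm
  | trans x y z _ _ ih1 ih2 => exact ih1.trans ih2

/-- Retraction away from the pair `x₀, y₀`. -/
noncomputable def retr (p : X → X) (x₀ y₀ : X) : X → X := fun z =>
  if z = x₀ ∨ z = y₀ then p z else z

variable (hinv : ∀ x, p (p x) = x) (hfpf : ∀ x, p x ≠ x) (hxy : p x₀ ≠ y₀)
  (hqinv : ∀ x, q (q x) = x) (hq : q x₀ = y₀)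
include hinv hfpf hxy hqinv hq

omit hfpf hinv hxy in
lemma q_y : q y₀ = x₀ := by rw [← hq, hqinv]

omit hqinv hq in
lemma retr_ne (z : X) : retr p x₀ y₀ z ≠ x₀ ∧ retr p x₀ y₀ z ≠ y₀ := by
  have := ne_of_pair_ne hinv hxy
  unfold retr
  split_ifs with h
  · rcases h with rfl | rfl
    · exact ⟨hfpf _, hxy⟩
    · exact ⟨this, hfpf _⟩
  · tauto

omit hinv hfpf hxy hqinv hq in
lemma retr_of_ne {z : X} (h1 : z ≠ x₀) (h2 : z ≠ y₀) : retr p x₀ y₀ z = z := by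
  unfold retr; rw [if_neg (by tauto)]

lemma cs_surg_of_cs {x y : X} (h : (cs p q).r x y) :
    (cs (surg p x₀ y₀) q).r (retr p x₀ y₀ x) (retr p x₀ y₀ y) := by
  have hqy : q y₀ = x₀ := q_y hqinv hq
  have su := surg_u hfpf hxy
  have sv := surg_v hinv hfpf hxy
  have hvx := ne_of_pair_ne hinv hxy
  have ru : retr p x₀ y₀ (p x₀) = p x₀ := retr_of_ne (hfpf _) hxy
  have rv : retr p x₀ y₀ (p y₀) = p y₀ := retr_of_ne hvx (hfpf _)
  have rx : retr p x₀ y₀ x₀ = p x₀ := by simp [retr]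
  have ry : retr p x₀ y₀ y₀ = p y₀ := by simp [retr]
  refine cs_map (retr p x₀ y₀) (fun z => ?_) (fun z => ?_) h
  · rcases surg_cases p x₀ y₀ z with rfl | rfl | rfl | rfl | ⟨h1, h2, h3, h4⟩
    · rw [rx, ru]
    · rw [ry, rv]
    · rw [ru, hinv, rx]
    · rw [rv, hinv, ry]
    · obtain ⟨k1, k2, -, -⟩ := pair_other hinv h1 h2 h3 h4
      rw [retr_of_ne h1 h2, retr_of_ne k1 k2, ← surg_other h1 h2 h3 h4]
      exact cs_p _ _ _
  · by_cases h1 : z = x₀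
    · rw [h1, hq, rx, ry, ← su]; exact cs_p _ _ _
    by_cases h2 : z = y₀
    · rw [h2, hqy, rx, ry, ← sv]; exact cs_p _ _ _
    rw [retr_of_ne h1 h2, retr_of_ne]
    · exact cs_q _ _ _
    · intro e; exact h2 (by rw [← hqinv z, e, hq])
    · intro e; exact h1 (by rw [← hqinv z, e, hqy])

lemma cs_of_cs_surg {x y : X} (h : (cs (surg p x₀ y₀) q).r x y) : (cs p q).r x y := by
  have hqy : q y₀ = x₀ := q_y hqinv hq
  have su := surg_u hfpf hxy
  have sv := surg_v hinv hfpf hxy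
  refine cs_map (p := surg p x₀ y₀) (q := q) (p' := p) (q' := q) (fun z => z) (fun z => ?_)
    (fun z => cs_q _ _ _) h
  rcases surg_cases p x₀ y₀ z with rfl | rfl | rfl | rfl | ⟨h1, h2, h3, h4⟩
  · rw [surg_x, ← hq]; exact cs_q _ _ _
  · rw [surg_y, ← hqy]; exact cs_q _ _ _
  · rw [su]
    refine .trans _ _ _ (.symm _ _ (cs_p p q x₀)) (.trans _ y₀ _ ?_ (cs_p p q y₀))
    rw [← hq]; exact cs_q _ _ _
  · rw [sv]
    refine .trans _ _ _ (.symm _ _ (cs_p p q y₀)) (.trans _ x₀ _ ?_ (cs_p p q x₀))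
    rw [← hqy]; exact cs_q _ _ _
  · rw [surg_other h1 h2 h3 h4]; exact cs_p _ _ _

omit hinv hfpf hxy hqinv hq in
lemma cs_retr (z : X) : (cs p q).r (retr p x₀ y₀ z) z := by
  unfold retr
  split_ifs
  · exact .symm _ _ (cs_p _ _ _)
  · exact .refl _

lemma cs_iff_surg {x y : X} :
    (cs p q).r x y ↔ (cs (surg p x₀ y₀) q).r (retr p x₀ y₀ x) (retr p x₀ y₀ y) := by
  refine ⟨cs_surg_of_cs hinv hfpf hxy hqinv hq, fun h => ?_⟩
  exact .trans _ _ _ (.symm _ _ (cs_retr x))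
    (.trans _ _ _ (cs_of_cs_surg hinv hfpf hxy hqinv hq h) (cs_retr y))

lemma cs_surg_pair {z : X} (h : (cs (surg p x₀ y₀) q).r x₀ z) : z = x₀ ∨ z = y₀ := by
  have hqy : q y₀ = x₀ := q_y hqinv hq
  have hne : x₀ ≠ y₀ ∨ x₀ = y₀ := by tauto
  have hqx : ∀ z, q z = x₀ → z = y₀ := fun z e => by rw [← hqinv z, e, hq]
  have hqy' : ∀ z, q z = y₀ → z = x₀ := fun z e => by rw [← hqinv z, e, hqy]
  have := cs_stable (p := surg p x₀ y₀) (q := q) (S := fun z => z = x₀ ∨ z = y₀)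
    (fun z => ?_) (fun z => ?_) h
  · simpa using this
  · have su := surg_u hfpf hxy
    have sv := surg_v hinv hfpf hxy
    have hvx := ne_of_pair_ne hinv hxy
    rcases surg_cases p x₀ y₀ z with rfl | rfl | rfl | rfl | ⟨h1, h2, h3, h4⟩
    · simp [surg_x]
    · simp [surg_y]
    · simp [su, hfpf, hxy, hvx]
    · simp [sv, hfpf, hxy, hvx]
    · obtain ⟨k1, k2, -, -⟩ := pair_other hinv h1 h2 h3 h4
      simp [surg_other h1 h2 h3 h4, h1, h2, k1, k2]
  · constructor
    · rintro (rfl | rfl)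
      · exact .inr hq
      · exact .inl hqy
    · rintro (h | h)
      · exact .inr (hqx _ h)
      · exact .inl (hqy' _ h)

end conn

/-- The components not containing any point of `S`. -/
abbrev ClosedClass {X : Type} (r : Setoid X) (S : X → Prop) : Type :=
  {c : Quotient r // ∀ x, S x → Quotient.mk r x ≠ c}

lemma card_closed_surg {X : Type} [Finite X] {p q : X → X} {x₀ y₀ : X}
    (hinv : ∀ x, p (p x) = x) (hfpf : ∀ x, p x ≠ x) (hxy : p x₀ ≠ y₀)
    (hqinv : ∀ x, q (q x) = x) (hq : q x₀ = y₀) {S : X → Prop} (hx : ¬ S x₀) (hy : ¬ S y₀) :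
    Nat.card (ClosedClass (cs (surg p x₀ y₀) q) S) = Nat.card (ClosedClass (cs p q) S) + 1 := by
  have hS : ∀ z, S z → retr p x₀ y₀ z = z := fun z hz =>
    retr_of_ne (fun e => hx (e ▸ hz)) (fun e => hy (e ▸ hz))
  have key := fun x y => cs_iff_surg (x := x) (y := y) hinv hfpf hxy hqinv hq
  have pairc := fun z => cs_surg_pair (z := z) hinv hfpf hxy hqinv hq
  let g : Quotient (cs p q) → Quotient (cs (surg p x₀ y₀) q) :=
    Quotient.map' (retr p x₀ y₀) (fun x y h => (key x y).1 h)
  have g_mk : ∀ z, g (Quotient.mk _ z) = Quotient.mk _ (retr p x₀ y₀ z) := fun z => rfl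
  have g_inj : Function.Injective g := by
    intro c c'
    induction c using Quotient.inductionOn
    induction c' using Quotient.inductionOn
    intro h
    rw [g_mk, g_mk] at h
    exact Quotient.sound ((key _ _).2 (Quotient.exact h))
  have hg0 : ∀ c, g c ≠ Quotient.mk _ x₀ := by
    intro c
    induction c using Quotient.inductionOn with | h z => ?_
    intro h
    have := retr_ne hinv hfpf hxy z
    rcases pairc _ (Quotient.exact h.symm) with h | h
    · exact this.1 h
    · exact this.2 h
  let F : Option (ClosedClass (cs p q) S) → ClosedClass (cs (surg p x₀ y₀) q) S := fun o =>
    o.elim ⟨Quotient.mk _ x₀, fun z hz h => by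
      rcases pairc _ (Quotient.exact h.symm) with rfl | rfl
      · exact hx hz
      · exact hy hz⟩
    fun c => ⟨g c.1, fun z hz h => by
      rw [← hS z hz, ← g_mk] at h
      exact c.2 z hz (g_inj h)⟩
  have hF : Function.Bijective F := by
    constructor
    · rintro (_ | c) (_ | c') h
      · rfl
      · exact absurd (congrArg Subtype.val h).symm (hg0 _)
      · exact absurd (congrArg Subtype.val h) (hg0 _)
      · exact congrArg some (Subtype.ext (g_inj (congrArg Subtype.val h)))
    · rintro ⟨c, hc⟩
      induction c using Quotient.inductionOn with | h z => ?_
      by_cases h1 : z = x₀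
      · exact ⟨none, Subtype.ext (by subst h1; rfl)⟩
      by_cases h2 : z = y₀
      · refine ⟨none, Subtype.ext (Quotient.sound ?_)⟩
        subst h2
        have := cs_q (surg p x₀ z) q x₀
        rwa [hq] at this
      have h3 : g (Quotient.mk _ z) = Quotient.mk _ z := by rw [g_mk, retr_of_ne h1 h2]
      refine ⟨some ⟨Quotient.mk _ z, fun w hw h => hc w hw ?_⟩, Subtype.ext h3⟩
      rw [← h3, ← h, g_mk, hS w hw]
  rw [← Nat.card_eq_of_bijective F hF, Finite.card_option]
end

section
/-! ### State sums -/

/-- Local weight of a point `x` on the strand `{x, p x}` in the state `σ`. -/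
noncomputable def hW (τ : ℂ) {X : Type} (pos : X → ℕ) (p : X → X) (σ : X → Bool) (x : X) : ℂ :=
  if σ x = σ (p x) then 0 else if pos x < pos (p x) ∧ σ x = true then τ⁻¹ else 1

/-- The weight of a state `σ` on the matching `p`. -/
noncomputable def Phi (τ : ℂ) {X : Type} [Fintype X] (pos : X → ℕ) (p : X → X) (σ : X → Bool) :
    ℂ := ∏ x, hW τ pos p σ x

/-- Local weight on a glued pair. -/
noncomputable def gw (τ : ℂ) (b : Bool) : ℂ := if b then τ else 1

section glue
variable {O G : Type} [Fintype O] [Fintype G] {τ : ℂ}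

/-- The state of a glued picture with outer state `o` and inner state `t`. -/
def gst (o : O → Bool) (t : G → Bool) : O ⊕ (G ⊕ G) → Bool :=
  Sum.elim o (Sum.elim (fun j => !t j) t)

/-- The state sum of a glued picture. -/
noncomputable def Zg (τ : ℂ) (pos : O ⊕ (G ⊕ G) → ℕ) (p : O ⊕ (G ⊕ G) → O ⊕ (G ⊕ G))
    (o : O → Bool) : ℂ :=
  ∑ t : G → Bool, (∏ j, gw τ (t j)) * Phi τ pos p (gst o t)

/-- The gluing involution. -/
def gq : O ⊕ (G ⊕ G) → O ⊕ (G ⊕ G) := Sum.map id Sum.swap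

omit [Fintype O] [Fintype G] in
lemma gq_gq (x : O ⊕ (G ⊕ G)) : gq (gq x) = x := by
  rcases x with x | x | x <;> rfl

/-- The local weights around a glued pair. -/
noncomputable def coreW (τ : ℂ) (b α β : Bool) (a c u v : Prop) : ℂ :=
  (if (!b) = α then 0 else if a ∧ (!b) = true then τ⁻¹ else 1) *
  (if b = β then 0 else if c ∧ b = true then τ⁻¹ else 1) *
  (if α = (!b) then 0 else if u ∧ α = true then τ⁻¹ else 1) *
  (if β = b then 0 else if v ∧ β = true then τ⁻¹ else 1)

noncomputable def coreW' (τ : ℂ) (b α β : Bool) (a c u v : Prop) : ℂ :=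
  (if (!b) = b then 0 else if a ∧ (!b) = true then τ⁻¹ else 1) *
  (if b = (!b) then 0 else if c ∧ b = true then τ⁻¹ else 1) *
  (if α = β then 0 else if u ∧ α = true then τ⁻¹ else 1) *
  (if β = α then 0 else if v ∧ β = true then τ⁻¹ else 1)

lemma core_identity (hτ : τ ≠ 0) (a c u v : ℕ) (α β : Bool) (hac : a < c)
    (hu : u < a ∨ c < u) (hv : v < a ∨ c < v) (huv : u ≠ v)
    (n1 : ¬ (u < v ∧ v < a)) (n2 : ¬ (c < u ∧ u < v)) (n3 : ¬ (v < a ∧ c < u)) :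
    gw τ true * (coreW' τ true α β (a < c) (c < a) (u < v) (v < u) -
      (τ + τ⁻¹) * coreW τ true α β (a < u) (c < v) (u < a) (v < c)) +
    gw τ false * (coreW' τ false α β (a < c) (c < a) (u < v) (v < u) -
      (τ + τ⁻¹) * coreW τ false α β (a < u) (c < v) (u < a) (v < c)) = 0 := by
  have e1 : ¬ c < a := by omega
  rcases hu with hu | hu <;> rcases hv with hv | hv
  · have e2 : v < u := by omega
    have e3 : ¬ u < v := by omega
    have e4 : ¬ a < u := by omega
    have e5 : ¬ c < v := by omega
    have e6 : v < c := by omega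
    cases α <;> cases β <;> simp [coreW, coreW', gw, *] <;> field_simp <;> ring
  · have e2 : u < v := by omega
    have e3 : ¬ v < u := by omega
    have e4 : ¬ a < u := by omega
    have e6 : ¬ v < c := by omega
    cases α <;> cases β <;> simp [coreW, coreW', gw, *] <;> field_simp <;> ring
  · omega
  · have e2 : v < u := by omega
    have e3 : ¬ u < v := by omega
    have e4 : a < u := by omega
    have e5 : ¬ u < a := by omega
    have e6 : ¬ v < c := by omega
    cases α <;> cases β <;> simp [coreW, coreW', gw, *] <;> field_simp <;> ring

lemma prod_four {X : Type} [Fintype X] [DecidableEq X] (f : X → ℂ) {x y u v : X}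
    (h1 : x ≠ y) (h2 : x ≠ u) (h3 : x ≠ v) (h4 : y ≠ u) (h5 : y ≠ v) (h6 : u ≠ v) :
    ∏ z, f z = f x * f y * f u * f v * ∏ z ∈ ({x, y, u, v} : Finset X)ᶜ, f z := by
  rw [← Finset.prod_mul_prod_compl ({x, y, u, v} : Finset X)]
  rw [Finset.prod_insert (by simp [*]), Finset.prod_insert (by simp [*]),
    Finset.prod_insert (by simp [*]), Finset.prod_singleton]
  ring

/-- Resolving one glued pair multiplies the state sum by the loop value. -/
lemma Zg_surg (hτ : τ ≠ 0) {pos : O ⊕ (G ⊕ G) → ℕ} (hpos : Function.Injective pos)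
    {p : O ⊕ (G ⊕ G) → O ⊕ (G ⊕ G)} (h : IsNC pos p) (j : G)
    (hxy : p (.inr (.inl j)) ≠ .inr (.inr j))
    (hlt : pos (.inr (.inl j)) < pos (.inr (.inr j)))
    (hbtw : ∀ z, pos (.inr (.inl j)) < pos z → pos z < pos (.inr (.inr j)) →
      pos (.inr (.inl j)) < pos (p z) ∧ pos (p z) < pos (.inr (.inr j))) (o : O → Bool) :
    Zg τ pos (surg p (.inr (.inl j)) (.inr (.inr j))) o = (τ + τ⁻¹) * Zg τ pos p o := by
  set x₀ : O ⊕ (G ⊕ G) := .inr (.inl j) with hx₀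
  set y₀ : O ⊕ (G ⊕ G) := .inr (.inr j) with hy₀
  have hne : x₀ ≠ y₀ := by simp [hx₀, hy₀]
  have hvx := ne_of_pair_ne h.inv hxy
  have su := surg_u h.fpf hxy
  have sv := surg_v h.inv h.fpf hxy
  have huv : p x₀ ≠ p y₀ := fun e => hne (by rw [← h.inv x₀, e, h.inv])
  have hg : ∀ (t : G → Bool) z, z ≠ x₀ → z ≠ y₀ →
      gst o (Function.update t j (!t j)) z = gst o t z := by
    rintro t (z | z | z) h1 h2
    · rfl
    · have : z ≠ j := by rintro rfl; exact h1 rfl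
      change (!Function.update t j (!t j) z) = !t z
      rw [Function.update_of_ne this]
    · have : z ≠ j := by rintro rfl; exact h2 rfl
      change Function.update t j (!t j) z = t z
      rw [Function.update_of_ne this]
  have gx : ∀ t : G → Bool, gst o t x₀ = !t j := fun t => rfl
  have gy : ∀ t : G → Bool, gst o t y₀ = t j := fun t => rfl
  let s : Finset (O ⊕ (G ⊕ G)) := {x₀, y₀, p x₀, p y₀}
  have hs : ∀ z ∈ sᶜ, z ≠ x₀ ∧ z ≠ y₀ ∧ z ≠ p x₀ ∧ z ≠ p y₀ := fun z hz => by
    simpa [s] using hz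
  let R : (G → Bool) → ℂ := fun t =>
    (∏ i ∈ Finset.univ.erase j, gw τ (t i)) * ∏ z ∈ sᶜ, hW τ pos p (gst o t) z
  have hR : ∀ t, R (Function.update t j (!t j)) = R t := by
    intro t
    simp only [R]
    congr 1
    · refine Finset.prod_congr rfl fun i hi => ?_
      rw [Function.update_of_ne (Finset.ne_of_mem_erase hi)]
    · refine Finset.prod_congr rfl fun z hz => ?_
      obtain ⟨h1, h2, h3, h4⟩ := hs z hz
      obtain ⟨k1, k2, -, -⟩ := pair_other h.inv h1 h2 h3 h4
      rw [hW, hW, hg t z h1 h2, hg t _ k1 k2]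
  have hf : ∀ t, (∏ i, gw τ (t i)) * Phi τ pos p (gst o t) = gw τ (t j) * R t *
      coreW τ (t j) (gst o t (p x₀)) (gst o t (p y₀)) (pos x₀ < pos (p x₀)) (pos y₀ < pos (p y₀))
        (pos (p x₀) < pos x₀) (pos (p y₀) < pos y₀) := by
    intro t
    rw [Phi, prod_four _ hne (h.fpf x₀).symm hvx.symm hxy.symm (h.fpf y₀).symm huv,
      ← Finset.mul_prod_erase _ _ (Finset.mem_univ j)]
    simp only [R, s, hW, h.inv, gx, gy, coreW]
    ring_nf
  have hf' : ∀ t, (∏ i, gw τ (t i)) * Phi τ pos (surg p x₀ y₀) (gst o t) = gw τ (t j) * R t *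
      coreW' τ (t j) (gst o t (p x₀)) (gst o t (p y₀)) (pos x₀ < pos y₀) (pos y₀ < pos x₀)
        (pos (p x₀) < pos (p y₀)) (pos (p y₀) < pos (p x₀)) := by
    intro t
    have : ∏ z ∈ sᶜ, hW τ pos p (gst o t) z = ∏ z ∈ sᶜ, hW τ pos (surg p x₀ y₀) (gst o t) z := by
      refine Finset.prod_congr rfl fun z hz => ?_
      obtain ⟨h1, h2, h3, h4⟩ := hs z hz
      rw [hW, hW, surg_other h1 h2 h3 h4]
    rw [Phi, prod_four _ hne (h.fpf x₀).symm hvx.symm hxy.symm (h.fpf y₀).symm huv,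
      ← Finset.mul_prod_erase _ _ (Finset.mem_univ j)]
    simp only [R, this]
    simp only [hW, su, sv, surg_x, surg_y, gx, gy, coreW', s]
    ring_nf
  rw [← sub_eq_zero, Zg, Zg, Finset.mul_sum, ← Finset.sum_sub_distrib]
  have nu : pos (p x₀) < pos x₀ ∨ pos y₀ < pos (p x₀) := by
    have := hpos.ne (h.fpf x₀)
    have := hpos.ne hxy
    have := hbtw (p x₀)
    rw [h.inv] at this
    omega
  have nv : pos (p y₀) < pos x₀ ∨ pos y₀ < pos (p y₀) := by
    have := hpos.ne (h.fpf y₀)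
    have := hpos.ne hvx
    have := hbtw (p y₀)
    rw [h.inv] at this
    omega
  have c1 := h.nc (p x₀) (p y₀)
  have c2 := h.nc x₀ y₀
  have c3 := h.nc (p y₀) x₀
  simp only [h.inv] at c1 c2 c3
  have core := fun α β => core_identity hτ (pos x₀) (pos y₀) (pos (p x₀)) (pos (p y₀)) α β hlt nu nv
    (hpos.ne huv) (by omega) (by omega) (by omega)
  refine Finset.sum_involution (fun t _ => Function.update t j (!t j)) ?_ ?_ ?_ ?_
  · intro t _
    have := core (gst o t (p x₀)) (gst o t (p y₀))
    rw [hf, hf', hf, hf', hR, hg t _ (h.fpf x₀) hxy, hg t _ hvx (h.fpf y₀),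
      Function.update_self]
    cases t j <;> simp only [Bool.not_true, Bool.not_false]
    · linear_combination R t * this
    · linear_combination R t * this
  · intro t _ _ e
    have := congrFun e j
    simp at this
  · intro t _; simp
  · intro t _; simp
end glue
end

section
section glue
variable {O G : Type} [Fintype O] [Fintype G] {τ : ℂ}

/-- The number of closed components of a glued picture. -/
noncomputable def gloops (p : O ⊕ (G ⊕ G) → O ⊕ (G ⊕ G)) : ℕ :=
  Nat.card (ClosedClass (cs p gq) fun x => ∃ o, x = Sum.inl o)

/-- Gluing when all glued pairs are closed up by `p`. -/
lemma glue_resolved {pos : O ⊕ (G ⊕ G) → ℕ}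
    {p : O ⊕ (G ⊕ G) → O ⊕ (G ⊕ G)} (h : IsNC pos p)
    (hlt : ∀ j, pos (.inr (.inl j)) < pos (.inr (.inr j)))
    (hres : ∀ j, p (.inr (.inl j)) = .inr (.inr j)) :
    ∃ c : O → O, IsNC (pos ∘ Sum.inl) c ∧
      (∀ x, (cs p gq).r (.inl x) (.inl (c x))) ∧
      (∀ x y, (cs p gq).r (.inl x) (.inl y) → y = x ∨ y = c x) ∧
      ∀ o, Zg τ pos p o = (τ + τ⁻¹) ^ gloops p * Phi τ (pos ∘ Sum.inl) c o := by
  have hres' : ∀ j, p (.inr (.inr j)) = .inr (.inl j) := fun j => by rw [← hres, h.inv]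
  have hO : ∀ x, ∃ y, p (Sum.inl x) = Sum.inl y := by
    intro x
    rcases hp : p (Sum.inl x) with y | j | j
    · exact ⟨y, rfl⟩
    · have := h.inv (Sum.inl x); rw [hp, hres] at this; cases this
    · have := h.inv (Sum.inl x); rw [hp, hres'] at this; cases this
  choose c hc using hO
  have hcc : ∀ x, c (c x) = x := fun x => Sum.inl_injective (by rw [← hc, ← hc, h.inv])
  have hl : gloops p = Fintype.card G := by
    rw [gloops, ← Nat.card_eq_fintype_card]
    symm
    have hst : ∀ j z, (cs p gq).r (.inr (.inl j)) z → z = .inr (.inl j) ∨ z = .inr (.inr j) := by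
      intro j z hz
      have := cs_stable (p := p) (q := gq)
        (S := fun z => z = .inr (.inl j) ∨ z = .inr (.inr j)) ?_ ?_ hz
      · simpa using this
      · rintro (z | z | z) <;> simp [hc, hres, hres']
      · rintro (z | z | z) <;> simp [gq]
    refine Nat.card_eq_of_bijective (fun j => ⟨Quotient.mk _ (.inr (.inl j)), ?_⟩) ⟨?_, ?_⟩
    · rintro _ ⟨o, rfl⟩ e
      have := hst j _ (Quotient.exact e.symm)
      simp at this
    · intro i j e
      have := hst i _ (Quotient.exact (congrArg Subtype.val e))
      simpa [eq_comm] using this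
    · rintro ⟨z, hz⟩
      induction z using Quotient.inductionOn with | h z => ?_
      rcases z with z | j | j
      · exact absurd rfl (hz _ ⟨z, rfl⟩)
      · exact ⟨j, rfl⟩
      · exact ⟨j, Subtype.ext (Quotient.sound (cs_q p gq (.inr (.inl j))))⟩
  refine ⟨c, ⟨hcc, fun x e => h.fpf (Sum.inl x) (by rw [hc, e]), fun x y => ?_⟩, fun x => ?_,
    fun x y hxy => ?_, fun o => ?_⟩
  · have := h.nc (Sum.inl x) (Sum.inl y)
    rwa [hc, hc] at this
  · rw [← hc]; exact cs_p _ _ _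
  · have := cs_stable (p := p) (q := gq)
      (S := fun z => z = .inl x ∨ z = .inl (c x)) ?_ ?_ hxy
    · simpa using this
    · rintro (z | z | z) <;> simp [hc, hres, hres']
      constructor
      · rintro (rfl | rfl)
        · exact .inr rfl
        · exact .inl (hcc _)
      · rintro (e | e)
        · exact .inr (by rw [← e, hcc])
        · exact .inl (by rw [← hcc z, e, hcc])
    · rintro (z | z | z) <;> simp [gq]
  · have key : ∀ t : G → Bool, (∏ j, gw τ (t j)) * Phi τ pos p (gst o t) =
        (∏ j, (if t j then τ else τ⁻¹)) * Phi τ (pos ∘ Sum.inl) c o := by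
      intro t
      rw [Phi, Fintype.prod_sum_type, Fintype.prod_sum_type, ← Finset.prod_mul_distrib,
        mul_left_comm, ← Finset.prod_mul_distrib, mul_comm]
      congr 1
      · refine Finset.prod_congr rfl fun j _ => ?_
        have := hlt j
        have h2 : ¬ pos (.inr (.inr j)) < pos (.inr (.inl j)) := by omega
        simp only [hW, hres, hres', gst, Sum.elim_inr, Sum.elim_inl, gw]
        cases t j <;> simp [this, h2]
      · refine Finset.prod_congr rfl fun x _ => ?_
        simp [hW, hc, gst]
    rw [Zg, hl]
    simp_rw [key]
    rw [← Finset.sum_mul]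
    congr 1
    have := Finset.prod_univ_sum (fun _ : G => (Finset.univ : Finset Bool))
      (fun _ b => if b = true then τ else τ⁻¹)
    rw [Fintype.piFinset_univ] at this
    rw [← this]
    simp

/-- **Gluing theorem.** A glued picture reduces to a matching of the outer points times a power
of the loop value, compatibly with state sums. -/
theorem glue (hτ : τ ≠ 0) (hd : τ + τ⁻¹ ≠ 0) {pos : O ⊕ (G ⊕ G) → ℕ}
    (hpos : Function.Injective pos)
    (hlt : ∀ j, pos (.inr (.inl j)) < pos (.inr (.inr j)))
    (hnest : ∀ j z, pos (.inr (.inl j)) < pos z → pos z < pos (.inr (.inr j)) →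
      ∃ i, (z = .inr (.inl i) ∨ z = .inr (.inr i)) ∧
        pos (.inr (.inl j)) < pos (.inr (.inl i)) ∧ pos (.inr (.inr i)) < pos (.inr (.inr j)))
    {p : O ⊕ (G ⊕ G) → O ⊕ (G ⊕ G)} (h : IsNC pos p) :
    ∃ c : O → O, IsNC (pos ∘ Sum.inl) c ∧
      (∀ x, (cs p gq).r (.inl x) (.inl (c x))) ∧
      (∀ x y, (cs p gq).r (.inl x) (.inl y) → y = x ∨ y = c x) ∧
      ∀ o, Zg τ pos p o = (τ + τ⁻¹) ^ gloops p * Phi τ (pos ∘ Sum.inl) c o := by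
  obtain ⟨N, hN⟩ : ∃ N, (Finset.univ.filter
    fun j : G => p (.inr (.inl j)) ≠ .inr (.inr j)).card = N := ⟨_, rfl⟩
  induction N using Nat.strong_induction_on generalizing p with
  | _ N ih =>
  by_cases hne : (Finset.univ.filter fun j : G => p (.inr (.inl j)) ≠ .inr (.inr j)).Nonempty
  swap
  · refine glue_resolved h hlt fun j => ?_
    by_contra hj
    exact hne ⟨j, by simpa using hj⟩
  obtain ⟨j, hj, hmin⟩ := Finset.exists_min_image _
    (fun j => pos (.inr (.inr j)) - pos (.inr (.inl j))) hne
  simp only [Finset.mem_filter, Finset.mem_univ, true_and] at hj hmin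
  have hbtw : ∀ z, pos (.inr (.inl j)) < pos z → pos z < pos (.inr (.inr j)) →
      pos (.inr (.inl j)) < pos (p z) ∧ pos (p z) < pos (.inr (.inr j)) := by
    intro z h1 h2
    obtain ⟨i, hz, h3, h4⟩ := hnest j z h1 h2
    have hi : p (.inr (.inl i)) = .inr (.inr i) := by
      by_contra hi
      have := hmin i hi
      have := hlt i
      omega
    have := hlt i
    rcases hz with rfl | rfl
    · rw [hi]; omega
    · rw [← hi, h.inv]; omega
  have hx0 : (Sum.inr (Sum.inl j) : O ⊕ (G ⊕ G)) ≠ .inr (.inr j) := by simp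
  have h' := surg_isNC h.inv h.fpf hj hx0 hpos h hbtw (hlt j)
  have hcard : (Finset.univ.filter fun i : G =>
      surg p (.inr (.inl j)) (.inr (.inr j)) (.inr (.inl i)) ≠ .inr (.inr i)).card < N := by
    rw [← hN]
    apply Finset.card_lt_card
    rw [Finset.ssubset_iff_of_subset]
    · exact ⟨j, by simpa using hj, by simp [surg_x]⟩
    · intro i
      simp only [Finset.mem_filter, Finset.mem_univ, true_and]
      contrapose!
      intro hi
      by_cases hij : i = j
      · subst hij; exact surg_x
      rw [surg_other _ _ _ _, hi]
      · simpa using hij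
      · simp
      · intro e; rw [e, h.inv] at hi; simp at hi
      · intro e; rw [e, h.inv] at hi; simp at hi; exact hij hi.symm
  obtain ⟨c, c1, c2, c3, c4⟩ := ih _ hcard h' rfl
  have hr : ∀ x : O, retr p (.inr (.inl j)) (.inr (.inr j)) (.inl x) = .inl x := fun x =>
    retr_of_ne (by simp) (by simp)
  have key := fun x y : O => cs_iff_surg (x := Sum.inl x) (y := Sum.inl y) h.inv h.fpf hj
    gq_gq rfl
  simp only [hr] at key
  refine ⟨c, c1, fun x => (key _ _).2 (c2 x), fun x y hxy => c3 x y ((key _ _).1 hxy), fun o => ?_⟩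
  have e1 := c4 o
  rw [Zg_surg hτ hpos h j hj (hlt j) hbtw, gloops,
    card_closed_surg h.inv h.fpf hj gq_gq rfl (by simp) (by simp), pow_succ', mul_assoc] at e1
  exact mul_left_cancel₀ hd e1
end glue
end

section
lemma Diagram.isNC {m n : ℕ} (D : Diagram m n) : IsNC (bIdx m n) D.pair :=
  ⟨D.involutive, D.fixedPointFree, D.noncrossing⟩

lemma Diagram.ext_pair {m n : ℕ} {D E : Diagram m n} (h : D.pair = E.pair) : D = E := by
  cases D; cases E; simpa using h

/-- The diagram of a noncrossing matching. -/
def IsNC.toDiagram {m n : ℕ} {p : Fin m ⊕ Fin n → Fin m ⊕ Fin n} (h : IsNC (bIdx m n) p) :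
    Diagram m n := ⟨p, h.inv, h.fpf, h.nc⟩

lemma bIdx_inj (m n : ℕ) : Function.Injective (bIdx m n) := by
  rintro (i | i) (j | j) h <;> simp only [bIdx] at h <;> have hi := i.isLt <;> have hj := j.isLt
  · exact congrArg _ (Fin.ext h)
  · omega
  · omega
  · exact congrArg _ (Fin.ext (by omega))

lemma IsNC.of_order {X : Type} {pos pos' : X → ℕ} (ho : ∀ x y, pos x < pos y ↔ pos' x < pos' y)
    {p : X → X} (h : IsNC pos p) : IsNC pos' p :=
  ⟨h.inv, h.fpf, fun x y => by simp only [← ho]; exact h.nc x y⟩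

lemma Phi_of_order {τ : ℂ} {X : Type} [Fintype X] {pos pos' : X → ℕ}
    (ho : ∀ x y, pos x < pos y ↔ pos' x < pos' y) (p : X → X) (σ : X → Bool) :
    Phi τ pos p σ = Phi τ pos' p σ := by
  simp only [Phi, hW, ho]

/-- The spin representation of a diagram. -/
noncomputable def FD (τ : ℂ) {m n : ℕ} (D : Diagram m n) (s : Fin m → Bool) (t : Fin n → Bool) :
    ℂ := (∏ j, gw τ (t j)) * Phi τ (bIdx m n) D.pair (Sum.elim s fun j => !t j)

/-- The spin representation of a morphism. -/
noncomputable def F (τ : ℂ) {m n : ℕ} (x : Hom ℂ m n) (s : Fin m → Bool) (t : Fin n → Bool) :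
    ℂ := ∑ D, x D * FD τ D s t

section comp
variable {l m n : ℕ}

/-- Position of the points in the glued picture of a composition. -/
def gpos (l m n : ℕ) : (Fin l ⊕ Fin n) ⊕ (Fin m ⊕ Fin m) → ℕ
  | .inl (.inl i) => i
  | .inr (.inl j) => l + (m - 1 - j)
  | .inr (.inr j) => l + m + j
  | .inl (.inr k) => l + m + m + (n - 1 - k)

def eA : Fin l ⊕ Fin m → (Fin l ⊕ Fin n) ⊕ (Fin m ⊕ Fin m) :=
  Sum.elim (fun i => .inl (.inl i)) fun j => .inr (.inl j)

def eB : Fin m ⊕ Fin n → (Fin l ⊕ Fin n) ⊕ (Fin m ⊕ Fin m) :=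
  Sum.elim (fun j => .inr (.inr j)) fun k => .inl (.inr k)

/-- The matching of the glued picture of a composition. -/
def gp (a : Diagram l m) (b : Diagram m n) :
    (Fin l ⊕ Fin n) ⊕ (Fin m ⊕ Fin m) → (Fin l ⊕ Fin n) ⊕ (Fin m ⊕ Fin m)
  | .inl (.inl i) => eA (a.pair (.inl i))
  | .inr (.inl j) => eA (a.pair (.inr j))
  | .inr (.inr j) => eB (b.pair (.inl j))
  | .inl (.inr k) => eB (b.pair (.inr k))

lemma gp_eA (a : Diagram l m) (b : Diagram m n) (u) : gp a b (eA u) = eA (a.pair u) := by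
  rcases u with u | u <;> rfl

lemma gp_eB (a : Diagram l m) (b : Diagram m n) (u) : gp a b (eB u) = eB (b.pair u) := by
  rcases u with u | u <;> rfl

lemma eAB_cases (x : (Fin l ⊕ Fin n) ⊕ (Fin m ⊕ Fin m)) : (∃ u, eA u = x) ∨ ∃ u, eB u = x := by
  rcases x with (x | x) | (x | x)
  · exact .inl ⟨.inl x, rfl⟩
  · exact .inr ⟨.inr x, rfl⟩
  · exact .inl ⟨.inr x, rfl⟩
  · exact .inr ⟨.inl x, rfl⟩

lemma gpos_eA (u : Fin l ⊕ Fin m) : gpos l m n (eA u) = bIdx l m u := by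
  rcases u with u | u <;> rfl

lemma gpos_eB (u : Fin m ⊕ Fin n) : gpos l m n (eB u) = l + m + bIdx m n u := by
  rcases u with u | u
  · rfl
  · simp only [eB, gpos, bIdx, Sum.elim_inr]; omega

lemma bIdx_lt (u : Fin l ⊕ Fin m) : bIdx l m u < l + m := by
  rcases u with u | u <;> have := u.isLt <;> simp only [bIdx] <;> omega

lemma eA_inj : Function.Injective (eA : Fin l ⊕ Fin m → (Fin l ⊕ Fin n) ⊕ (Fin m ⊕ Fin m)) := by
  rintro (u | u) (v | v) h <;> simp_all [eA]

lemma eB_inj : Function.Injective (eB : Fin m ⊕ Fin n → (Fin l ⊕ Fin n) ⊕ (Fin m ⊕ Fin m)) := by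
  rintro (u | u) (v | v) h <;> simp_all [eB]

lemma gp_isNC (a : Diagram l m) (b : Diagram m n) : IsNC (gpos l m n) (gp a b) := by
  refine ⟨fun x => ?_, fun x => ?_, fun x y => ?_⟩
  · rcases eAB_cases x with ⟨u, rfl⟩ | ⟨u, rfl⟩
    · rw [gp_eA, gp_eA, a.involutive]
    · rw [gp_eB, gp_eB, b.involutive]
  · rcases eAB_cases x with ⟨u, rfl⟩ | ⟨u, rfl⟩
    · rw [gp_eA]; exact eA_inj.ne (a.fixedPointFree u)
    · rw [gp_eB]; exact eB_inj.ne (b.fixedPointFree u)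
  · rcases eAB_cases x with ⟨u, rfl⟩ | ⟨u, rfl⟩ <;> rcases eAB_cases y with ⟨v, rfl⟩ | ⟨v, rfl⟩ <;>
      simp only [gp_eA, gp_eB, gpos_eA, gpos_eB]
    · exact a.noncrossing u v
    · have := bIdx_lt (a.pair u); omega
    · have := bIdx_lt v; omega
    · have := b.noncrossing u v; omega

/-- Collapse of the glued picture onto the stacked picture. -/
def gcol : (Fin l ⊕ Fin n) ⊕ (Fin m ⊕ Fin m) → Pt l m n
  | .inl (.inl i) => .inl i
  | .inr (.inl j) => .inr (.inl j)
  | .inr (.inr j) => .inr (.inl j)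
  | .inl (.inr k) => .inr (.inr k)

def gsec : Pt l m n → (Fin l ⊕ Fin n) ⊕ (Fin m ⊕ Fin m)
  | .inl i => .inl (.inl i)
  | .inr (.inl j) => .inr (.inl j)
  | .inr (.inr k) => .inl (.inr k)

lemma gcol_gsec (x : Pt l m n) : gcol (gsec x) = x := by
  rcases x with x | x | x <;> rfl

lemma gcol_eA (u : Fin l ⊕ Fin m) : gcol (n := n) (eA u) = Sum.map id Sum.inl u := by
  rcases u with u | u <;> rfl

lemma gcol_eB (u : Fin m ⊕ Fin n) : gcol (l := l) (eB u) = Sum.inr u := by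
  rcases u with u | u <;> rfl

lemma gcol_gq (x : (Fin l ⊕ Fin n) ⊕ (Fin m ⊕ Fin m)) : gcol (gq x) = gcol x := by
  rcases x with (x | x) | (x | x) <;> rfl

lemma gsec_gcol (p) (x : (Fin l ⊕ Fin n) ⊕ (Fin m ⊕ Fin m)) : (cs p gq).r (gsec (gcol x)) x := by
  rcases x with (x | x) | (x | x)
  · exact .refl _
  · exact .refl _
  · exact .refl _
  · exact cs_q p gq (.inr (.inl x))

lemma conn_iff (a : Diagram l m) (b : Diagram m n) (x y) :
    (cs (gp a b) gq).r x y ↔ Conn a b (gcol x) (gcol y) := by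
  constructor
  · intro h
    induction h with
    | rel x y h =>
      rcases h with rfl | rfl
      · rcases eAB_cases x with ⟨u, rfl⟩ | ⟨u, rfl⟩
        · rw [gp_eA, gcol_eA, gcol_eA]; exact .rel _ _ (.inl ⟨u, rfl, rfl⟩)
        · rw [gp_eB, gcol_eB, gcol_eB]; exact .rel _ _ (.inr ⟨u, rfl, rfl⟩)
      · rw [gcol_gq]; exact .refl _
    | refl x => exact .refl _
    | symm x y _ ih => exact .symm _ _ ih
    | trans x y z _ _ ih1 ih2 => exact .trans _ _ _ ih1 ih2
  · have main : ∀ x y, Conn a b x y → (cs (gp a b) gq).r (gsec x) (gsec y) := by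
      intro x y h
      induction h with
      | rel x y h =>
        rcases h with ⟨u, rfl, rfl⟩ | ⟨u, rfl, rfl⟩
        · rw [← gcol_eA, ← gcol_eA]
          refine .trans _ _ _ (gsec_gcol _ _) (.trans _ _ _ ?_ (.symm _ _ (gsec_gcol _ _)))
          rw [← gp_eA a b]; exact cs_p _ _ _
        · rw [← gcol_eB, ← gcol_eB]
          refine .trans _ _ _ (gsec_gcol _ _) (.trans _ _ _ ?_ (.symm _ _ (gsec_gcol _ _)))
          rw [← gp_eB a b]; exact cs_p _ _ _
      | refl x => exact .refl _
      | symm x y _ ih => exact .symm _ _ ih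
      | trans x y z _ _ ih1 ih2 => exact .trans _ _ _ ih1 ih2
    intro h
    exact .trans _ _ _ (.symm _ _ (gsec_gcol _ _)) (.trans _ _ _ (main _ _ h) (gsec_gcol _ _))

lemma gcol_inl (x : Fin l ⊕ Fin n) : gcol (m := m) (.inl x) = Sum.map id Sum.inr x := by
  rcases x with x | x <;> rfl

lemma numLoops_eq (a : Diagram l m) (b : Diagram m n) : numLoops a b = gloops (gp a b) := by
  have hout : ∀ (z : Pt l m n), (¬ ∃ j : Fin m, z = Sum.inr (Sum.inl j)) →
      ∃ o, gsec z = Sum.inl o := by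
    rintro (z | z | z) hz
    · exact ⟨_, rfl⟩
    · exact absurd ⟨z, rfl⟩ hz
    · exact ⟨_, rfl⟩
  have hmk : ∀ x : Pt l m n, x ∈ ClosedMid a b →
      ∀ z, (∃ o, z = Sum.inl o) → Quotient.mk (cs (gp a b) gq) z ≠ Quotient.mk _ (gsec x) := by
    rintro x hx _ ⟨o, rfl⟩ h
    have h1 := (conn_iff a b _ _).1 (Quotient.exact h.symm)
    rw [gcol_gsec] at h1
    obtain ⟨j, hj⟩ := hx.2 _ h1
    rcases o with o | o <;> simp [gcol] at hj
  rw [numLoops, gloops]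
  let f : ClosedMid a b → ClosedClass (cs (gp a b) gq) (fun x => ∃ o, x = Sum.inl o) :=
    fun x => ⟨Quotient.mk _ (gsec x.1), hmk x.1 x.2⟩
  refine Nat.card_eq_of_bijective (Quotient.lift f ?_) ⟨?_, ?_⟩
  · intro x y h
    refine Subtype.ext (Quotient.sound ((conn_iff a b _ _).2 ?_))
    rw [gcol_gsec, gcol_gsec]; exact h
  · intro x y
    induction x using Quotient.inductionOn
    induction y using Quotient.inductionOn
    intro h
    have := (conn_iff a b _ _).1 (Quotient.exact (congrArg Subtype.val h))
    rw [gcol_gsec, gcol_gsec] at this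
    exact Quotient.sound this
  · rintro ⟨z, hz⟩
    induction z using Quotient.inductionOn with | h z => ?_
    have hc : ∀ y, Conn a b (gcol z) y → ∃ j : Fin m, y = Sum.inr (Sum.inl j) := by
      intro y hy
      by_contra hn
      obtain ⟨o, ho⟩ := hout y hn
      refine hz _ ⟨o, rfl⟩ (Quotient.sound ((conn_iff a b _ _).2 ?_))
      rw [← ho, gcol_gsec]
      exact .symm _ _ hy
    refine ⟨Quotient.mk _ ⟨gcol z, hc _ (.refl _), hc⟩, Subtype.ext ?_⟩
    exact Quotient.sound (gsec_gcol _ z)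

lemma Phi_gp {τ : ℂ} (a : Diagram l m) (b : Diagram m n) (s : Fin l → Bool) (t : Fin m → Bool)
    (u : Fin n → Bool) :
    Phi τ (gpos l m n) (gp a b) (gst (Sum.elim s fun j => !u j) t) =
      Phi τ (bIdx l m) a.pair (Sum.elim s fun j => !t j) *
      Phi τ (bIdx m n) b.pair (Sum.elim t fun j => !u j) := by
  have sA : ∀ x, gst (Sum.elim s fun j => !u j) t (eA x) = Sum.elim s (fun j => !t j) x := by
    rintro (x | x) <;> rfl
  have sB : ∀ x, gst (Sum.elim s fun j => !u j) t (eB x) = Sum.elim t (fun j => !u j) x := by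
    rintro (x | x) <;> rfl
  have hA : ∀ x, hW τ (gpos l m n) (gp a b) (gst (Sum.elim s fun j => !u j) t) (eA x) =
      hW τ (bIdx l m) a.pair (Sum.elim s fun j => !t j) x := fun x => by
    simp only [hW, gp_eA, sA, gpos_eA]
  have hB : ∀ x, hW τ (gpos l m n) (gp a b) (gst (Sum.elim s fun j => !u j) t) (eB x) =
      hW τ (bIdx m n) b.pair (Sum.elim t fun j => !u j) x := fun x => by
    simp only [hW, gp_eB, sB, gpos_eB, add_lt_add_iff_left]
  have e : ∀ f : (Fin l ⊕ Fin n) ⊕ (Fin m ⊕ Fin m) → ℂ,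
      ∏ x, f x = (∏ x, f (eA x)) * ∏ x, f (eB x) := fun f => by
    simp only [Fintype.prod_sum_type, eA, eB, Sum.elim_inl, Sum.elim_inr]
    ring
  rw [Phi, e]
  simp only [hA, hB, Phi]

lemma gpos_inj : Function.Injective (gpos l m n) := by
  rintro ((i | i) | (i | i)) ((j | j) | (j | j)) h <;> simp only [gpos] at h <;>
    have hi := i.isLt <;> have hj := j.isLt <;> first | omega | skip
  all_goals simp only [Sum.inl.injEq, Sum.inr.injEq]; exact Fin.ext (by omega)

/-- Composition of two diagrams is a power of `d` times a diagram, and the spin representation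
is multiplicative. -/
theorem compD_spec {τ : ℂ} (hτ : τ ≠ 0) (hd : τ + τ⁻¹ ≠ 0) (a : Diagram l m) (b : Diagram m n) :
    ∃ c : Diagram l n, (∀ e, compD (τ + τ⁻¹) b a e =
        if e = c then (τ + τ⁻¹) ^ numLoops a b else 0) ∧
      ∀ s u, ∑ t, FD τ a s t * FD τ b t u = (τ + τ⁻¹) ^ numLoops a b * FD τ c s u := by
  obtain ⟨c, hc, c1, c2, c3⟩ := glue hτ hd (gpos_inj (l := l) (m := m) (n := n))
    (fun j => by simp only [gpos]; have := j.isLt; omega)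
    (fun j z h1 h2 => by
      rcases z with (z | z) | (z | z) <;> simp only [gpos] at h1 h2 <;> have := z.isLt <;>
        have := j.isLt
      · omega
      · omega
      · exact ⟨z, .inl rfl, by simp only [gpos]; omega, by simp only [gpos]; omega⟩
      · exact ⟨z, .inr rfl, by simp only [gpos]; omega, by simp only [gpos]; omega⟩) (gp_isNC a b)
  have ho : ∀ x y, (gpos l m n ∘ Sum.inl) x < (gpos l m n ∘ Sum.inl) y ↔
      bIdx l n x < bIdx l n y := by
    rintro (x | x) (y | y) <;> have := x.isLt <;> have := y.isLt <;>
      simp only [Function.comp, gpos, bIdx] <;> omega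
  refine ⟨(hc.of_order ho).toDiagram, fun e => ?_, fun s u => ?_⟩
  · unfold compD
    congr 1
    refine propext ⟨fun h => Diagram.ext_pair (funext fun x => ?_), ?_⟩
    · have := h x
      rw [← gcol_inl, ← gcol_inl, ← conn_iff] at this
      exact (c2 _ _ this).resolve_left (e.fixedPointFree x)
    · rintro rfl x
      rw [← gcol_inl, ← gcol_inl, ← conn_iff]
      exact c1 x
  · have := c3 (Sum.elim s fun j => !u j)
    rw [← numLoops_eq, Phi_of_order ho] at this
    simp only [FD]
    rw [mul_left_comm]
    change _ = _ * (_ * Phi τ (bIdx l n) c _)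
    rw [← this, Zg, Finset.mul_sum]
    refine Finset.sum_congr (by ext; simp) fun t _ => ?_
    rw [Phi_gp]
    ring

lemma F_comp {τ : ℂ} (hτ : τ ≠ 0) (hd : τ + τ⁻¹ ≠ 0) (a : Hom ℂ l m) (b : Hom ℂ m n) (s u) :
    F τ (comp (τ + τ⁻¹) b a) s u = ∑ t, F τ a s t * F τ b t u := by
  have key : ∀ (p : Diagram m n) (q : Diagram l m),
      ∑ c, compD (τ + τ⁻¹) p q c * FD τ c s u = ∑ t, FD τ q s t * FD τ p t u := by
    intro p q
    obtain ⟨c, h1, h2⟩ := compD_spec hτ hd q p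
    rw [h2]
    simp [h1]
  simp only [F, comp]
  simp_rw [Finset.sum_mul]
  rw [Finset.sum_comm]
  simp_rw [Finset.sum_comm (s := (Finset.univ : Finset (Diagram l n))), mul_assoc, 
    ← Finset.mul_sum, key, Finset.mul_sum]
  simp_rw [Finset.sum_comm (t := (Finset.univ : Finset (Fin m → Bool)))]
  refine Finset.sum_congr rfl fun t _ => ?_
  rw [Finset.sum_comm]
  refine Finset.sum_congr rfl fun p _ => Finset.sum_congr rfl fun q _ => ?_
  ring
end comp
end

section
section trace
variable {G : Type} [Fintype G] {τ : ℂ}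

/-- The state sum of a closed picture. -/
lemma glue_trace (hτ : τ ≠ 0) (hd : τ + τ⁻¹ ≠ 0) {pos : G ⊕ G → ℕ}
    (hpos : Function.Injective pos) (hlt : ∀ j, pos (.inl j) < pos (.inr j))
    (hnest : ∀ j z, pos (.inl j) < pos z → pos z < pos (.inr j) →
      ∃ i, (z = .inl i ∨ z = .inr i) ∧ pos (.inl j) < pos (.inl i) ∧ pos (.inr i) < pos (.inr j))
    {p : G ⊕ G → G ⊕ G} (h : IsNC pos p) :
    ∑ t : G → Bool, (∏ j, gw τ (t j)) * Phi τ pos p (Sum.elim (fun j => !t j) t) =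
      (τ + τ⁻¹) ^ Nat.card (Quotient (cs p Sum.swap)) := by
  let pos' : Empty ⊕ (G ⊕ G) → ℕ := Sum.elim Empty.elim pos
  let p' : Empty ⊕ (G ⊕ G) → Empty ⊕ (G ⊕ G) := Sum.map id p
  have h' : IsNC pos' p' := by
    refine ⟨?_, ?_, ?_⟩
    · rintro (x | x)
      · exact x.elim
      · simp [p', h.inv x]
    · rintro (x | x)
      · exact x.elim
      · simp [p', h.fpf x]
    · rintro (x | x) (y | y)
      · exact x.elim
      · exact x.elim
      · exact y.elim
      · exact h.nc x y
  obtain ⟨c, -, -, -, c4⟩ := glue (O := Empty) hτ hd (pos := pos') (by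
    rintro (x | x) (y | y) hxy
    · exact x.elim
    · exact x.elim
    · exact y.elim
    · exact congrArg _ (hpos hxy)) hlt (by
    rintro j (z | z) h1 h2
    · exact z.elim
    · obtain ⟨i, hi, h3⟩ := hnest j z h1 h2
      exact ⟨i, by simpa using hi, h3⟩) h'
  have hl : gloops p' = Nat.card (Quotient (cs p Sum.swap)) := by
    have e : ∀ x y : G ⊕ G, (cs p' gq).r (.inr x) (.inr y) ↔ (cs p Sum.swap).r x y := fun x y =>
      ⟨fun hh => cs_map (p' := p) (q' := Sum.swap)
        (f := fun z : Empty ⊕ (G ⊕ G) => z.elim Empty.elim id) (by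
          rintro (z | z)
          · exact z.elim
          · exact cs_p _ _ _) (by
          rintro (z | z)
          · exact z.elim
          · exact cs_q _ _ _) hh,
      fun hh => cs_map (p' := p') (q' := gq) (f := Sum.inr) (fun z => cs_p p' gq (.inr z))
        (fun z => cs_q p' gq (.inr z)) hh⟩
    symm
    refine Nat.card_eq_of_bijective (Quotient.lift
      (fun x => (⟨Quotient.mk _ (.inr x), fun y hy => hy.choose.elim⟩ :
        ClosedClass (cs p' gq) fun x => ∃ o, x = Sum.inl o))
      fun x y hxy => Subtype.ext (Quotient.sound ((e x y).2 hxy))) ⟨?_, ?_⟩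
    · intro x y
      induction x using Quotient.inductionOn
      induction y using Quotient.inductionOn
      intro hh
      exact Quotient.sound ((e _ _).1 (Quotient.exact (congrArg Subtype.val hh)))
    · rintro ⟨z, hz⟩
      induction z using Quotient.inductionOn with | h z => ?_
      rcases z with z | z
      · exact z.elim
      · exact ⟨Quotient.mk _ z, rfl⟩
  have c5 := c4 Empty.elim
  rw [hl] at c5
  have : Phi τ (pos' ∘ Sum.inl) c Empty.elim = 1 := by simp [Phi]
  rw [this, mul_one] at c5
  rw [← c5, Zg]
  refine Finset.sum_congr (by ext; simp) fun t _ => ?_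
  congr 1
  have : ∀ x, gst Empty.elim t (.inr x) = (Sum.elim (fun j => !t j) t : G ⊕ G → Bool) x := by
    rintro (x | x) <;> rfl
  have hp : ∀ x, hW τ pos' p' (gst Empty.elim t) (.inr x) =
      hW τ pos p (Sum.elim (fun j => !t j) t) x :=
    fun x => by simp only [hW, p', Sum.map_inr, this, pos', Sum.elim_inr]
  rw [Phi, Phi]
  symm
  refine (Fintype.prod_sum_type _).trans ?_
  rw [Fintype.prod_empty (ι := Empty), one_mul]
  simp only [hp]
end trace

variable {τ : ℂ}

/-- The weight of a state in the Markov trace. -/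
noncomputable def Kw (τ : ℂ) {n : ℕ} (s : Fin n → Bool) : ℂ := ∏ i, if s i then τ⁻¹ else τ

lemma sum_not {n : ℕ} (f : (Fin n → Bool) → ℂ) :
    ∑ t : Fin n → Bool, f (fun j => !t j) = ∑ t, f t := by
  refine Fintype.sum_equiv (⟨fun t j => !t j, fun t j => !t j, fun t => by simp, fun t => by simp⟩ :
    (Fin n → Bool) ≃ (Fin n → Bool)) _ _ fun t => rfl

lemma elim_swap {n : ℕ} :
    (Sum.elim Sum.inr Sum.inl : Fin n ⊕ Fin n → Fin n ⊕ Fin n) = Sum.swap := by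
  funext x; rcases x with x | x <;> rfl

lemma trLoops_eq {n : ℕ} (p : Diagram n n) :
    trLoops p = Nat.card (Quotient (cs p.pair Sum.swap)) := by
  rw [trLoops, cs, ← elim_swap]; rfl

lemma FD_trace (hτ : τ ≠ 0) (hd : τ + τ⁻¹ ≠ 0) {n : ℕ} (p : Diagram n n) :
    ∑ s, Kw τ s * FD τ p s s = (τ + τ⁻¹) ^ trLoops p := by
  rw [trLoops_eq, ← glue_trace hτ hd (bIdx_inj n n) (fun j => by simp only [bIdx]; omega)
    (fun j z h1 h2 => by
      rcases z with z | z <;> have := z.isLt <;> simp only [bIdx] at h1 h2 ⊢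
      · exact ⟨z, .inl rfl, by omega, by omega⟩
      · exact ⟨z, .inr rfl, by omega, by omega⟩) p.isNC, ← sum_not]
  refine Finset.sum_congr (by ext; simp) fun t _ => ?_
  rw [Kw, FD, ← mul_assoc, ← Finset.prod_mul_distrib]
  simp only [Bool.not_not]
  congr 1
  refine Finset.prod_congr rfl fun j _ => ?_
  cases t j <;> simp [gw, hτ]

/-- The positions of the points of a diagram read from the lower left corner. -/
def bIdx' (n : ℕ) : Fin n ⊕ Fin n → ℕ
  | .inl i => n + i
  | .inr j => n - 1 - j

lemma bIdx'_inj (n : ℕ) : Function.Injective (bIdx' n) := by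
  rintro (i | i) (j | j) h <;> simp only [bIdx'] at h <;> have hi := i.isLt <;> have hj := j.isLt
  · exact congrArg _ (Fin.ext (by omega))
  · omega
  · omega
  · exact congrArg _ (Fin.ext (by omega))

lemma isNC_bIdx' {n : ℕ} (p : Diagram n n) : IsNC (bIdx' n) p.pair := by
  refine ⟨p.involutive, p.fixedPointFree, fun x y => ?_⟩
  have h1 := p.noncrossing x y
  have h2 := p.noncrossing y (p.pair x)
  have h3 := p.noncrossing (p.pair x) (p.pair y)
  have h4 := p.noncrossing (p.pair y) x
  simp only [p.involutive _] at h2 h3 h4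
  have e : ∀ x, (bIdx n n x < n ∧ bIdx' n x = bIdx n n x + n) ∨
      (n ≤ bIdx n n x ∧ bIdx' n x + n = bIdx n n x ∧ bIdx n n x < n + n) := by
    rintro (x | x) <;> have := x.isLt <;> simp only [bIdx, bIdx'] <;> omega
  have b1 := e x
  have b2 := e y
  have b3 := e (p.pair x)
  have b4 := e (p.pair y)
  omega

lemma Phi_bIdx' (hτ : τ ≠ 0) {n : ℕ} (p : Diagram n n) (σ : Fin n ⊕ Fin n → Bool) :
    Phi τ (bIdx' n) p.pair σ =
      (∏ i, if σ (.inl i) then τ else τ⁻¹) * Phi τ (bIdx n n) p.pair σ := by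
  by_cases hs : ∃ x, σ x = σ (p.pair x)
  · obtain ⟨x, hx⟩ := hs
    rw [Phi, Phi, Finset.prod_eq_zero (Finset.mem_univ x) (by simp [hW, hx]),
      Finset.prod_eq_zero (Finset.mem_univ x) (by simp [hW, hx]), mul_zero]
  push Not at hs
  let G : Fin n ⊕ Fin n → ℂ := Sum.elim (fun i => if σ (.inl i) then τ else τ⁻¹) fun _ => 1
  have hG : ∏ x, G x = ∏ i, if σ (.inl i) then τ else τ⁻¹ := by
    simp [G, Fintype.prod_sum_type]
  have hWn : ∀ x, hW τ (bIdx n n) p.pair σ x ≠ 0 := fun x => by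
    simp only [hW, hs x, if_false]; split_ifs <;> simp [hτ]
  have hGn : ∀ x, G x ≠ 0 := by
    rintro (x | x) <;> simp only [G, Sum.elim_inl, Sum.elim_inr] <;> [split_ifs; skip] <;>
      simp [hτ]
  have key : ∏ x, hW τ (bIdx' n) p.pair σ x / (G x * hW τ (bIdx n n) p.pair σ x) = 1 := by
    refine Finset.prod_involution (fun x _ => p.pair x) ?_ ?_ ?_ ?_
    · intro x _
      have hs' := hs x
      simp only [hW, p.involutive x, hs x, (hs x).symm, if_false]
      have e : σ (p.pair x) = !σ x := by cases h1 : σ x <;> cases h2 : σ (p.pair x) <;> simp_all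
      rw [e]
      have hne := (bIdx_inj n n).ne (p.fixedPointFree x)
      rcases x with x | x <;> rcases hy : p.pair _ with y | y <;> rw [hy] at hne e <;>
        have hx := x.isLt <;> have hy' := y.isLt <;>
        simp only [bIdx, bIdx', G, Sum.elim_inl, Sum.elim_inr, e] at hne ⊢
      · rcases lt_or_gt_of_ne hne with h | h <;> cases σ (.inl x) <;> simp [h, h.not_gt, hτ]
      · have h1 : (x : ℕ) < n + (n - 1 - y) := by omega
        have h2 : n - 1 - (y : ℕ) < n + x := by omega
        cases σ (.inl x) <;> simp [h1, h2, h1.not_gt, h2.not_gt, hτ]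
      · have h1 : (y : ℕ) < n + (n - 1 - x) := by omega
        have h2 : n - 1 - (x : ℕ) < n + y := by omega
        cases σ (.inr x) <;> simp [h1, h2, h1.not_gt, h2.not_gt, hτ]
      · rcases lt_or_gt_of_ne (show n - 1 - (y : ℕ) ≠ n - 1 - x by omega) with h | h <;>
          cases σ (.inr x) <;> simp [h, h.not_gt, hτ]
    · intro x _ _; exact p.fixedPointFree x
    · intro x _; exact Finset.mem_univ _
    · intro x _; exact p.involutive x
  rw [Finset.prod_div_distrib, Finset.prod_mul_distrib, hG, div_eq_one_iff_eq] at key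
  · exact key
  · rw [← hG, ← Finset.prod_mul_distrib]
    exact Finset.prod_ne_zero_iff.2 fun x _ => mul_ne_zero (hGn x) (hWn x)

lemma FD_trace_left (hτ : τ ≠ 0) (hd : τ + τ⁻¹ ≠ 0) {n : ℕ} (p : Diagram n n) :
    ∑ s, (Kw τ s)⁻¹ * FD τ p s s = (τ + τ⁻¹) ^ trLoops p := by
  have hs : ∀ f : (Fin n ⊕ Fin n → ℂ), ∏ x, f x = ∏ x : Fin n ⊕ Fin n, f x.swap := fun f =>
    (Equiv.prod_comp (Equiv.sumComm _ _) f).symm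
  have hnc := isNC_bIdx' p
  have hnc' : IsNC (fun x : Fin n ⊕ Fin n => bIdx' n x.swap)
      (fun x : Fin n ⊕ Fin n => (p.pair x.swap).swap) := by
    refine ⟨fun x => ?_, fun x h => ?_, fun x y => ?_⟩
    · simp [p.involutive x.swap]
    · exact p.fixedPointFree x.swap (by rw [← Sum.swap_swap (p.pair x.swap), h])
    · simpa using hnc.nc x.swap y.swap
  have hl : trLoops p =
      Nat.card (Quotient (cs (fun x : Fin n ⊕ Fin n => (p.pair x.swap).swap) Sum.swap)) := by
    rw [trLoops_eq]
    refine Nat.card_congr (Quotient.congr (Equiv.sumComm _ _) fun x y => ⟨fun h => ?_, fun h => ?_⟩)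
    · exact cs_map (f := Sum.swap) (fun z => by
        have := cs_p (fun x : Fin n ⊕ Fin n => (p.pair x.swap).swap) Sum.swap z.swap
        rwa [Sum.swap_swap] at this) (fun z => cs_q _ _ z.swap) h
    · have := cs_map (p' := p.pair) (q' := Sum.swap) (f := Sum.swap) (fun z => by
        have := cs_p p.pair Sum.swap z.swap
        simpa using this) (fun z => cs_q _ _ z.swap) h
      simpa using this
  rw [hl, ← glue_trace hτ hd (pos := fun x : Fin n ⊕ Fin n => bIdx' n x.swap)
    (fun x y h => by simpa using congrArg Sum.swap (bIdx'_inj n h))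
    (fun j => by simp only [bIdx', Sum.swap_inl, Sum.swap_inr]; omega)
    (fun j z h1 h2 => by
      rcases z with z | z <;> have := z.isLt <;>
        simp only [bIdx', Sum.swap_inl, Sum.swap_inr] at h1 h2 ⊢
      · exact ⟨z, .inl rfl, by omega, by omega⟩
      · exact ⟨z, .inr rfl, by omega, by omega⟩) hnc']
  refine Finset.sum_congr (by ext; simp) fun t _ => ?_
  have e : Phi τ (fun x : Fin n ⊕ Fin n => bIdx' n x.swap)
      (fun x : Fin n ⊕ Fin n => (p.pair x.swap).swap)
      (Sum.elim (fun j => !t j) t) = Phi τ (bIdx' n) p.pair (Sum.elim t fun j => !t j) := by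
    rw [Phi, hs, Phi]
    refine Finset.prod_congr rfl fun x _ => ?_
    have e2 : ∀ x : Fin n ⊕ Fin n, Sum.elim (fun j => !t j) t x.swap =
        Sum.elim t (fun j => !t j) x := by rintro (x | x) <;> rfl
    simp only [hW, Sum.swap_swap, e2]
  rw [e, Phi_bIdx' hτ, Kw, FD]
  simp only [Sum.elim_inl]
  rw [← Finset.prod_inv_distrib]
  have : (∏ x, (if t x = true then τ⁻¹ else τ)⁻¹) = ∏ i, if t i = true then τ else τ⁻¹ := by
    refine Finset.prod_congr rfl fun x _ => ?_
    split_ifs <;> simp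
  rw [this]
  rw [mul_left_comm]
  congr!
end

section
variable {τ : ℂ}

lemma F_add {m n : ℕ} (x y : Hom ℂ m n) (s t) : F τ (x + y) s t = F τ x s t + F τ y s t := by
  simp [F, add_mul, Finset.sum_add_distrib]

lemma F_smul {m n : ℕ} (c : ℂ) (x : Hom ℂ m n) (s t) : F τ (c • x) s t = c * F τ x s t := by
  simp [F, Finset.mul_sum, mul_assoc]

lemma F_zero {m n : ℕ} (s t) : F τ (0 : Hom ℂ m n) s t = 0 := by simp [F]

lemma F_single {m n : ℕ} (D : Diagram m n) (s t) : F τ (single D) s t = FD τ D s t := by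
  simp [F, single]

/-! ### Trace -/

lemma F_trace (hτ : τ ≠ 0) (hd : τ + τ⁻¹ ≠ 0) {n : ℕ} (x : Hom ℂ n n) :
    Tr (τ + τ⁻¹) x = ∑ s, Kw τ s * F τ x s s := by
  simp only [Tr, F, ← FD_trace hτ hd, Finset.mul_sum]
  rw [Finset.sum_comm]
  exact Finset.sum_congr rfl fun s _ => Finset.sum_congr rfl fun t _ => by ring

lemma F_trace_left (hτ : τ ≠ 0) (hd : τ + τ⁻¹ ≠ 0) {n : ℕ} (x : Hom ℂ n n) :
    Tr (τ + τ⁻¹) x = ∑ s, (Kw τ s)⁻¹ * F τ x s s := by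
  simp only [Tr, F, ← FD_trace_left hτ hd, Finset.mul_sum]
  rw [Finset.sum_comm]
  exact Finset.sum_congr rfl fun s _ => Finset.sum_congr rfl fun t _ => by ring

/-! ### Tensor product -/

section tensor
variable {m n m' n' : ℕ}

lemma tpos₁ (i : Fin m) : bIdx (m + m') (n + n') ((tEquiv m n m' n').symm (.inl (.inl i))) = i := by
  simp [tEquiv, bIdx]

lemma tpos₂ (i : Fin n) : bIdx (m + m') (n + n') ((tEquiv m n m' n').symm (.inl (.inr i))) =
    m + m' + (n + n' - 1 - i) := by
  simp [tEquiv, bIdx]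

lemma tpos₃ (i : Fin m') : bIdx (m + m') (n + n') ((tEquiv m n m' n').symm (.inr (.inl i))) =
    m + i := by
  simp [tEquiv, bIdx]

lemma tpos₄ (i : Fin n') : bIdx (m + m') (n + n') ((tEquiv m n m' n').symm (.inr (.inr i))) =
    m + m' + (n' - 1 - i) := by
  simp [tEquiv, bIdx]; omega

lemma tpos_inl (x : Fin m ⊕ Fin n) :
    (bIdx m n x < m ∧ bIdx (m + m') (n + n') ((tEquiv m n m' n').symm (.inl x)) = bIdx m n x) ∨
    (m ≤ bIdx m n x ∧ bIdx (m + m') (n + n') ((tEquiv m n m' n').symm (.inl x)) =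
      bIdx m n x + m' + n') := by
  rcases x with x | x <;> have := x.isLt
  · exact .inl ⟨x.isLt, tpos₁ x⟩
  · rw [tpos₂]; simp only [bIdx]; omega

lemma tpos_inr (x : Fin m' ⊕ Fin n') :
    bIdx (m + m') (n + n') ((tEquiv m n m' n').symm (.inr x)) = m + bIdx m' n' x ∧
      bIdx m' n' x < m' + n' := by
  rcases x with x | x <;> have := x.isLt
  · exact ⟨tpos₃ x, Nat.lt_add_right _ x.isLt⟩
  · rw [tpos₄]; simp only [bIdx]; omega

lemma tpos_lt_inl (x y : Fin m ⊕ Fin n) :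
    bIdx (m + m') (n + n') ((tEquiv m n m' n').symm (.inl x)) <
      bIdx (m + m') (n + n') ((tEquiv m n m' n').symm (.inl y)) ↔ bIdx m n x < bIdx m n y := by
  have := tpos_inl (m' := m') (n' := n') x
  have := tpos_inl (m' := m') (n' := n') y
  omega

lemma tpos_lt_inr (x y : Fin m' ⊕ Fin n') :
    bIdx (m + m') (n + n') ((tEquiv m n m' n').symm (.inr x)) <
      bIdx (m + m') (n + n') ((tEquiv m n m' n').symm (.inr y)) ↔ bIdx m' n' x < bIdx m' n' y := by
  have := tpos_inr (m := m) (n := n) x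
  have := tpos_inr (m := m) (n := n) y
  omega

lemma tensorPair_symm (a : Diagram m n) (b : Diagram m' n') (x) :
    tensorPair a b ((tEquiv m n m' n').symm x) =
      (tEquiv m n m' n').symm (Sum.map a.pair b.pair x) := by
  simp [tensorPair]

lemma tensorPair_isNC (a : Diagram m n) (b : Diagram m' n') :
    IsNC (bIdx (m + m') (n + n')) (tensorPair a b) := by
  refine ⟨fun x => ?_, fun x => ?_, fun x y => ?_⟩ <;>
    obtain ⟨x, rfl⟩ := (tEquiv m n m' n').symm.surjective x
  · rw [tensorPair_symm, tensorPair_symm]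
    rcases x with x | x
    · simp [a.involutive x]
    · simp [b.involutive x]
  · rw [tensorPair_symm]
    rcases x with x | x
    · simp [a.fixedPointFree x]
    · simp [b.fixedPointFree x]
  · obtain ⟨y, rfl⟩ := (tEquiv m n m' n').symm.surjective y
    rw [tensorPair_symm, tensorPair_symm]
    rcases x with x | x <;> rcases y with y | y <;> simp only [Sum.map_inl, Sum.map_inr]
    · simp only [tpos_lt_inl]; exact a.noncrossing x y
    · have := tpos_inl (m' := m') (n' := n') x
      have := tpos_inl (m' := m') (n' := n') (a.pair x)
      have := tpos_inr (m := m) (n := n) y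
      have := tpos_inr (m := m) (n := n) (b.pair y)
      omega
    · have := tpos_inl (m' := m') (n' := n') y
      have := tpos_inl (m' := m') (n' := n') (a.pair y)
      have := tpos_inr (m := m) (n := n) x
      have := tpos_inr (m := m) (n := n) (b.pair x)
      omega
    · simp only [tpos_lt_inr]; exact b.noncrossing x y

/-- Horizontal juxtaposition of diagrams. -/
def tD (a : Diagram m n) (b : Diagram m' n') : Diagram (m + m') (n + n') :=
  (tensorPair_isNC a b).toDiagram

lemma FD_tD (a : Diagram m n) (b : Diagram m' n') (s t) :
    FD τ (tD a b) s t = FD τ a (fun i => s (Fin.castAdd m' i)) (fun i => t (Fin.castAdd n' i)) *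
      FD τ b (fun i => s (Fin.natAdd m i)) (fun i => t (Fin.natAdd n i)) := by
  have h : ∀ x, (Sum.elim s (fun j => !t j) : Fin (m + m') ⊕ Fin (n + n') → Bool)
      ((tEquiv m n m' n').symm x) =
      Sum.elim (Sum.elim (fun i => s (Fin.castAdd m' i)) fun i => !t (Fin.castAdd n' i))
        (Sum.elim (fun i => s (Fin.natAdd m i)) fun i => !t (Fin.natAdd n i)) x := by
    rintro ((x | x) | (x | x)) <;> simp [tEquiv]
  have hl : ∀ x, hW τ (bIdx (m + m') (n + n')) (tensorPair a b) (Sum.elim s fun j => !t j)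
      ((tEquiv m n m' n').symm (.inl x)) = hW τ (bIdx m n) a.pair
        (Sum.elim (fun i => s (Fin.castAdd m' i)) fun i => !t (Fin.castAdd n' i)) x := fun x => by
    simp only [hW, tensorPair_symm, h, Sum.map_inl, Sum.elim_inl, tpos_lt_inl]
  have hr : ∀ x, hW τ (bIdx (m + m') (n + n')) (tensorPair a b) (Sum.elim s fun j => !t j)
      ((tEquiv m n m' n').symm (.inr x)) = hW τ (bIdx m' n') b.pair
        (Sum.elim (fun i => s (Fin.natAdd m i)) fun i => !t (Fin.natAdd n i)) x := fun x => by
    simp only [hW, tensorPair_symm, h, Sum.map_inr, Sum.elim_inr, tpos_lt_inr]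
  have hp : Phi τ (bIdx (m + m') (n + n')) (tensorPair a b) (Sum.elim s fun j => !t j) =
      Phi τ (bIdx m n) a.pair
        (Sum.elim (fun i => s (Fin.castAdd m' i)) fun i => !t (Fin.castAdd n' i)) *
      Phi τ (bIdx m' n') b.pair
        (Sum.elim (fun i => s (Fin.natAdd m i)) fun i => !t (Fin.natAdd n i)) := by
    rw [Phi, ← Equiv.prod_comp (tEquiv m n m' n').symm]
    refine (Fintype.prod_sum_type _).trans ?_
    simp only [hl, hr, Phi]
  simp only [FD, tD, IsNC.toDiagram, hp, Fin.prod_univ_add]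
  ring

lemma F_tensor (x : Hom ℂ m n) (y : Hom ℂ m' n') (s t) :
    F τ (tensor x y) s t = F τ x (fun i => s (Fin.castAdd m' i)) (fun i => t (Fin.castAdd n' i)) *
      F τ y (fun i => s (Fin.natAdd m i)) (fun i => t (Fin.natAdd n i)) := by
  have key : ∀ p q, ∑ c, (tensorD p q : Hom ℂ _ _) c * FD τ c s t = FD τ (tD p q) s t :=
      fun p q => by
    have : ∀ c : Diagram (m + m') (n + n'), c.pair = tensorPair p q ↔ c = tD p q := fun c =>
      ⟨fun h => Diagram.ext_pair h, fun h => by rw [h]; rfl⟩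
    simp [tensorD, this]
  simp only [F, tensor, Finset.sum_mul]
  rw [Finset.sum_comm]
  simp_rw [Finset.sum_comm (s := (Finset.univ : Finset (Diagram (m + m') (n + n')))), mul_assoc,
    ← Finset.mul_sum, key, FD_tD, Finset.mul_sum]
  refine Finset.sum_congr rfl fun p _ => ?_
  refine Finset.sum_congr rfl fun q _ => ?_
  ring
end tensor

/-! ### Identity -/

lemma F_id {n : ℕ} (hτ : τ ≠ 0) (s t : Fin n → Bool) :
    F τ (idHom ℂ n) s t = if s = t then 1 else 0 := by
  have h : F τ (idHom ℂ n) s t = FD τ (idD n) s t := by simp [F, idHom]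
  rw [h, FD, Phi, Fintype.prod_sum_type]
  split_ifs with hst
  · subst hst
    rw [← Finset.prod_mul_distrib, ← Finset.prod_mul_distrib]
    refine Finset.prod_eq_one fun i _ => ?_
    have h1 : (i : ℕ) < n + (n - 1 - i) := by omega
    cases hs : s i <;> simp [hW, idD, bIdx, gw, hs, h1, hτ, h1.not_gt]
  · obtain ⟨i, hi⟩ := Function.ne_iff.1 hst
    have : ∏ i, hW τ (bIdx n n) (idD n).pair (Sum.elim s fun j => !t j) (.inl i) = 0 := by
      refine Finset.prod_eq_zero (Finset.mem_univ i) ?_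
      cases hs : s i <;> cases ht : t i <;> simp_all [hW, idD]
    rw [this]; simp
end

section
variable {τ : ℂ}

/-! ### Faithfulness of the spin representation -/

section opener
variable {X : Type} [Fintype X]

/-- The state in which openers are up and closers are down. -/
noncomputable def opn (pos : X → ℕ) (p : X → X) (x : X) : Bool := decide (pos x < pos (p x))

/-- Total position of the up points. -/
def upSum (pos : X → ℕ) (σ : X → Bool) : ℕ := ∑ x, if σ x then pos x else 0

lemma ne_of_Phi {pos : X → ℕ} {p : X → X} {σ : X → Bool} (h : Phi τ pos p σ ≠ 0) (x : X) :
    σ (p x) = !σ x := by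
  have := Finset.prod_ne_zero_iff.1 h x (Finset.mem_univ x)
  have h2 : σ x ≠ σ (p x) := fun e => this (by simp [hW, e])
  cases h1 : σ x <;> cases h3 : σ (p x) <;> simp_all

omit [Fintype X] in
lemma opn_pair {pos : X → ℕ} (hpos : Function.Injective pos) {p : X → X} (h : IsNC pos p) (x : X) :
    opn pos p (p x) = !opn pos p x := by
  have := hpos.ne (h.fpf x)
  rcases lt_or_gt_of_ne this with h1 | h1 <;> simp [opn, h.inv, h1, h1.not_gt]

lemma Phi_opn (hτ : τ ≠ 0) {pos : X → ℕ} (hpos : Function.Injective pos) {p : X → X}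
    (h : IsNC pos p) : Phi τ pos p (opn pos p) ≠ 0 := by
  refine Finset.prod_ne_zero_iff.2 fun x _ => ?_
  rw [hW, opn_pair hpos h]
  simp only [Bool.eq_not_self, if_false]
  split_ifs <;> simp [hτ]

lemma upSum_two {pos : X → ℕ} {p : X → X} (hinv : ∀ x, p (p x) = x) {σ : X → Bool}
    (hσ : ∀ x, σ (p x) = !σ x) :
    2 * upSum pos σ = ∑ x, if σ x then pos x else pos (p x) := by
  have e : upSum pos σ = ∑ x, if σ (p x) then pos (p x) else 0 :=
    (Equiv.sum_comp (Function.Involutive.toPerm p hinv) fun x => if σ x then pos x else 0).symm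
  rw [two_mul]
  nth_rw 2 [e]
  rw [upSum, ← Finset.sum_add_distrib]
  refine Finset.sum_congr rfl fun x _ => ?_
  rw [hσ]; cases σ x <;> simp

lemma upSum_opn {pos : X → ℕ} (hpos : Function.Injective pos) {p : X → X} (h : IsNC pos p)
    {σ : X → Bool} (hσ : ∀ x, σ (p x) = !σ x) (hle : upSum pos σ ≤ upSum pos (opn pos p)) :
    σ = opn pos p := by
  have hm : ∀ x, (if opn pos p x then pos x else pos (p x)) ≤ if σ x then pos x else pos (p x) := by
    intro x
    simp only [opn, decide_eq_true_eq]
    split_ifs <;> omega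
  have h2 : ∑ x, (if opn pos p x then pos x else pos (p x)) =
      ∑ x, if σ x then pos x else pos (p x) := by
    refine le_antisymm (Finset.sum_le_sum fun x _ => hm x) ?_
    rw [← upSum_two h.inv hσ, ← upSum_two h.inv (opn_pair hpos h)]
    omega
  rw [Finset.sum_eq_sum_iff_of_le fun x _ => hm x] at h2
  funext x
  have h3 := h2 x (Finset.mem_univ x)
  have h4 := hpos.ne (h.fpf x)
  cases h5 : σ x <;> cases h6 : opn pos p x <;> simp only [h5, h6, if_true] at h3 <;>
    simp_all

omit [Fintype X] in
lemma pair_eq_of_opn {pos : X → ℕ} (hpos : Function.Injective pos) (N : ℕ) :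
    ∀ {p p' : X → X}, IsNC pos p → IsNC pos p' → opn pos p = opn pos p' →
      ∀ x, pos x < pos (p x) → pos (p x) - pos x ≤ N → p x = p' x := by
  induction N with
  | zero => intro p p' _ _ _ x h1 h2; omega
  | succ N ih =>
    have aux : ∀ {p p' : X → X}, IsNC pos p → IsNC pos p' → opn pos p = opn pos p' →
      ∀ x, pos x < pos (p x) → pos (p x) - pos x ≤ N + 1 → ¬ pos (p x) < pos (p' x) := by
      intro p p' h h' ho x h1 h2 h3
      have hy : opn pos p' (p x) = false := by rw [← ho, opn_pair hpos h]; simp [opn, h1]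
      have hy2 : pos (p' (p x)) < pos (p x) := by
        have := hpos.ne (h'.fpf (p x))
        simp only [opn, decide_eq_false_iff_not] at hy
        omega
      have hz1 : pos x < pos (p' (p x)) := by
        rcases lt_trichotomy (pos x) (pos (p' (p x))) with h4 | h4 | h4
        · exact h4
        · have := hpos h4
          rw [this, h'.inv, ← this] at h3
          omega
        · exact absurd ⟨h4, by rw [h'.inv]; exact h1, by rw [h'.inv]; exact h3⟩
            (h'.nc (p' (p x)) x)
      set z := p' (p x) with hz
      have hzo : pos z < pos (p z) := by
        have : opn pos p z = true := by rw [ho]; simp [opn, hz, h'.inv]; exact hy2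
        simpa [opn] using this
      have hzl : pos (p z) < pos (p x) := by
        rcases lt_trichotomy (pos (p z)) (pos (p x)) with h4 | h4 | h4
        · exact h4
        · have := hpos h4
          have : z = x := by rw [← h.inv z, this, h.inv]
          rw [this] at hz1; omega
        · exact absurd ⟨hz1, hy2, h4⟩ (h.nc x z)
      have := ih h h' ho z hzo (by omega)
      rw [hz, h'.inv] at this
      rw [← hz] at this
      rw [this] at hzl
      omega
    intro p p' h h' ho x h1 h2
    refine hpos (le_antisymm ?_ ?_)
    · by_contra hc
      refine aux h' h ho.symm x ?_ (by omega) (by omega)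
      have : opn pos p' x = true := by rw [← ho]; simp [opn, h1]
      simpa [opn] using this
    · exact le_of_not_gt (aux h h' ho x h1 h2)

omit [Fintype X] in
lemma eq_of_opn {pos : X → ℕ} (hpos : Function.Injective pos) {p p' : X → X} (h : IsNC pos p)
    (h' : IsNC pos p') (ho : opn pos p = opn pos p') : p = p' := by
  funext x
  have hne := hpos.ne (h.fpf x)
  rcases lt_or_gt_of_ne hne with h1 | h1
  · have := pair_eq_of_opn hpos _ h h' ho (p x) (by rwa [h.inv]) le_rfl
    rw [h.inv] at this
    rw [this, h'.inv, ← this]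
  · exact pair_eq_of_opn hpos _ h h' ho x h1 le_rfl
end opener

lemma eq_zero_of_F (hτ : τ ≠ 0) {m n : ℕ} {x : Hom ℂ m n} (h : ∀ s t, F τ x s t = 0) : x = 0 := by
  by_contra hx
  have hne : (Finset.univ.filter fun D => x D ≠ 0).Nonempty := by
    obtain ⟨D, hD⟩ := Function.ne_iff.1 hx
    exact ⟨D, by simpa using hD⟩
  obtain ⟨D, hD, hmin⟩ := Finset.exists_min_image _
    (fun D => upSum (bIdx m n) (opn (bIdx m n) D.pair)) hne
  simp only [Finset.mem_filter, Finset.mem_univ, true_and] at hD hmin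
  let σ := opn (bIdx m n) D.pair
  have hσ : (Sum.elim (fun i => σ (.inl i)) fun j => !!σ (.inr j)) = σ := by
    funext x; rcases x with x | x <;> simp
  have h1 := h (fun i => σ (.inl i)) fun j => !σ (.inr j)
  rw [F, Finset.sum_eq_single D] at h1
  · rcases mul_eq_zero.1 h1 with h2 | h2
    · exact hD h2
    · rw [FD, hσ] at h2
      rcases mul_eq_zero.1 h2 with h2 | h2
      · refine Finset.prod_ne_zero_iff.2 (fun j _ => ?_) h2
        unfold gw; split_ifs <;> simp [hτ]
      · exact Phi_opn hτ (bIdx_inj m n) D.isNC h2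
  · intro D' _ hne
    by_contra hc
    have hc1 := left_ne_zero_of_mul hc
    have hc2 := right_ne_zero_of_mul (right_ne_zero_of_mul hc)
    rw [hσ] at hc2
    have := upSum_opn (bIdx_inj m n) D'.isNC (ne_of_Phi hc2) (hmin D' hc1)
    exact hne (Diagram.ext_pair (eq_of_opn (bIdx_inj m n) D'.isNC D.isNC this.symm))
  · simp

lemma F_inj (hτ : τ ≠ 0) {m n : ℕ} {x y : Hom ℂ m n} (h : ∀ s t, F τ x s t = F τ y s t) :
    x = y := by
  have : x + (-1 : ℂ) • y = 0 := eq_zero_of_F hτ fun s t => by rw [F_add, F_smul, h]; ring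
  have := eq_neg_of_add_eq_zero_left this
  simpa using this

/-! ### Weights -/

/-- The number of up points of a state. -/
def cnt {n : ℕ} (s : Fin n → Bool) : ℕ := (Finset.univ.filter fun i => s i = true).card

lemma cnt_add {n : ℕ} (s : Fin n → Bool) :
    cnt s + (Finset.univ.filter fun i => ¬ s i = true).card = n := by
  rw [cnt, Finset.card_filter_add_card_filter_not]; simp

lemma Kw_eq {n : ℕ} (s : Fin n → Bool) : Kw τ s = τ⁻¹ ^ cnt s * τ ^ (n - cnt s) := by
  have := cnt_add s
  rw [Kw, Finset.prod_ite, Finset.prod_const, Finset.prod_const, cnt]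
  congr 2
  rw [cnt] at this
  omega

lemma FD_weight {m n : ℕ} {D : Diagram m n} {s t} (h : FD τ D s t ≠ 0) :
    2 * cnt s + n = 2 * cnt t + m := by
  have h1 := ne_of_Phi (right_ne_zero_of_mul h)
  set σ : Fin m ⊕ Fin n → Bool := Sum.elim s fun j => !t j with hσ
  have e : ∑ x, (if σ x = true then 1 else 0) = ∑ x, if σ x = true then 0 else 1 := by
    rw [← Equiv.sum_comp (Function.Involutive.toPerm D.pair D.involutive)]
    refine Finset.sum_congr rfl fun x _ => ?_
    simp only [Function.Involutive.coe_toPerm, h1 x]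
    cases σ x <;> simp
  rw [Fintype.sum_sum_type, Fintype.sum_sum_type] at e
  have h2 := cnt_add s
  have h3 := cnt_add t
  simp only [cnt, Finset.card_filter] at h2 h3 ⊢
  simp only [hσ, Sum.elim_inl, Sum.elim_inr] at e
  have e1 : ∑ x, (if (!t x) = true then 1 else 0) = ∑ i, if ¬ t i = true then 1 else 0 :=
    Finset.sum_congr rfl fun x _ => by cases t x <;> simp
  have e2 : ∑ x, (if (!t x) = true then 0 else 1) = ∑ i, if t i = true then 1 else 0 :=
    Finset.sum_congr rfl fun x _ => by cases t x <;> simp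
  have e3 : ∑ x, (if s x = true then 0 else 1) = ∑ i, if ¬ s i = true then 1 else 0 :=
    Finset.sum_congr rfl fun x _ => by cases s x <;> simp
  rw [e1, e2, e3] at e
  omega

lemma F_weight {m n : ℕ} {x : Hom ℂ m n} {s t} (h : F τ x s t ≠ 0) :
    2 * cnt s + n = 2 * cnt t + m := by
  obtain ⟨D, -, hD⟩ := Finset.exists_ne_zero_of_sum_ne_zero h
  exact FD_weight (right_ne_zero_of_mul hD)
end

section
variable {τ : ℂ}

lemma Kw_eq_zpow (hτ : τ ≠ 0) {n : ℕ} (s : Fin n → Bool) : Kw τ s = τ ^ ((n : ℤ) - 2 * cnt s) := by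
  have := cnt_add s
  rw [Kw_eq, show (n : ℤ) - 2 * cnt s = ((n - cnt s : ℕ) : ℤ) - (cnt s : ℤ) by omega,
    zpow_sub₀ hτ, zpow_natCast, zpow_natCast, inv_pow]
  field_simp

lemma Kw_eq_of_F' (hτ : τ ≠ 0) {m n : ℕ} {x : Hom ℂ m n} {s t} (h : F τ x s t ≠ 0) :
    Kw τ s = Kw τ t := by
  have := F_weight h
  rw [Kw_eq_zpow hτ, Kw_eq_zpow hτ]
  congr 1
  omega

section category
variable (hτ : τ ≠ 0) (hd : τ + τ⁻¹ ≠ 0) {k l m n : ℕ}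
include hτ hd

lemma comp_assoc' (a : Hom ℂ k l) (b : Hom ℂ l m) (c : Hom ℂ m n) :
    comp (τ + τ⁻¹) c (comp (τ + τ⁻¹) b a) = comp (τ + τ⁻¹) (comp (τ + τ⁻¹) c b) a := by
  refine F_inj hτ fun s u => ?_
  simp only [F_comp hτ hd, Finset.sum_mul, Finset.mul_sum]
  rw [Finset.sum_comm]
  exact Finset.sum_congr rfl fun _ _ => Finset.sum_congr rfl fun _ _ => by ring

lemma id_comp' (a : Hom ℂ m n) : comp (τ + τ⁻¹) (idHom ℂ n) a = a := by
  refine F_inj hτ fun s u => ?_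
  simp [F_comp hτ hd, F_id hτ]

lemma Tr_comm (a : Hom ℂ m n) (b : Hom ℂ n m) :
    Tr (τ + τ⁻¹) (comp (τ + τ⁻¹) b a) = Tr (τ + τ⁻¹) (comp (τ + τ⁻¹) a b) := by
  simp only [F_trace hτ hd, F_comp hτ hd, Finset.mul_sum]
  rw [Finset.sum_comm]
  refine Finset.sum_congr rfl fun t _ => Finset.sum_congr rfl fun s _ => ?_
  by_cases h : F τ a s t = 0
  · simp [h]
  · rw [Kw_eq_of_F' hτ h]; ring
end category

/-! ### Changing the number of points along equalities -/

/-- Transport of a morphism along equalities of objects. -/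
def castH {m n m' n' : ℕ} (h : m = m') (h' : n = n') (x : Hom ℂ m n) : Hom ℂ m' n' :=
  cast (by rw [h, h']) x

lemma F_castH {m n m' n' : ℕ} (h : m = m') (h' : n = n') (x : Hom ℂ m n) (s t) :
    F τ (castH h h' x) s t = F τ x (fun i => s (Fin.cast h i)) fun i => t (Fin.cast h' i) := by
  subst h h'; rfl

lemma castH_mem {J : ∀ m n : ℕ, Set (Hom ℂ m n)} {m n m' n' : ℕ} {h : m = m'} {h' : n = n'}
    {x : Hom ℂ m n} : castH h h' x ∈ J m' n' ↔ x ∈ J m n := by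
  subst h h'; rfl

lemma castH_eq_zero {m n m' n' : ℕ} {h : m = m'} {h' : n = n'} {x : Hom ℂ m n} :
    castH h h' x = 0 ↔ x = 0 := by
  subst h h'; rfl

/-! ### Nested caps and cups -/

lemma sum_append {a b : ℕ} (f : (Fin (a + b) → Bool) → ℂ) :
    ∑ w, f w = ∑ s : Fin a → Bool, ∑ t : Fin b → Bool, f (Fin.append s t) := by
  rw [← Equiv.sum_comp (Fin.appendEquiv a b), Fintype.sum_prod_type]
  rfl

/-- The nested diagram with `m` caps. -/
def capND (m : ℕ) : Diagram 0 (m + m) where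
  pair := Sum.map id Fin.rev
  involutive := by rintro (i | i); · exact i.elim0
                   · simp
  fixedPointFree := by
    rintro (i | i)
    · exact i.elim0
    · simp only [Sum.map_inr, ne_eq, Sum.inr.injEq, Fin.ext_iff, Fin.val_rev]; omega
  noncrossing := by
    rintro (i | i) (j | j)
    · exact i.elim0
    · exact i.elim0
    · exact j.elim0
    · simp only [Sum.map_inr, bIdx, Fin.val_rev]; omega

/-- The nested diagram with `m` cups. -/
def cupND (m : ℕ) : Diagram (m + m) 0 where
  pair := Sum.map Fin.rev id
  involutive := by rintro (i | i)
                   · simp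
                   · exact i.elim0
  fixedPointFree := by
    rintro (i | i)
    · simp only [Sum.map_inl, ne_eq, Sum.inl.injEq, Fin.ext_iff, Fin.val_rev]; omega
    · exact i.elim0
  noncrossing := by
    rintro (i | i) (j | j)
    · simp only [Sum.map_inl, bIdx, Fin.val_rev]; omega
    · exact j.elim0
    · exact i.elim0
    · exact i.elim0

/-- The state opposite to `s`. -/
def rbar {m : ℕ} (s : Fin m → Bool) : Fin m → Bool := fun i => !s i.rev

lemma rbar_rbar {m : ℕ} (s : Fin m → Bool) : rbar (rbar s) = s := by funext i; simp [rbar]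

/-- The weight of a state on nested caps. -/
noncomputable def capW (τ : ℂ) {m : ℕ} (s : Fin m → Bool) : ℂ := ∏ i, if s i then 1 else τ

/-- The weight of a state on nested cups. -/
noncomputable def cupW (τ : ℂ) {m : ℕ} (s : Fin m → Bool) : ℂ := ∏ i, if s i then τ⁻¹ else 1

lemma cap_mul_cup {m : ℕ} (s : Fin m → Bool) : capW τ s * cupW τ s = Kw τ s := by
  rw [capW, cupW, Kw, ← Finset.prod_mul_distrib]
  refine Finset.prod_congr rfl fun i _ => ?_
  cases s i <;> simp

lemma cupW_ne (hτ : τ ≠ 0) {m : ℕ} (s : Fin m → Bool) : cupW τ s ≠ 0 :=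
  Finset.prod_ne_zero_iff.2 fun i _ => by split_ifs <;> simp [hτ]

lemma Kw_rbar {m : ℕ} (s : Fin m → Bool) : Kw τ (rbar s) = (Kw τ s)⁻¹ := by
  rw [Kw, Kw, ← Finset.prod_inv_distrib, ← Equiv.prod_comp Fin.revPerm]
  refine Finset.prod_congr rfl fun i _ => ?_
  cases h : s i <;> simp [rbar, h]

lemma rev_castAdd' {m : ℕ} (i : Fin m) : (Fin.castAdd m i).rev = Fin.natAdd m i.rev := by
  ext; simp only [Fin.val_rev, Fin.val_castAdd, Fin.val_natAdd]; omega

lemma rev_natAdd' {m : ℕ} (i : Fin m) : (Fin.natAdd m i).rev = Fin.castAdd m i.rev := by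
  ext; simp only [Fin.val_rev, Fin.val_castAdd, Fin.val_natAdd]; omega

lemma prod_rev {m : ℕ} (f : Fin m → ℂ) : ∏ i : Fin m, f i.rev = ∏ i, f i :=
  Equiv.prod_comp Fin.revPerm f

lemma F_capN (hτ : τ ≠ 0) {m : ℕ} (u) (s t : Fin m → Bool) :
    F τ (single (capND m)) u (Fin.append s t) = if t = rbar s then capW τ s else 0 := by
  rw [F_single, FD, Phi, Fintype.prod_sum_type, Fin.prod_univ_add, Fin.prod_univ_add,
    Fintype.prod_empty (ι := Fin 0), one_mul]
  have h1 : ∀ i : Fin m, hW τ (bIdx 0 (m + m)) (capND m).pair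
      (Sum.elim u fun j => !Fin.append s t j) (.inr (Fin.castAdd m i)) =
      if s i = t i.rev then 0 else 1 := fun i => by
    have : ¬ 0 + (m + m - 1 - (i : ℕ)) < 0 + (m + m - 1 - (m + (m - ((i : ℕ) + 1)))) := by omega
    simp only [hW, capND, Sum.map_inr, rev_castAdd', Sum.elim_inr, Fin.append_left,
      Fin.append_right, bIdx, Fin.val_castAdd, Fin.val_natAdd, Fin.val_rev, this]
    cases s i <;> cases t i.rev <;> simp
  have h2 : ∀ i : Fin m, hW τ (bIdx 0 (m + m)) (capND m).pair
      (Sum.elim u fun j => !Fin.append s t j) (.inr (Fin.natAdd m i)) =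
      if s i.rev = t i then 0 else if t i then 1 else τ⁻¹ := fun i => by
    have : 0 + (m + m - 1 - (m + (i : ℕ))) < 0 + (m + m - 1 - (m - ((i : ℕ) + 1))) := by omega
    simp only [hW, capND, Sum.map_inr, rev_natAdd', Sum.elim_inr, Fin.append_left,
      Fin.append_right, bIdx, Fin.val_castAdd, Fin.val_natAdd, Fin.val_rev, this]
    cases s i.rev <;> cases t i <;> simp
  simp only [h1, h2, Fin.append_left, Fin.append_right]
  rw [← prod_rev fun i => gw τ (t i), ← prod_rev fun i => ite (s i.rev = t i) _ _]
  simp only [Fin.rev_rev]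
  rw [← Finset.prod_mul_distrib, ← Finset.prod_mul_distrib, ← Finset.prod_mul_distrib]
  split_ifs with h
  · subst h
    refine Finset.prod_congr rfl fun i _ => ?_
    cases h : s i <;> simp [rbar, h, gw, hτ]
  · obtain ⟨i, hi⟩ := Function.ne_iff.1 h
    refine Finset.prod_eq_zero (Finset.mem_univ i.rev) ?_
    have : s i.rev = t i := by
      revert hi; simp only [rbar]; cases s i.rev <;> cases t i <;> simp
    simp [this]

lemma F_cupN {m : ℕ} (u) (s t : Fin m → Bool) :
    F τ (single (cupND m)) (Fin.append s t) u = if t = rbar s then cupW τ s else 0 := by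
  rw [F_single, FD, Phi, Fintype.prod_sum_type, Fin.prod_univ_add,
    Fintype.prod_empty (ι := Fin 0), Fintype.prod_empty (ι := Fin 0), one_mul, mul_one]
  have h1 : ∀ i : Fin m, hW τ (bIdx (m + m) 0) (cupND m).pair
      (Sum.elim (Fin.append s t) fun j => !u j) (.inl (Fin.castAdd m i)) =
      if s i = t i.rev then 0 else if s i then τ⁻¹ else 1 := fun i => by
    have : (i : ℕ) < m + (m - ((i : ℕ) + 1)) := by omega
    simp only [hW, cupND, Sum.map_inl, rev_castAdd', Sum.elim_inl, Fin.append_left,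
      Fin.append_right, bIdx, Fin.val_castAdd, Fin.val_natAdd, Fin.val_rev, this]
    cases s i <;> cases t i.rev <;> simp
  have h2 : ∀ i : Fin m, hW τ (bIdx (m + m) 0) (cupND m).pair
      (Sum.elim (Fin.append s t) fun j => !u j) (.inl (Fin.natAdd m i)) =
      if s i.rev = t i then 0 else 1 := fun i => by
    have : ¬ m + (i : ℕ) < m - ((i : ℕ) + 1) := by omega
    simp only [hW, cupND, Sum.map_inl, rev_natAdd', Sum.elim_inl, Fin.append_left,
      Fin.append_right, bIdx, Fin.val_castAdd, Fin.val_natAdd, Fin.val_rev, this]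
    cases s i.rev <;> cases t i <;> simp
  simp only [h1, h2]
  rw [← prod_rev fun i => ite (s i.rev = t i) _ _]
  simp only [Fin.rev_rev]
  rw [← Finset.prod_mul_distrib]
  split_ifs with h
  · subst h
    refine Finset.prod_congr rfl fun i _ => ?_
    cases h : s i <;> simp [rbar, h]
  · obtain ⟨i, hi⟩ := Function.ne_iff.1 h
    refine Finset.prod_eq_zero (Finset.mem_univ i.rev) ?_
    have : s i.rev = t i := by
      revert hi; simp only [rbar]; cases s i.rev <;> cases t i <;> simp
    simp [this]
end

section
variable {τ : ℂ}

lemma F_tensor_append {m n m' n' : ℕ} (x : Hom ℂ m n) (y : Hom ℂ m' n') (s s' t t') :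
    F τ (tensor x y) (Fin.append s s') (Fin.append t t') = F τ x s t * F τ y s' t' := by
  rw [F_tensor]; simp [Fin.append_left, Fin.append_right]

lemma append_cast {a b c : ℕ} (s : Fin a → Bool) (t : Fin b → Bool) (u : Fin c → Bool) :
    (fun i => Fin.append (Fin.append s t) u (Fin.cast (Nat.add_assoc a b c).symm i)) =
      Fin.append s (Fin.append t u) := by
  rw [Fin.append_assoc]; rfl

lemma append_cast' {a b c : ℕ} (s : Fin a → Bool) (t : Fin b → Bool) (u : Fin c → Bool) :
    (fun i => Fin.append s (Fin.append t u) (Fin.cast (Nat.add_assoc a b c) i)) =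
      Fin.append (Fin.append s t) u := by
  rw [Fin.append_assoc]; rfl

lemma Kw_append {a b : ℕ} (s : Fin a → Bool) (t : Fin b → Bool) :
    Kw τ (Fin.append s t) = Kw τ s * Kw τ t := by
  simp [Kw, Fin.prod_univ_add]

lemma append_empty {a : ℕ} (s : Fin a → Bool) (t : Fin 0 → Bool) : Fin.append s t = s := by
  funext i; exact Fin.append_left s t i

lemma rbar_inj {m : ℕ} {s t : Fin m → Bool} : rbar s = rbar t ↔ s = t :=
  ⟨fun h => by rw [← rbar_rbar s, h, rbar_rbar], fun h => h ▸ rfl⟩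

section linear
variable (hτ : τ ≠ 0) (hd : τ + τ⁻¹ ≠ 0) {k l m n : ℕ}
include hτ hd

lemma comp_add' (b : Hom ℂ m n) (a a' : Hom ℂ l m) : comp (τ + τ⁻¹) b (a + a') =
    comp (τ + τ⁻¹) b a + comp (τ + τ⁻¹) b a' := by
  refine F_inj hτ fun s u => ?_
  simp [F_comp hτ hd, F_add, add_mul, Finset.sum_add_distrib]

lemma comp_smul' (c : ℂ) (b : Hom ℂ m n) (a : Hom ℂ l m) : comp (τ + τ⁻¹) b (c • a) =
    c • comp (τ + τ⁻¹) b a := by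
  refine F_inj hτ fun s u => ?_
  simp [F_comp hτ hd, F_smul, mul_assoc, Finset.mul_sum]

lemma comp_zero' (b : Hom ℂ m n) : comp (τ + τ⁻¹) b (0 : Hom ℂ l m) = 0 := by
  refine F_inj hτ fun s u => ?_
  simp [F_comp hτ hd, F_zero]

lemma Tr_add' (x y : Hom ℂ n n) : Tr (τ + τ⁻¹) (x + y) = Tr (τ + τ⁻¹) x + Tr (τ + τ⁻¹) y := by
  simp [F_trace hτ hd, F_add, mul_add, Finset.sum_add_distrib]

lemma Tr_smul' (c : ℂ) (x : Hom ℂ n n) : Tr (τ + τ⁻¹) (c • x) = c * Tr (τ + τ⁻¹) x := by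
  simp [F_trace hτ hd, F_smul, Finset.mul_sum, mul_left_comm]

lemma tensor_eq_comp (x : Hom ℂ m n) (y : Hom ℂ k l) : tensor x y =
    comp (τ + τ⁻¹) (tensor (idHom ℂ n) y) (tensor x (idHom ℂ k)) := by
  refine F_inj hτ fun s u => ?_
  simp [F_comp hτ hd, F_tensor, sum_append, F_id hτ]

lemma tensor_eq_comp' (x : Hom ℂ m n) (y : Hom ℂ k l) : tensor x y =
    comp (τ + τ⁻¹) (tensor x (idHom ℂ l)) (tensor (idHom ℂ m) y) := by
  refine F_inj hτ fun s u => ?_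
  simp [F_comp hτ hd, F_tensor, sum_append, F_id hτ, mul_comm]
end linear

/-! ### Partial traces -/

/-- The identity followed by `k` nested caps. -/
noncomputable def capR (n k : ℕ) : Hom ℂ n (n + k + k) :=
  castH (Nat.add_zero n) (Nat.add_assoc n k k).symm (tensor (idHom ℂ n) (single (capND k)))

/-- The identity followed by `k` nested cups. -/
noncomputable def cupR (n k : ℕ) : Hom ℂ (n + k + k) n :=
  castH (Nat.add_assoc n k k).symm (Nat.add_zero n) (tensor (idHom ℂ n) (single (cupND k)))

/-- `k` nested caps followed by the identity. -/
noncomputable def capL (n k : ℕ) : Hom ℂ n (k + (k + n)) :=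
  castH (Nat.zero_add n) (Nat.add_assoc k k n) (tensor (single (capND k)) (idHom ℂ n))

/-- `k` nested cups followed by the identity. -/
noncomputable def cupL (n k : ℕ) : Hom ℂ (k + (k + n)) n :=
  castH (Nat.add_assoc k k n) (Nat.zero_add n) (tensor (single (cupND k)) (idHom ℂ n))

lemma cast_empty_append {n : ℕ} (s : Fin n → Bool) : (fun i => s (Fin.cast (Nat.zero_add n) i)) =
    Fin.append Fin.elim0 s := by
  funext i
  rw [Fin.elim0_append]; rfl

section caps
variable (hτ : τ ≠ 0) {n k : ℕ}
include hτ

lemma F_capR (s s' : Fin n → Bool) (r r' : Fin k → Bool) :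
    F τ (capR n k) s (Fin.append (Fin.append s' r) r') =
      if s' = s then if r' = rbar r then capW τ r else 0 else 0 := by
  rw [capR, F_castH, append_cast, show (fun i => s (Fin.cast (Nat.add_zero n) i)) =
    Fin.append s Fin.elim0 from (append_empty _ _).symm, F_tensor_append, F_id hτ, F_capN hτ]
  simp only [ite_mul, one_mul, zero_mul, eq_comm (a := s)]

lemma F_cupR (s s' : Fin n → Bool) (r r' : Fin k → Bool) :
    F τ (cupR n k) (Fin.append (Fin.append s' r) r') s =
      if s' = s then if r' = rbar r then cupW τ r else 0 else 0 := by
  rw [cupR, F_castH, append_cast, show (fun i => s (Fin.cast (Nat.add_zero n) i)) =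
    Fin.append s Fin.elim0 from (append_empty _ _).symm, F_tensor_append, F_id hτ, F_cupN]
  simp only [ite_mul, one_mul, zero_mul]

lemma F_capL (s s' : Fin n → Bool) (r r' : Fin k → Bool) :
    F τ (capL n k) s (Fin.append r (Fin.append r' s')) =
      if s' = s then if r' = rbar r then capW τ r else 0 else 0 := by
  rw [capL, F_castH, append_cast', cast_empty_append, F_tensor_append, F_id hτ, F_capN hτ]
  simp only [mul_ite, mul_one, mul_zero, eq_comm (a := s)]

lemma F_cupL (s s' : Fin n → Bool) (r r' : Fin k → Bool) :
    F τ (cupL n k) (Fin.append r (Fin.append r' s')) s =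
      if s' = s then if r' = rbar r then cupW τ r else 0 else 0 := by
  rw [cupL, F_castH, append_cast', cast_empty_append, F_tensor_append, F_id hτ, F_cupN]
  simp only [mul_ite, mul_one, mul_zero]
end caps

/-- The partial trace closing up the last `k` strands. -/
noncomputable def ptrR (τ : ℂ) {m n k : ℕ} (z : Hom ℂ (n + k) (m + k)) : Hom ℂ n m :=
  comp (τ + τ⁻¹) (cupR m k) (comp (τ + τ⁻¹) (tensor z (idHom ℂ k)) (capR n k))

/-- The partial trace closing up the first `k` strands. -/
noncomputable def ptrL (τ : ℂ) {m n k : ℕ} (z : Hom ℂ (k + n) (k + m)) : Hom ℂ n m :=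
  comp (τ + τ⁻¹) (cupL m k) (comp (τ + τ⁻¹) (tensor (idHom ℂ k) z) (capL n k))

section ptr
variable (hτ : τ ≠ 0) (hd : τ + τ⁻¹ ≠ 0) {m n k : ℕ}
include hτ hd

lemma F_ptrR (z : Hom ℂ (n + k) (m + k)) (s t) :
    F τ (ptrR τ z) s t = ∑ r, Kw τ r * F τ z (Fin.append s r) (Fin.append t r) := by
  simp only [ptrR, F_comp hτ hd, sum_append (a := _ + _), sum_append (a := n), sum_append (a := m),
    F_capR hτ, F_cupR hτ, F_tensor_append, F_id hτ]
  simp [rbar_inj, ← cap_mul_cup]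
  refine Finset.sum_congr rfl fun r _ => by ring

lemma F_ptrL (z : Hom ℂ (k + n) (k + m)) (s t) :
    F τ (ptrL τ z) s t = ∑ r, (Kw τ r)⁻¹ * F τ z (Fin.append r s) (Fin.append r t) := by
  simp only [ptrL, F_comp hτ hd, sum_append (b := _ + _), sum_append (b := n), sum_append (b := m),
    F_capL hτ, F_cupL hτ, F_tensor_append, F_id hτ]
  simp
  refine Fintype.sum_bijective rbar (Function.Involutive.bijective rbar_rbar) _ _ fun r => ?_
  rw [Kw_rbar, inv_inv, ← cap_mul_cup]
  ring
end ptr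

section ideal
variable (hτ : τ ≠ 0) (hd : τ + τ⁻¹ ≠ 0)
include hτ hd

lemma Tr_tensor_id {m n k : ℕ} (x : Hom ℂ m n) (z : Hom ℂ (n + k) (m + k)) :
    Tr (τ + τ⁻¹) (comp (τ + τ⁻¹) z (tensor x (idHom ℂ k))) =
      Tr (τ + τ⁻¹) (comp (τ + τ⁻¹) (ptrR τ z) x) := by
  simp only [F_trace hτ hd, F_comp hτ hd, sum_append, F_ptrR hτ hd, F_tensor_append, F_id hτ,
    Kw_append]
  simp [Finset.mul_sum]
  refine Finset.sum_congr rfl fun s _ => ?_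
  rw [Finset.sum_comm]
  refine Finset.sum_congr rfl fun s _ => Finset.sum_congr rfl fun s _ => by ring

lemma Tr_id_tensor {m n k : ℕ} (x : Hom ℂ m n) (z : Hom ℂ (k + n) (k + m)) :
    Tr (τ + τ⁻¹) (comp (τ + τ⁻¹) z (tensor (idHom ℂ k) x)) =
      Tr (τ + τ⁻¹) (comp (τ + τ⁻¹) (ptrL τ z) x) := by
  simp only [F_trace_left hτ hd, F_comp hτ hd, sum_append, F_ptrL hτ hd, F_tensor_append, F_id hτ,
    Kw_append]
  simp [Finset.mul_sum]
  rw [Finset.sum_comm]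
  refine Finset.sum_congr rfl fun s _ => ?_
  rw [Finset.sum_comm]
  refine Finset.sum_congr rfl fun s _ => Finset.sum_congr rfl fun s _ => by ring

lemma Negl_comp_left {l m n : ℕ} (b : Hom ℂ m n) {a : Hom ℂ l m} (ha : a ∈ Negl (τ + τ⁻¹) l m) :
    comp (τ + τ⁻¹) b a ∈ Negl (τ + τ⁻¹) l n := fun c => by
  rw [comp_assoc' hτ hd]; exact ha _

lemma Negl_comp_right {l m n : ℕ} {b : Hom ℂ m n} (a : Hom ℂ l m) (hb : b ∈ Negl (τ + τ⁻¹) m n) :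
    comp (τ + τ⁻¹) b a ∈ Negl (τ + τ⁻¹) l n := fun c => by
  rw [Tr_comm hτ hd, ← comp_assoc' hτ hd, Tr_comm hτ hd]; exact hb _

lemma Negl_isIdealEv : IsIdealEv (τ + τ⁻¹) (Negl (τ + τ⁻¹)) where
  zero_mem m n _ _ b := by simp [comp_zero' hτ hd, Tr]
  add_mem m n _ _ x hx y hy b := by rw [comp_add' hτ hd, Tr_add' hτ hd, hx, hy, add_zero]
  smul_mem m n _ _ c x hx b := by rw [comp_smul' hτ hd, Tr_smul' hτ hd, hx, mul_zero]
  comp_mem_left _ _ _ b a ha := Negl_comp_left hτ hd b ha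
  comp_mem_right _ _ _ b a hb := Negl_comp_right hτ hd a hb
  tensor_mem_left _ _ _ _ x y hx := by
    rw [tensor_eq_comp hτ hd]
    refine Negl_comp_left hτ hd _ fun z => ?_
    rw [Tr_tensor_id hτ hd]; exact hx _
  tensor_mem_right _ _ _ _ x y hy := by
    rw [tensor_eq_comp' hτ hd]
    refine Negl_comp_left hτ hd _ fun z => ?_
    rw [Tr_id_tensor hτ hd]; exact hy _

lemma Negl_proper : IdealProperEv (Negl (τ + τ⁻¹)) := by
  refine ⟨0, 0, Even.zero, Even.zero, fun h => ?_⟩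
  have := (h ▸ Set.mem_univ _ : idHom ℂ 0 ∈ Negl (τ + τ⁻¹) 0 0) (idHom ℂ 0)
  rw [id_comp' hτ hd, F_trace hτ hd] at this
  simp [F_id hτ, Kw] at this

/-- A proper ideal is contained in the ideal of negligible morphisms. -/
lemma le_Negl_of_proper {J : ∀ m n : ℕ, Set (Hom ℂ m n)} (hJ : IsIdealEv (τ + τ⁻¹) J)
    (hp : IdealProperEv J) {m n : ℕ} (hm : Even m) (hn : Even n) : J m n ⊆ Negl (τ + τ⁻¹) m n := by
  intro a ha b
  by_contra hb
  obtain ⟨m', n', hm', hn', hne⟩ := hp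
  apply hne
  have h0 : ∀ x ∈ J m m, castH (Nat.zero_add m).symm (Nat.zero_add m).symm x ∈ J (0 + m) (0 + m) :=
    fun x hx => castH_mem.2 hx
  have h1 : ptrR τ (castH (Nat.zero_add m).symm (Nat.zero_add m).symm (comp (τ + τ⁻¹) b a)) ∈
      J 0 0 := by
    have e1 : Even (0 + m) := by simpa
    have e2 : Even (0 + m + m) := by simp
    exact hJ.comp_mem_left Even.zero e2 Even.zero _ _ <| hJ.comp_mem_right Even.zero e2 e2 _ _ <|
      hJ.tensor_mem_left e1 e1 hm hm _ _ <| h0 _ <| hJ.comp_mem_left hm hn hm _ _ ha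
  have h2 : idHom ℂ 0 ∈ J 0 0 := by
    convert hJ.smul_mem 0 0 Even.zero Even.zero (Tr (τ + τ⁻¹) (comp (τ + τ⁻¹) b a))⁻¹ _ h1 using 1
    refine F_inj hτ fun s t => ?_
    rw [F_smul, F_ptrR hτ hd, F_id hτ, if_pos (Subsingleton.elim _ _), eq_comm,
      inv_mul_eq_one₀ hb, F_trace hτ hd]
    refine Finset.sum_congr rfl fun r _ => ?_
    rw [F_castH]
    have : ∀ s : Fin 0 → Bool,
        (fun i => Fin.append s r (Fin.cast (Nat.zero_add m).symm i)) = r := by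
      intro s
      rw [Subsingleton.elim s Fin.elim0, Fin.elim0_append]; rfl
    rw [this, this]
  refine Set.eq_univ_of_forall fun y => ?_
  have := hJ.tensor_mem_right hm' hn' Even.zero Even.zero y _ h2
  have e : y = (tensor y (idHom ℂ 0) : Hom ℂ m' n') := F_inj hτ fun s t => by
    refine Eq.trans ?_ (F_tensor y (idHom ℂ 0) s t).symm
    rw [F_id hτ, if_pos (Subsingleton.elim _ _), mul_one]; rfl
  rw [e]; exact this
end ideal
end

section
variable {τ : ℂ}

/-! ### Adjacent caps and cups -/

/-- The state of a single point. -/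
def b1 (x : Bool) : Fin 1 → Bool := fun _ => x

/-- A state on `i + 2 + j` points with the two middle points specified. -/
def mid {i j : ℕ} (a : Fin i → Bool) (x y : Bool) (b : Fin j → Bool) :
    Fin (i + (1 + 1) + j) → Bool :=
  Fin.append (Fin.append a (Fin.append (b1 x) (b1 y))) b

lemma sum_two (f : (Fin (1 + 1) → Bool) → ℂ) :
    ∑ w, f w = ∑ x, ∑ y, f (Fin.append (b1 x) (b1 y)) := by
  have h : ∀ g : (Fin 1 → Bool) → ℂ, ∑ w, g w = ∑ x, g (b1 x) := fun g =>
    Fintype.sum_equiv (Equiv.funUnique (Fin 1) Bool) _ _ fun w => congrArg g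
      (funext fun i => by rw [Subsingleton.elim i default]; rfl)
  rw [sum_append, h]
  exact Finset.sum_congr rfl fun _ _ => h _

lemma rbar_b1 (x : Bool) : rbar (b1 x) = b1 (!x) := rfl

lemma b1_inj {x y : Bool} : b1 x = b1 y ↔ x = y := ⟨fun h => congrFun h 0, fun h => h ▸ rfl⟩

/-- The cup joining the points `i` and `i+1` among `i + 2 + j` points. -/
noncomputable def cupI (i j : ℕ) : Hom ℂ (i + (1 + 1) + j) (i + j) :=
  tensor (tensor (idHom ℂ i) (single (cupND 1)) : Hom ℂ (i + (1 + 1)) (i + 0)) (idHom ℂ j)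

/-- The cap joining the points `i` and `i+1` among `i + 2 + j` points. -/
noncomputable def capI (i j : ℕ) : Hom ℂ (i + j) (i + (1 + 1) + j) :=
  tensor (tensor (idHom ℂ i) (single (capND 1)) : Hom ℂ (i + 0) (i + (1 + 1))) (idHom ℂ j)

section mid
variable (hτ : τ ≠ 0) {i j : ℕ}
include hτ

lemma F_cupI (a a' : Fin i → Bool) (x y : Bool) (b b' : Fin j → Bool) :
    F τ (cupI i j) (mid a x y b) (Fin.append a' b') =
      if a = a' then if b = b' then if y = !x then if x then τ⁻¹ else 1 else 0 else 0 else 0 := by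
  rw [cupI, mid]
  refine (F_tensor_append _ _ _ _ _ _).trans ?_
  rw [← append_empty a' Fin.elim0, F_tensor_append, F_id hτ, F_id hτ, F_cupN, rbar_b1]
  simp only [b1_inj, cupW, Fin.prod_univ_one, b1, append_empty]
  split_ifs <;> simp_all

lemma F_capI (a a' : Fin i → Bool) (x y : Bool) (b b' : Fin j → Bool) :
    F τ (capI i j) (Fin.append a' b') (mid a x y b) =
      if a = a' then if b = b' then if y = !x then if x then 1 else τ else 0 else 0 else 0 := by
  rw [capI, mid]
  refine (F_tensor_append _ _ _ _ _ _).trans ?_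
  rw [← append_empty a' Fin.elim0, F_tensor_append, F_id hτ, F_id hτ, F_capN hτ, rbar_b1]
  simp only [b1_inj, capW, Fin.prod_univ_one, b1, append_empty, eq_comm (a := a'),
    eq_comm (a := b')]
  split_ifs <;> simp_all

omit hτ in
lemma sum_mid (f : (Fin (i + (1 + 1) + j) → Bool) → ℂ) :
    ∑ w, f w = ∑ a, ∑ x, ∑ y, ∑ b, f (mid a x y b) := by
  rw [sum_append, sum_append]
  refine Finset.sum_congr rfl fun a _ => ?_
  rw [sum_two]; rfl

variable (hd : τ + τ⁻¹ ≠ 0)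
include hd

lemma F_cupI_comp {m : ℕ} (z : Hom ℂ m (i + (1 + 1) + j)) (s a b) :
    F τ (comp (τ + τ⁻¹) (cupI i j) z) s (Fin.append a b) =
      τ⁻¹ * F τ z s (mid a true false b) + F τ z s (mid a false true b) := by
  simp only [F_comp hτ hd, sum_mid, F_cupI hτ]
  simp [mul_comm]
end mid

lemma exists_mid {i j : ℕ} (s : Fin (i + (1 + 1) + j) → Bool) :
    ∃ a x y b, s = mid a x y b := by
  refine ⟨fun k => s ((k.castAdd (1 + 1)).castAdd j),
    s (((0 : Fin 1).castAdd 1).natAdd i |>.castAdd j),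
    s (((0 : Fin 1).natAdd 1).natAdd i |>.castAdd j), fun k => s (k.natAdd (i + (1 + 1))), ?_⟩
  funext k
  refine k.addCases (fun k => ?_) fun k => ?_
  · refine k.addCases (fun k => ?_) fun k => ?_
    · simp [mid]
    · refine k.addCases (fun k => ?_) fun k => ?_ <;>
        simp only [mid, Fin.append_left, Fin.append_right, Subsingleton.elim k 0, b1]
  · simp [mid]
end

section
variable {τ : ℂ}

/-! ### Factoring diagrams other than the identity -/

lemma exists_cup {n : ℕ} {D : Diagram n n} (hD : D ≠ idD n) :
    ∃ i j, D.pair (.inl i) = .inl j := by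
  by_contra! h
  have h1 : ∀ i, ∃ j, D.pair (.inl i) = .inr j := fun i => by
    rcases hi : D.pair (.inl i) with j | j
    · exact absurd hi (h i j)
    · exact ⟨j, rfl⟩
  choose f hf using h1
  have hinj : Function.Injective f := fun a b hab => by
    have : D.pair (.inl a) = D.pair (.inl b) := by rw [hf, hf, hab]
    exact Sum.inl_injective (D.involutive.injective this)
  have hsurj := Finite.surjective_of_injective hinj
  refine hD (Diagram.ext_pair (eq_of_opn (bIdx_inj n n) D.isNC (idD n).isNC (funext fun x => ?_)))
  rcases x with i | j
  · have := i.isLt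
    simp only [opn, hf, idD, Sum.elim_inl, bIdx]
    congr 1; simp only [eq_iff_iff]; omega
  · obtain ⟨i, rfl⟩ := hsurj j
    have := i.isLt
    have h2 : D.pair (.inr (f i)) = .inl i := by rw [← hf, D.involutive]
    simp only [opn, h2, idD, Sum.elim_inr, bIdx]
    congr 1; simp only [eq_iff_iff]; have := (f i).isLt; omega

lemma exists_adj {m n : ℕ} (D : Diagram m n) : ∀ N : ℕ, ∀ i j : Fin m, (i : ℕ) < j →
    (j : ℕ) - i ≤ N → D.pair (.inl i) = .inl j →
    ∃ (a : ℕ) (h : a + 1 < m), (i : ℕ) ≤ a ∧ D.pair (.inl ⟨a, by omega⟩) = .inl ⟨a + 1, h⟩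
  | 0, i, j, h1, h2, _ => by omega
  | N + 1, i, j, h1, h2, h => by
    by_cases hj : (j : ℕ) = i + 1
    · exact ⟨i, by omega, le_rfl, by rw [h]; congr; exact Fin.ext hj⟩
    have hlt : (i : ℕ) + 1 < m := by omega
    have hne := (bIdx_inj m n).ne (D.fixedPointFree (.inl ⟨i + 1, hlt⟩))
    have h3 := D.noncrossing (.inl i) (.inl ⟨i + 1, hlt⟩)
    have h4 := D.noncrossing (D.pair (.inl ⟨i + 1, hlt⟩)) (.inl i)
    rw [D.involutive, h] at h4
    rw [h] at h3
    have h5 : ∀ x, bIdx m n (D.pair x) = i → x = .inl j := fun x hx => by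
      have : D.pair x = .inl i := bIdx_inj m n hx
      rw [← D.involutive x, this, h]
    have h6 : ∀ x, bIdx m n (D.pair x) = j → x = .inl i := fun x hx => by
      have : D.pair x = .inl j := bIdx_inj m n hx
      rw [← D.involutive x, this, ← h, D.involutive]
    have h5' := h5 (.inl ⟨i + 1, hlt⟩)
    have h6' := h6 (.inl ⟨i + 1, hlt⟩)
    rcases hk : D.pair (.inl ⟨i + 1, hlt⟩) with k | k
    · rw [hk] at h3 h4 hne h5' h6'
      simp only [bIdx, Sum.inl.injEq, Fin.ext_iff] at h3 h4 hne h5' h6'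
      obtain ⟨a, ha, hia, h7⟩ :=
        exists_adj D N ⟨i + 1, hlt⟩ k (by simp only; omega) (by simp only; omega) hk
      exact ⟨a, ha, by simp only at hia; omega, h7⟩
    · rw [hk] at h3
      simp only [bIdx] at h3
      omega

lemma exists_adj' {n : ℕ} {D : Diagram n n} (hD : D ≠ idD n) :
    ∃ (a : ℕ) (h : a + 1 < n), D.pair (.inl ⟨a, by omega⟩) = .inl ⟨a + 1, h⟩ := by
  obtain ⟨i, j, h⟩ := exists_cup hD
  have hne : i ≠ j := fun e => D.fixedPointFree (.inl i) (by rw [h, e])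
  rcases lt_or_gt_of_ne hne with h1 | h1
  · obtain ⟨a, ha, -, h2⟩ := exists_adj D _ i j h1 le_rfl h
    exact ⟨a, ha, h2⟩
  · obtain ⟨a, ha, -, h2⟩ := exists_adj D _ j i h1 le_rfl (by rw [← h, D.involutive])
    exact ⟨a, ha, h2⟩

lemma Phi_swap {X : Type} [Fintype X] {pos : X → ℕ} {p : X → X} (hp : ∀ x, p (p x) = x)
    {x y : X} (hxy : p x = y) (hlt : pos x < pos y) {σ σ' : X → Bool}
    (h : ∀ z, z ≠ x → z ≠ y → σ z = σ' z)
    (h1 : σ x = true) (h2 : σ y = false) (h3 : σ' x = false) (h4 : σ' y = true) :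
    Phi τ pos p σ = τ⁻¹ * Phi τ pos p σ' := by
  have hyx : p y = x := by rw [← hxy, hp]
  have hne : x ≠ y := fun e => by rw [e] at hlt; exact lt_irrefl _ hlt
  have hs : ∀ f : X → ℂ, ∏ z, f z = f x * (f y * ∏ z ∈ (Finset.univ.erase x).erase y, f z) :=
    fun f => by
      rw [← Finset.mul_prod_erase _ _ (Finset.mem_univ x), ← Finset.mul_prod_erase _ f
        (Finset.mem_erase.2 ⟨hne.symm, Finset.mem_univ y⟩)]
  rw [Phi, Phi, hs, hs fun z => hW τ pos p σ' z]
  have : ∀ z ∈ (Finset.univ.erase x).erase y, hW τ pos p σ z = hW τ pos p σ' z := fun z hz => by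
    simp only [Finset.mem_erase, Finset.mem_univ, and_true] at hz
    rw [hW, hW, h z hz.2 hz.1, h (p z)]
    · intro e; exact hz.1 (by rw [← hxy, ← e, hp])
    · intro e; exact hz.2 (by rw [← hyx, ← e, hp])
  rw [Finset.prod_congr rfl this]
  have e1 : hW τ pos p σ x = τ⁻¹ := by simp [hW, hxy, h1, h2, hlt]
  have e2 : hW τ pos p σ y = 1 := by simp [hW, hyx, h1, h2]
  have e3 : hW τ pos p σ' x = 1 := by simp [hW, hxy, h3, h4]
  have e4 : hW τ pos p σ' y = 1 := by simp [hW, hyx, h3, h4, hlt.not_gt]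
  rw [e1, e2, e3, e4, one_mul, one_mul]

lemma FD_ne_pair {m n : ℕ} {D : Diagram m n} {s t} (h : FD τ D s t ≠ 0) (x : Fin m ⊕ Fin n) :
    (Sum.elim s fun j => !t j : _ → Bool) (D.pair x) = !(Sum.elim s fun j => !t j : _ → Bool) x :=
  ne_of_Phi (right_ne_zero_of_mul h) x

lemma F_top (hτ : τ ≠ 0) {n : ℕ} (x : Hom ℂ n n) :
    F τ x (fun _ => true) (fun _ => true) = x (idD n) := by
  rw [F, Finset.sum_eq_single (idD n)]
  · have := F_id hτ (n := n) (fun _ => true) fun _ => true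
    rw [if_pos rfl] at this
    rw [← F_single, show single (idD n) = idHom ℂ n from rfl, this, mul_one]
  · intro D _ hD
    obtain ⟨i, j, h⟩ := exists_cup hD
    by_contra h0
    have := FD_ne_pair (right_ne_zero_of_mul h0) (.inl i)
    rw [h] at this
    simp at this
  · simp

section mid
variable {i j : ℕ} (a : Fin i → Bool) (x y x' y' : Bool) (b : Fin j → Bool)

lemma mid_left (h) : mid a x y b ⟨i, h⟩ = x := by
  rw [show (⟨i, h⟩ : Fin (i + (1 + 1) + j)) =
    (((0 : Fin 1).castAdd 1).natAdd i).castAdd j from Fin.ext (by simp)]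
  simp only [mid, Fin.append_left, Fin.append_right, b1]

lemma mid_right (h) : mid a x y b ⟨i + 1, h⟩ = y := by
  rw [show (⟨i + 1, h⟩ : Fin (i + (1 + 1) + j)) =
    (((0 : Fin 1).natAdd 1).natAdd i).castAdd j from Fin.ext (by simp)]
  simp only [mid, Fin.append_left, Fin.append_right, b1]

lemma mid_off (k : Fin (i + (1 + 1) + j)) (h : (k : ℕ) ≠ i) (h' : (k : ℕ) ≠ i + 1) :
    mid a x y b k = mid a x' y' b k := by
  revert h h'
  refine k.addCases (fun k => ?_) fun k => ?_
  · refine k.addCases (fun k => ?_) fun k => ?_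
    · simp [mid]
    · refine k.addCases (fun k => ?_) fun k => ?_
      · simp
      · simp
  · simp [mid]
end mid

section factor
variable (hτ : τ ≠ 0) (hd : τ + τ⁻¹ ≠ 0)
include hτ hd

omit hτ hd in
lemma F_mid {i j n : ℕ} (D : Diagram (i + (1 + 1) + j) n)
    (h : D.pair (.inl ⟨i, by omega⟩) = .inl ⟨i + 1, by omega⟩) (a x b t) :
    FD τ D (mid a x (!x) b) t = (if x then τ⁻¹ else 1) * FD τ D (mid a false true b) t := by
  cases x
  · simp
  · simp only [FD, Bool.not_true, if_true]
    rw [Phi_swap (τ := τ) D.involutive h (by simp [bIdx])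
      (σ' := Sum.elim (mid a false true b) fun j => !t j)]
    · ring
    · rintro (k | k) h1 h2
      · refine mid_off _ _ _ _ _ _ k (fun e => h1 ?_) (fun e => h2 ?_)
        · exact congrArg Sum.inl (Fin.ext e)
        · exact congrArg Sum.inl (Fin.ext e)
      · rfl
    · exact mid_left _ _ _ _ _
    · exact mid_right _ _ _ _ _
    · exact mid_left _ _ _ _ _
    · exact mid_right _ _ _ _ _

lemma factor {n : ℕ} {D : Diagram n n} (hD : D ≠ idD n) :
    ∃ (i j : ℕ) (h : i + (1 + 1) + j = n) (v : Hom ℂ (i + j) n),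
      single D = comp (τ + τ⁻¹) v (castH h rfl (cupI i j)) := by
  obtain ⟨i, hi, h⟩ := exists_adj' hD
  obtain ⟨j, hj⟩ : ∃ j, i + (1 + 1) + j = n := ⟨n - (i + 2), by omega⟩
  refine ⟨i, j, hj, (τ + τ⁻¹)⁻¹ • comp (τ + τ⁻¹) (single D) (castH rfl hj (capI i j)), ?_⟩
  clear hD
  have : ∀ (m : ℕ) (D : Diagram (i + (1 + 1) + j) m) 
      (h : D.pair (.inl ⟨i, by omega⟩) = .inl ⟨i + 1, by omega⟩),
      single D =
        comp (τ + τ⁻¹) ((τ + τ⁻¹)⁻¹ • comp (τ + τ⁻¹) (single D) (capI i j)) (cupI i j) := by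
    intro m D h
    refine F_inj hτ fun s t => ?_
    obtain ⟨a, x, y, b, rfl⟩ := exists_mid s
    simp only [F_comp hτ hd, F_smul, sum_append (a := i) (b := j), sum_mid, F_cupI hτ, F_capI hτ,
      F_single]
    by_cases hy : y = !x
    · subst hy
      rw [F_mid D h]
      have := F_mid (τ := τ) D h a true b t
      simp only [Bool.not_true] at this
      simp [this]
      have e : (τ + τ⁻¹)⁻¹ * (τ⁻¹ * FD τ D (mid a false true b) t +
          τ * FD τ D (mid a false true b) t) = FD τ D (mid a false true b) t := by
        rw [← add_mul, add_comm τ⁻¹, inv_mul_cancel_left₀ hd]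
      rw [e]
    · have h0 : FD τ D (mid a x y b) t = 0 := by
        by_contra h0
        have := FD_ne_pair h0 (.inl ⟨i, by omega⟩)
        rw [h] at this
        simp only [Sum.elim_inl, mid_left, mid_right] at this
        exact hy this
      simp [h0, hy]
  subst hj
  exact this _ D h
end factor
end

section
variable {τ : ℂ}

/-! ### Morphisms killed by all adjacent cups -/

/-- `x` is killed by composition with all adjacent cups. -/
def Killed (τ : ℂ) {m n : ℕ} (x : Hom ℂ m n) : Prop :=
  ∀ (i j : ℕ) (h : i + (1 + 1) + j = n), comp (τ + τ⁻¹) (castH h rfl (cupI i j)) x = 0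

/-- The `q`-symmetric vector. -/
noncomputable def qp (τ : ℂ) {n : ℕ} (s : Fin n → Bool) : ℂ :=
  ∏ p, if s p then 1 else (-τ) ^ (p : ℕ)

lemma qp_ne (hτ : τ ≠ 0) {n : ℕ} (s : Fin n → Bool) : qp τ s ≠ 0 :=
  Finset.prod_ne_zero_iff.2 fun i _ => by split_ifs <;> simp [hτ]

lemma qp_mid {i j : ℕ} (a : Fin i → Bool) (b : Fin j → Bool) :
    qp τ (mid a true false b) = -τ * qp τ (mid a false true b) := by
  simp only [qp, mid, Fin.prod_univ_add, Fin.append_left, Fin.append_right, b1,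
    Fin.prod_univ_one, Fin.val_castAdd, Fin.val_natAdd]
  simp [pow_succ]
  ring

lemma mid_swap {i j : ℕ} (a : Fin i → Bool) (x y : Bool) (b : Fin j → Bool) :
    mid a x y b ∘ Equiv.swap ⟨i, by omega⟩ ⟨i + 1, by omega⟩ = mid a y x b := by
  funext k
  by_cases h : (k : ℕ) = i
  · rw [show k = ⟨i, by omega⟩ from Fin.ext h, Function.comp, Equiv.swap_apply_left, mid_right,
      mid_left]
  · by_cases h' : (k : ℕ) = i + 1
    · rw [show k = ⟨i + 1, by omega⟩ from Fin.ext h', Function.comp, Equiv.swap_apply_right,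
        mid_right, mid_left]
    · rw [Function.comp, Equiv.swap_apply_of_ne_of_ne]
      · exact mid_off _ _ _ _ _ _ _ h h'
      · exact fun e => h (congrArg Fin.val e)
      · exact fun e => h' (congrArg Fin.val e)

lemma invariant_perm {n : ℕ} (g : (Fin n → Bool) → ℂ)
    (hg : ∀ (i : ℕ) (h : i + 1 < n) (t : Fin n → Bool),
      g (t ∘ Equiv.swap ⟨i, by omega⟩ ⟨i + 1, h⟩) = g t) (t : Fin n → Bool)
    (σ : Equiv.Perm (Fin n)) : g (t ∘ σ) = g t := by
  cases n with
  | zero => exact congrArg g (Subsingleton.elim _ _)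
  | succ n =>
    have hσ : σ ∈ Submonoid.closure
        (Set.range fun i : Fin n => Equiv.swap i.castSucc i.succ) := by
      rw [Equiv.Perm.mclosure_swap_castSucc_succ]; trivial
    induction hσ using Submonoid.closure_induction generalizing t with
    | mem x hx =>
      obtain ⟨i, rfl⟩ := hx
      exact hg i (by omega) t
    | one => rfl
    | mul x y _ _ hx hy =>
      rw [Equiv.Perm.coe_mul, ← Function.comp_assoc, hy, hx]

lemma exists_perm {n : ℕ} {s t : Fin n → Bool} (h : cnt s = cnt t) :
    ∃ σ : Equiv.Perm (Fin n), s = t ∘ σ := by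
  have e : Nonempty ({i // s i = true} ≃ {i // t i = true}) := by
    rw [← Fintype.card_eq, Fintype.card_subtype, Fintype.card_subtype]; exact h
  obtain ⟨e⟩ := e
  refine ⟨e.extendSubtype, funext fun i => ?_⟩
  by_cases hi : s i = true
  · rw [Function.comp, e.extendSubtype_mem i hi, hi]
  · have := e.extendSubtype_not_mem i hi
    simp only [Bool.not_eq_true] at this hi
    rw [Function.comp, this, hi]

lemma Killed.eq (hτ : τ ≠ 0) (hd : τ + τ⁻¹ ≠ 0) {m n : ℕ} {x : Hom ℂ m n} (hx : Killed τ x)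
    (s) {t t' : Fin n → Bool} (h : cnt t = cnt t') :
    F τ x s t * qp τ t' = F τ x s t' * qp τ t := by
  have hg : ∀ (i : ℕ) (h : i + 1 < n) (t : Fin n → Bool),
      (fun t => F τ x s t / qp τ t) (t ∘ Equiv.swap ⟨i, by omega⟩ ⟨i + 1, h⟩) =
      (fun t => F τ x s t / qp τ t) t := by
    intro i hi
    obtain ⟨j, hj⟩ : ∃ j, i + (1 + 1) + j = n := ⟨n - (i + 2), by omega⟩
    subst hj
    intro t
    obtain ⟨a, y, z, b, rfl⟩ := exists_mid t
    have key : F τ x s (mid a true false b) = - τ * F τ x s (mid a false true b) := by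
      have := F_cupI_comp hτ hd x s a b
      rw [show comp (τ + τ⁻¹) (cupI i j) x = 0 from hx i j rfl, F_zero] at this
      field_simp at this
      linear_combination -this
    have k2 : F τ x s (mid a true false b) / qp τ (mid a true false b) =
        F τ x s (mid a false true b) / qp τ (mid a false true b) := by
      rw [key, qp_mid, mul_div_mul_left _ _ (neg_ne_zero.2 hτ)]
    simp only [mid_swap]
    cases y <;> cases z <;> simp [k2]
  obtain ⟨σ, rfl⟩ := exists_perm h
  have := invariant_perm (fun t => F τ x s t / qp τ t) hg t' σ
  rwa [div_eq_div_iff (qp_ne hτ _) (qp_ne hτ _)] at this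
end

section
variable {τ : ℂ}

/-! ### Vanishing of Gaussian binomial coefficients -/

/-- The generating polynomial of the elementary symmetric functions of `1, q, …, q^(N-1)`. -/
noncomputable def gpoly (q : ℂ) (N : ℕ) : Polynomial ℂ :=
  ∏ p ∈ Finset.range N, (1 + Polynomial.C (q ^ p) * Polynomial.X)

lemma gpoly_succ (q : ℂ) (N : ℕ) :
    gpoly q (N + 1) = gpoly q N * (1 + Polynomial.C (q ^ N) * Polynomial.X) :=
  Finset.prod_range_succ _ _

lemma gpoly_coeff_zero (q : ℂ) (N : ℕ) : (gpoly q N).coeff 0 = 1 := by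
  simp [gpoly, Polynomial.coeff_zero_prod]

lemma gpoly_coeff_succ (q : ℂ) (N r : ℕ) : (gpoly q (N + 1)).coeff (r + 1) =
    (gpoly q N).coeff (r + 1) + q ^ N * (gpoly q N).coeff r := by
  rw [gpoly_succ, mul_add, mul_one, Polynomial.coeff_add, mul_left_comm, Polynomial.coeff_C_mul,
    Polynomial.coeff_mul_X]

lemma gpoly_coeff_one (q : ℂ) (N : ℕ) : (gpoly q N).coeff 1 = ∑ p ∈ Finset.range N, q ^ p := by
  induction N with
  | zero => simp [gpoly, Polynomial.coeff_one]
  | succ N ih => rw [gpoly_coeff_succ, ih, gpoly_coeff_zero, Finset.sum_range_succ, mul_one]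

variable {q : ℂ} {ℓ : ℕ} (hq : IsPrimitiveRoot q ℓ) (hℓ : 0 < ℓ)
include hq hℓ

omit hq in
lemma prod_range_primitive {R : Type} [CommRing R] [IsDomain R] {ζ : R} (hζ : IsPrimitiveRoot ζ ℓ)
    (f : R → R) :
    ∏ p ∈ Finset.range ℓ, f (ζ ^ p) = ∏ z ∈ Polynomial.nthRootsFinset ℓ (1 : R), f z := by
  rw [← Finset.prod_image (g := fun p => ζ ^ p) (f := f) hζ.injOn_pow]
  congr 1
  refine Finset.eq_of_subset_of_card_le (fun z hz => ?_) ?_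
  · obtain ⟨p, _, rfl⟩ := Finset.mem_image.1 hz
    rw [Polynomial.mem_nthRootsFinset hℓ, ← pow_mul, mul_comm, pow_mul, hζ.pow_eq_one, one_pow]
  · rw [hζ.card_nthRootsFinset, Finset.card_image_of_injOn hζ.injOn_pow, Finset.card_range]

lemma gpoly_period (hodd : Odd ℓ) : gpoly q ℓ = 1 + Polynomial.X ^ ℓ := by
  have hC : IsPrimitiveRoot (Polynomial.C q) ℓ := hq.map_of_injective Polynomial.C_injective
  have := hC.pow_add_pow_eq_prod_add_mul 1 Polynomial.X hodd
  rw [one_pow] at this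
  rw [this, gpoly, ← prod_range_primitive hℓ hC fun z => 1 + z * Polynomial.X]
  simp

lemma gpoly_mul (hodd : Odd ℓ) (m : ℕ) : gpoly q (m * ℓ) = (1 + Polynomial.X ^ ℓ) ^ m := by
  induction m with
  | zero => simp [gpoly]
  | succ m ih =>
    rw [pow_succ, ← ih, ← gpoly_period hq hℓ hodd, gpoly, gpoly, gpoly, add_mul, one_mul,
      Finset.prod_range_add]
    congr 1
    refine Finset.prod_congr rfl fun p _ => ?_
    rw [pow_add, mul_comm m, pow_mul, hq.pow_eq_one, one_pow, one_mul]

omit hq in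
lemma coeff_pow_mul (m j : ℕ) : ((1 + Polynomial.X ^ ℓ : Polynomial ℂ) ^ m).coeff j =
    if ℓ ∣ j then (m.choose (j / ℓ) : ℂ) else 0 := by
  rw [show (1 + Polynomial.X ^ ℓ : Polynomial ℂ) ^ m =
    Polynomial.expand ℂ ℓ ((1 + Polynomial.X) ^ m) by simp, Polynomial.coeff_expand hℓ,
    Polynomial.coeff_one_add_X_pow]

lemma eq_of_gpoly_coeff (hodd : Odd ℓ) (hℓ1 : 1 < ℓ) {k : ℕ} (hk : 1 ≤ k)
    (h : ∀ r, 1 ≤ r → r ≤ k → (gpoly q (k + r)).coeff r = 0) : k + 1 = ℓ := by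
  have h1 := h 1 le_rfl hk
  rw [gpoly_coeff_one] at h1
  have h2 := geom_sum_mul q (k + 1)
  rw [h1, zero_mul, eq_comm, sub_eq_zero, hq.pow_eq_one_iff_dvd] at h2
  obtain ⟨m, hm⟩ := h2
  rcases Nat.lt_or_ge m 2 with hm2 | hm2
  · interval_cases m
    · simp at hm
    · simpa using hm
  exfalso
  have hle : ℓ * 2 ≤ ℓ * m := Nat.mul_le_mul_left _ hm2
  set P := k + ℓ with hP
  have hP1 : P + 1 = (m + 1) * ℓ := by rw [hP, add_mul, mul_comm m, ← hm]; omega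
  have hz := h ℓ hℓ (by omega)
  have hqP : q ^ P = q⁻¹ := by
    refine eq_inv_of_mul_eq_one_left ?_
    rw [← pow_succ, hP1, mul_comm, pow_mul, hq.pow_eq_one, one_pow]
  have hrec : ∀ j, (gpoly q P).coeff (j + 1) + q⁻¹ * (gpoly q P).coeff j =
      if ℓ ∣ j + 1 then ((m + 1).choose ((j + 1) / ℓ) : ℂ) else 0 := fun j => by
    rw [← hqP, ← gpoly_coeff_succ, hP1, gpoly_mul hq hℓ hodd, coeff_pow_mul hℓ]
  have hlow : ∀ j, j < ℓ → (gpoly q P).coeff j = (-q⁻¹) ^ j := by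
    intro j
    induction j with
    | zero => intro _; rw [gpoly_coeff_zero, pow_zero]
    | succ j ih =>
      intro hj
      have := hrec j
      rw [if_neg (Nat.not_dvd_of_pos_of_lt (by omega) hj), ih (by omega)] at this
      rw [pow_succ]
      linear_combination this
  obtain ⟨e, he⟩ : ∃ e, ℓ = e + 1 := ⟨ℓ - 1, by omega⟩
  have h3 := hrec e
  rw [hlow e (by omega), ← he, if_pos dvd_rfl, Nat.div_self hℓ, Nat.choose_one_right, hz] at h3
  have h4 : (-q⁻¹) ^ ℓ = -1 := by
    rw [hodd.neg_pow, inv_pow, hq.pow_eq_one, inv_one]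
  rw [he, pow_succ] at h4
  have h5 : (m : ℂ) = 0 := by
    push_cast at h3
    linear_combination -h3 - h4
  rw [Nat.cast_eq_zero] at h5
  omega
end

section
variable {τ : ℂ}

/-! ### Killed morphisms from the unit object -/

/-- The order-preserving identification of the boundary points of `(0,n)`- and
`(n,0)`-diagrams. -/
def flipE (n : ℕ) : Fin 0 ⊕ Fin n ≃ Fin n ⊕ Fin 0 :=
  (Equiv.sumComm _ _).trans (Equiv.sumCongr Fin.revPerm (Equiv.refl _))

lemma bIdx_flipE {n : ℕ} (x) : bIdx n 0 (flipE n x) = bIdx 0 n x := by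
  rcases x with i | j
  · exact i.elim0
  · simp only [flipE, Equiv.trans_apply, Equiv.sumComm_apply, Sum.swap_inr, Equiv.sumCongr_apply,
      Sum.map_inl, bIdx, Fin.revPerm_apply, Fin.val_rev]
    omega

/-- The `(n,0)`-diagram obtained by rotating a `(0,n)`-diagram. -/
def flipD {n : ℕ} (D : Diagram 0 n) : Diagram n 0 where
  pair x := flipE n (D.pair ((flipE n).symm x))
  involutive x := by simp [D.involutive _]
  fixedPointFree x h := D.fixedPointFree ((flipE n).symm x) ((flipE n).eq_symm_apply.2 h)
  noncrossing x y := by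
    have := D.noncrossing ((flipE n).symm x) ((flipE n).symm y)
    simpa only [bIdx_flipE, ← bIdx_flipE (n := n) ((flipE n).symm _), Equiv.apply_symm_apply]
      using this

lemma flipD_pair {n : ℕ} (D : Diagram 0 n) (x) :
    (flipD D).pair (flipE n x) = flipE n (D.pair x) := by simp [flipD]

lemma exists_adj_bot {P R : ℕ} (D : Diagram 0 (P + R)) (hPR : R < P) :
    ∃ (a : ℕ) (h : a + 1 < P), D.pair (.inr ⟨a, by omega⟩) = .inr ⟨a + 1, by omega⟩ := by
  obtain ⟨i, j, hij⟩ : ∃ i j : Fin P, D.pair (.inr (i.castAdd R)) = .inr (j.castAdd R) := by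
    by_contra! h
    have h1 : ∀ i : Fin P, ∃ r : Fin R, D.pair (.inr (i.castAdd R)) = .inr (r.natAdd P) := by
      intro i
      rcases hi : D.pair (.inr (i.castAdd R)) with k | k
      · exact k.elim0
      · induction k using Fin.addCases with
        | left k => exact absurd hi (h i k)
        | right k => exact ⟨k, rfl⟩
    choose f hf using h1
    have hinj : Function.Injective f := fun a b hab => by
      have : D.pair (.inr (a.castAdd R)) = D.pair (.inr (b.castAdd R)) := by rw [hf, hf, hab]
      exact Fin.castAdd_injective _ _ (Sum.inr_injective (D.involutive.injective this))
    have := Fintype.card_le_of_injective f hinj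
    simp only [Fintype.card_fin] at this
    omega
  have key : ∀ i j : Fin P, (j : ℕ) < i → D.pair (.inr (i.castAdd R)) = .inr (j.castAdd R) →
      ∃ (a : ℕ) (h : a + 1 < P), D.pair (.inr ⟨a, by omega⟩) = .inr ⟨a + 1, by omega⟩ := by
    intro i j hji hij
    have h1 := flipD_pair D (.inr (i.castAdd R))
    rw [hij] at h1
    obtain ⟨a, ha, hia, h2⟩ := exists_adj (flipD D) _ (i.castAdd R).rev (j.castAdd R).rev
      (by simp only [Fin.val_rev, Fin.val_castAdd]; omega) le_rfl h1
    simp only [Fin.val_rev, Fin.val_castAdd] at hia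
    have hi := i.isLt
    refine ⟨P + R - 2 - a, by omega, ?_⟩
    have e1 : (Sum.inl ⟨a, by omega⟩ : Fin (P + R) ⊕ Fin 0) =
        flipE (P + R) (.inr ⟨P + R - 2 - a + 1, by omega⟩) :=
      congrArg Sum.inl (Fin.ext (by simp only [Fin.revPerm_apply, Fin.val_rev]; omega))
    have e2 : (Sum.inl ⟨a + 1, ha⟩ : Fin (P + R) ⊕ Fin 0) =
        flipE (P + R) (.inr ⟨P + R - 2 - a, by omega⟩) :=
      congrArg Sum.inl (Fin.ext (by simp only [Fin.revPerm_apply, Fin.val_rev]; omega))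
    rw [e1, e2, flipD_pair] at h2
    rw [← (flipE _).injective h2, D.involutive]
  have hne : i ≠ j := fun e => D.fixedPointFree (.inr (i.castAdd R)) (by rw [hij, e])
  rcases lt_or_gt_of_ne hne with h1 | h1
  · exact key j i h1 (by rw [← hij, D.involutive])
  · exact key i j h1 hij

lemma qp_swap {P : ℕ} (a : ℕ) (ha : a + 1 < P) (s : Fin P → Bool) (h1 : s ⟨a, by omega⟩ = true)
    (h2 : s ⟨a + 1, ha⟩ = false) :
    qp τ s = -τ * qp τ (s ∘ Equiv.swap ⟨a, by omega⟩ ⟨a + 1, ha⟩) := by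
  obtain ⟨j, hj⟩ : ∃ j, a + (1 + 1) + j = P := ⟨P - (a + 2), by omega⟩
  subst hj
  obtain ⟨b, x, y, c, rfl⟩ := exists_mid s
  rw [mid_left] at h1
  rw [mid_right] at h2
  subst h1 h2
  rw [mid_swap, qp_mid]

lemma FD_swap_bot {P R m : ℕ} (D : Diagram m (P + R)) (a : ℕ) (ha : a + 1 < P)
    (h : D.pair (.inr ⟨a, by omega⟩) = .inr ⟨a + 1, by omega⟩) (u) (s : Fin P → Bool)
    (w : Fin R → Bool) (h1 : s ⟨a, by omega⟩ = true) (h2 : s ⟨a + 1, ha⟩ = false) :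
    FD τ D u (Fin.append s w) =
      τ⁻¹ * FD τ D u (Fin.append (s ∘ Equiv.swap ⟨a, by omega⟩ ⟨a + 1, ha⟩) w) := by
  have e1 : ∀ v : Fin P → Bool, ∀ k (hk : k < P),
      Fin.append v w ⟨k, by omega⟩ = v ⟨k, hk⟩ := fun v k hk =>
    Fin.append_left v w ⟨k, hk⟩
  rw [FD, FD, Phi_swap (τ := τ) D.involutive (x := .inr ⟨a + 1, by omega⟩) (y := .inr ⟨a, by omega⟩)
    (σ' := Sum.elim u fun j =>
      !(Fin.append (s ∘ Equiv.swap ⟨a, by omega⟩ ⟨a + 1, ha⟩) w) j)]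
  · have : ∏ j, gw τ (Fin.append s w j) =
        ∏ j, gw τ (Fin.append (s ∘ Equiv.swap ⟨a, by omega⟩ ⟨a + 1, ha⟩) w j) := by
      simp only [Fin.prod_univ_add, Fin.append_left, Fin.append_right, Function.comp_apply]
      rw [Equiv.prod_comp (Equiv.swap _ _) fun k => gw τ (s k)]
    rw [this]
    ring
  · rw [← h, D.involutive]
  · simp only [bIdx]; omega
  · rintro (k | k) h3 h4
    · rfl
    · simp only [Sum.elim_inr]
      congr 1
      induction k using Fin.addCases with
      | left k =>
        rw [Fin.append_left, Fin.append_left, Function.comp, Equiv.swap_apply_of_ne_of_ne]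
        · rintro rfl; exact h4 rfl
        · rintro rfl; exact h3 rfl
      | right k => rw [Fin.append_right, Fin.append_right]
  · simp only [Sum.elim_inr]; rw [e1 _ _ ha, h2]; rfl
  · simp only [Sum.elim_inr]; rw [e1 _ a (by omega), h1]; rfl
  · simp only [Sum.elim_inr]
    rw [e1 _ _ ha, Function.comp, Equiv.swap_apply_right, h1]; rfl
  · simp only [Sum.elim_inr]
    rw [e1 _ a (by omega), Function.comp, Equiv.swap_apply_left, h2]; rfl

lemma sum_qp_FD (hτ : τ ≠ 0) {P R : ℕ} (D : Diagram 0 (P + R)) (hPR : R < P) (u)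
    (w : Fin R → Bool) :
    ∑ s : Fin P → Bool, qp τ s * FD τ D u (Fin.append s w) = 0 := by
  obtain ⟨a, ha, h⟩ := exists_adj_bot D hPR
  have e1 : ∀ v : Fin P → Bool, ∀ k (hk : k < P),
      Fin.append v w ⟨k, by omega⟩ = v ⟨k, hk⟩ := fun v k hk =>
    Fin.append_left v w ⟨k, hk⟩
  have hz : ∀ s : Fin P → Bool, s ⟨a, by omega⟩ = s ⟨a + 1, ha⟩ →
      FD τ D u (Fin.append s w) = 0 := fun s hs => by
    by_contra h0
    have := FD_ne_pair h0 (.inr ⟨a, by omega⟩)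
    rw [h] at this
    simp only [Sum.elim_inr] at this
    rw [e1 _ _ ha, e1 _ a (by omega), hs] at this
    simp at this
  have hss : ∀ s : Fin P → Bool, (s ∘ Equiv.swap ⟨a, by omega⟩ ⟨a + 1, ha⟩) ∘
      Equiv.swap ⟨a, by omega⟩ ⟨a + 1, ha⟩ = s := fun s => by
    funext k; simp
  have hmain : ∀ s : Fin P → Bool, s ⟨a, by omega⟩ = true → s ⟨a + 1, ha⟩ = false →
      qp τ s * FD τ D u (Fin.append s w) +
        qp τ (s ∘ Equiv.swap ⟨a, by omega⟩ ⟨a + 1, ha⟩) *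
          FD τ D u (Fin.append (s ∘ Equiv.swap ⟨a, by omega⟩ ⟨a + 1, ha⟩) w) = 0 := by
    intro s h1 h2
    rw [qp_swap a ha s h1 h2, FD_swap_bot D a ha h u s w h1 h2]
    field_simp
    ring
  refine Finset.sum_involution (fun s _ => s ∘ Equiv.swap ⟨a, by omega⟩ ⟨a + 1, ha⟩)
    (fun s _ => ?_) (fun s _ h0 => ?_) (fun _ _ => Finset.mem_univ _) (fun s _ => hss s)
  · by_cases hs : s ⟨a, by omega⟩ = s ⟨a + 1, ha⟩
    · rw [hz s hs, hz (s ∘ _)]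
      · simp
      · simp [hs]
    · cases h1 : s ⟨a, by omega⟩
      · have h2 : s ⟨a + 1, ha⟩ = true := by rw [h1] at hs; simpa using Ne.symm hs
        have := hmain (s ∘ Equiv.swap ⟨a, by omega⟩ ⟨a + 1, ha⟩) (by simp [h2]) (by simp [h1])
        rw [hss] at this
        rw [add_comm, this]
      · exact hmain s h1 (by rw [h1] at hs; simpa using Ne.symm hs)
  · intro e
    refine h0 ?_
    rw [hz s, mul_zero]
    have := congrFun e ⟨a, by omega⟩
    simp only [Function.comp, Equiv.swap_apply_left] at this
    exact this.symm

lemma sum_qp_F (hτ : τ ≠ 0) {P R : ℕ} (x : Hom ℂ 0 (P + R)) (hPR : R < P) (u)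
    (w : Fin R → Bool) :
    ∑ s : Fin P → Bool, qp τ s * F τ x u (Fin.append s w) = 0 := by
  simp only [F, Finset.mul_sum]
  rw [Finset.sum_comm]
  refine Finset.sum_eq_zero fun D _ => ?_
  simp only [mul_left_comm (qp τ _)]
  rw [← Finset.mul_sum, sum_qp_FD hτ D hPR, mul_zero]

lemma qp_sq {P : ℕ} (s : Fin P → Bool) :
    qp τ s ^ 2 = ∏ p, if s p then 1 else (τ ^ 2) ^ (p : ℕ) := by
  rw [qp, ← Finset.prod_pow]
  refine Finset.prod_congr rfl fun p _ => ?_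
  split_ifs
  · simp
  · rw [← pow_mul, mul_comm, pow_mul, neg_sq]

lemma gpoly_eq_sum (P : ℕ) : gpoly (τ ^ 2) P =
    ∑ s : Fin P → Bool, Polynomial.C (qp τ s ^ 2) * Polynomial.X ^ (P - cnt s) := by
  rw [gpoly, Finset.prod_range]
  have : ∀ p : Fin P, (1 + Polynomial.C ((τ ^ 2) ^ (p : ℕ)) * Polynomial.X : Polynomial ℂ) =
      ∑ b : Bool, if b then 1 else Polynomial.C ((τ ^ 2) ^ (p : ℕ)) * Polynomial.X := by
    intro p; simp
  simp only [this]
  rw [Finset.prod_univ_sum, Fintype.piFinset_univ]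
  refine Finset.sum_congr rfl fun s _ => ?_
  have h1 : ∀ p : Fin P, (if s p = true then 1 else
      Polynomial.C ((τ ^ 2) ^ (p : ℕ)) * Polynomial.X : Polynomial ℂ) =
      Polynomial.C (if s p = true then 1 else (τ ^ 2) ^ (p : ℕ)) *
        if s p = true then 1 else Polynomial.X := by
    intro p; split_ifs <;> simp
  rw [Finset.prod_congr rfl fun p _ => h1 p, Finset.prod_mul_distrib, qp_sq, map_prod,
    Finset.prod_ite, Finset.prod_const_one, one_mul, Finset.prod_const]
  congr 2
  have := Finset.card_filter_add_card_filter_not (s := (Finset.univ : Finset (Fin P)))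
    (fun i => s i = true)
  rw [Finset.card_univ, Fintype.card_fin] at this
  rw [cnt]
  omega
end

section
variable {τ : ℂ}

lemma cnt_append {P R : ℕ} (s : Fin P → Bool) (w : Fin R → Bool) :
    cnt (Fin.append s w) = cnt s + cnt w := by
  simp only [cnt, Finset.card_filter, Fin.sum_univ_add, Fin.append_left, Fin.append_right]

lemma cnt_le {n : ℕ} (s : Fin n → Bool) : cnt s ≤ n := by
  have := cnt_add s
  omega

lemma cnt_const_true (n : ℕ) : cnt (fun _ : Fin n => true) = n := by simp [cnt]

lemma cnt_const_false (n : ℕ) : cnt (fun _ : Fin n => false) = 0 := by simp [cnt]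

lemma exists_F_ne (hτ : τ ≠ 0) {m n : ℕ} {x : Hom ℂ m n} (hx : x ≠ 0) :
    ∃ s t, F τ x s t ≠ 0 := by
  by_contra! h
  exact hx (eq_zero_of_F hτ h)

lemma Killed.coeff_eq_zero (hτ : τ ≠ 0) (hd : τ + τ⁻¹ ≠ 0) {n : ℕ} {x : Hom ℂ 0 n}
    (hx : Killed τ x) (hx0 : x ≠ 0) {R r : ℕ} (h : n = (R + 2 * r) + R) (hr : 1 ≤ r) :
    (gpoly (τ ^ 2) (R + 2 * r)).coeff r = 0 := by
  subst h
  obtain ⟨u, t, ht⟩ := exists_F_ne hτ hx0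
  have hu := cnt_le u
  have hw := F_weight ht
  have h1 := sum_qp_F hτ x (show R < R + 2 * r by omega) u fun _ => false
  have h2 : ∀ s : Fin (R + 2 * r) → Bool, qp τ s * F τ x u (Fin.append s fun _ => false) * qp τ t =
      if r = R + 2 * r - cnt s then qp τ s ^ 2 *
        (F τ x u t * ∏ j : Fin R, (-τ) ^ (R + 2 * r + j : ℕ)) else 0 := by
    intro s
    have hs := cnt_le s
    split_ifs with h
    · rw [mul_assoc, hx.eq hτ hd u (t' := t)]
      · simp only [qp, Fin.prod_univ_add, Fin.append_left, Fin.append_right, Fin.val_castAdd,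
          Fin.val_natAdd, Bool.false_eq_true, if_false]
        ring
      · rw [cnt_append, cnt_const_false]
        omega
    · have : F τ x u (Fin.append s fun _ => false) = 0 := by
        by_contra h0
        have := F_weight h0
        rw [cnt_append, cnt_const_false] at this
        omega
      rw [this, mul_zero, zero_mul]
  have h3 := congrArg (· * qp τ t) h1
  simp only [Finset.sum_mul, zero_mul] at h3
  rw [Finset.sum_congr rfl fun s _ => h2 s] at h3
  simp only [gpoly_eq_sum, Polynomial.finsetSum_coeff, Polynomial.coeff_C_mul,
    Polynomial.coeff_X_pow, mul_ite, mul_one, mul_zero]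
  simp only [← ite_zero_mul, ← Finset.sum_mul] at h3
  refine (mul_eq_zero.1 h3).resolve_right (mul_ne_zero ht (Finset.prod_ne_zero_iff.2 fun j _ => ?_))
  exact pow_ne_zero _ (neg_ne_zero.2 hτ)

/-- Killed morphisms from the unit object live in a single degree. -/
lemma Killed.eq_of_ne_zero (hτ : τ ≠ 0) (hd : τ + τ⁻¹ ≠ 0) {ℓ k : ℕ} (hodd : Odd ℓ) (hℓ : 3 ≤ ℓ)
    (hprim : IsPrimitiveRoot (τ ^ 2) ℓ) {x : Hom ℂ 0 (2 * k)} (hx : Killed τ x) (hx0 : x ≠ 0)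
    (hk : 1 ≤ k) : k + 1 = ℓ := by
  refine eq_of_gpoly_coeff hprim (by omega) hodd (by omega) hk fun r hr hrk => ?_
  obtain ⟨R, rfl⟩ : ∃ R, k = R + r := ⟨k - r, by omega⟩
  have := hx.coeff_eq_zero hτ hd hx0 (R := R) (r := r) (by omega) hr
  rwa [show R + r + r = R + 2 * r by omega]
end

section
variable {τ : ℂ}

/-! ### Bending morphisms -/

/-- The morphism from the unit object obtained by bending the source of `y` down. -/
noncomputable def bend (τ : ℂ) {m n : ℕ} (y : Hom ℂ m n) : Hom ℂ 0 (m + n) :=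
  comp (τ + τ⁻¹) (tensor (idHom ℂ m) y) (single (capND m))

/-- The inverse operation to `bend`. -/
noncomputable def unbend (τ : ℂ) {m n : ℕ} (z : Hom ℂ 0 (m + n)) : Hom ℂ m n :=
  comp (τ + τ⁻¹) (cupL n m) (castH (Nat.add_zero m) rfl (tensor (idHom ℂ m) z))

lemma cupW_mul_capW_rbar (hτ : τ ≠ 0) {m : ℕ} (s : Fin m → Bool) :
    cupW τ s * capW τ (rbar s) = 1 := by
  rw [capW, ← prod_rev, cupW, ← Finset.prod_mul_distrib]
  refine Finset.prod_eq_one fun i _ => ?_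
  simp only [rbar, Fin.rev_rev]
  cases s i <;> simp [hτ]

section bend
variable (hτ : τ ≠ 0) (hd : τ + τ⁻¹ ≠ 0)
include hτ hd

lemma F_bend {m n : ℕ} (y : Hom ℂ m n) (u) (s : Fin m → Bool) (t : Fin n → Bool) :
    F τ (bend τ y) u (Fin.append s t) = capW τ s * F τ y (rbar s) t := by
  simp only [bend, F_comp hτ hd, sum_append, F_tensor_append, F_id hτ, F_capN hτ]
  simp

lemma F_unbend {m n : ℕ} (z : Hom ℂ 0 (m + n)) (s : Fin m → Bool) (t : Fin n → Bool) :
    F τ (unbend τ z) s t = cupW τ s * F τ z Fin.elim0 (Fin.append (rbar s) t) := by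
  have e : ∀ p (w : Fin (m + n) → Bool),
      F τ (castH (Nat.add_zero m) rfl (tensor (idHom ℂ m) z)) s (Fin.append p w) =
        if s = p then F τ z Fin.elim0 w else 0 := by
    intro p w
    rw [F_castH, show (fun i => s (Fin.cast (Nat.add_zero m) i)) =
      Fin.append s Fin.elim0 from (append_empty _ _).symm]
    refine (F_tensor_append _ _ _ _ _ _).trans ?_
    rw [F_id hτ, ite_mul, one_mul, zero_mul]
  simp only [unbend, F_comp hτ hd, sum_append (b := _ + _), sum_append (b := n), e, F_cupL hτ]
  simp [mul_comm]

lemma unbend_bend {m n : ℕ} (y : Hom ℂ m n) : unbend τ (bend τ y) = y := by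
  refine F_inj hτ fun s t => ?_
  rw [F_unbend hτ hd, F_bend hτ hd, rbar_rbar, ← mul_assoc, cupW_mul_capW_rbar hτ, one_mul]

variable {J : ∀ m n : ℕ, Set (Hom ℂ m n)} (hJ : IsIdealEv (τ + τ⁻¹) J)
include hJ

omit hτ hd in
lemma bend_mem {m n : ℕ} (hm : Even m) (hn : Even n) {y : Hom ℂ m n} (hy : y ∈ J m n) :
    bend τ y ∈ J 0 (m + n) :=
  hJ.comp_mem_right Even.zero (hm.add hm) (hm.add hn) _ _
    (hJ.tensor_mem_right hm hm hm hn _ _ hy)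

lemma mem_of_bend_mem {m n : ℕ} (hm : Even m) (hn : Even n) {y : Hom ℂ m n}
    (hy : bend τ y ∈ J 0 (m + n)) : y ∈ J m n := by
  rw [← unbend_bend hτ hd y]
  exact hJ.comp_mem_left hm (hm.add (hm.add hn)) hn _ _
    (castH_mem.2 (hJ.tensor_mem_right hm hm Even.zero (hm.add hn) _ _ hy))

omit hτ hd in
lemma killed_of_minimal {k : ℕ} (h : ∀ j < k, ∀ x ∈ J 0 (2 * j), x = 0) {x : Hom ℂ 0 (2 * k)}
    (hx : x ∈ J 0 (2 * k)) : Killed τ x := by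
  intro i j hij
  have e : i + j = 2 * (k - 1) := by omega
  rw [← castH_eq_zero (h := rfl) (h' := e)]
  refine h (k - 1) (by omega) _ (castH_mem.2 ?_)
  exact hJ.comp_mem_left Even.zero (even_two_mul k) (by rw [e]; exact even_two_mul _) _ _ hx

variable {ℓ : ℕ} (hodd : Odd ℓ) (hℓ : 3 ≤ ℓ) (hprim : IsPrimitiveRoot (τ ^ 2) ℓ)
  (h0 : ∀ x ∈ J 0 0, x = 0)
include hodd hℓ hprim h0

lemma eq_zero_of_lt : ∀ k, k + 1 < ℓ → ∀ x ∈ J 0 (2 * k), x = 0 := by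
  intro k
  induction k using Nat.strong_induction_on with
  | _ k ih =>
    intro hk x hx
    rcases Nat.eq_zero_or_pos k with rfl | hk1
    · exact h0 x hx
    by_contra hx0
    have := (killed_of_minimal hJ (fun j hj => ih j hj (by omega)) hx).eq_of_ne_zero hτ hd hodd hℓ
      hprim hx0 hk1
    omega

lemma exists_killed (hne : IdealNonzeroEv J) :
    ∃ x ∈ J 0 (2 * (ℓ - 1)), x ≠ 0 ∧ Killed τ x := by
  have hex : ∃ k, ∃ x ∈ J 0 (2 * k), x ≠ 0 := by
    obtain ⟨m, n, hm, hn, x, hx, hx0⟩ := hne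
    obtain ⟨k, hk⟩ := hm.add hn
    refine ⟨k, castH rfl (by omega) (bend τ x), castH_mem.2 (bend_mem hJ hm hn hx), ?_⟩
    rw [Ne, castH_eq_zero]
    intro hb
    apply hx0
    rw [← unbend_bend hτ hd x, hb]
    exact F_inj hτ fun s t => by rw [F_unbend hτ hd, F_zero, F_zero, mul_zero]
  have hpos : Nat.find hex ≠ 0 := fun h => by
    obtain ⟨x, hx, hx0⟩ := (Nat.find_eq_zero hex).1 h
    exact hx0 (h0 x hx)
  obtain ⟨x, hx, hx0⟩ := Nat.find_spec hex
  have hk := killed_of_minimal hJ (fun j hj x hx => by_contra fun h =>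
    Nat.find_min hex hj ⟨x, hx, h⟩) hx
  have h1 : 1 ≤ Nat.find hex := by omega
  have h2 := hk.eq_of_ne_zero hτ hd hodd hℓ hprim hx0 h1
  have h3 : Nat.find hex = ℓ - 1 := by omega
  rw [← h3]
  exact ⟨x, hx, hx0, hk⟩
end bend

lemma Negl_zero_zero (hτ : τ ≠ 0) (hd : τ + τ⁻¹ ≠ 0) {x : Hom ℂ 0 0}
    (hx : x ∈ Negl (τ + τ⁻¹) 0 0) : x = 0 := by
  have := hx (idHom ℂ 0)
  rw [id_comp' hτ hd, F_trace hτ hd] at this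
  refine eq_zero_of_F hτ fun s t => ?_
  rw [Fintype.sum_subsingleton _ t] at this
  simpa [Kw, Subsingleton.elim s t] using this
end

section
variable {τ : ℂ}

/-! ### Existence of negligible morphisms -/

lemma exists_cnt {n w : ℕ} (h : w ≤ n) : ∃ t : Fin n → Bool, cnt t = w := by
  obtain ⟨v, rfl⟩ := Nat.exists_eq_add_of_le h
  exact ⟨Fin.append (fun _ => true) fun _ => false, by
    rw [cnt_append, cnt_const_true, cnt_const_false, add_zero]⟩

section negl
variable (hτ : τ ≠ 0) (hd : τ + τ⁻¹ ≠ 0)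
include hτ hd

omit hd in
lemma sum_qp_cupI (i j : ℕ) (r) : ∑ s, qp τ s * F τ (cupI i j) s r = 0 := by
  obtain ⟨a', b', rfl⟩ : ∃ (a' : Fin i → Bool) (b' : Fin j → Bool), r = Fin.append a' b' :=
    ⟨fun k => r (k.castAdd j), fun k => r (k.natAdd i), (Fin.append_castAdd_natAdd).symm⟩
  simp only [sum_mid, F_cupI hτ]
  simp [qp_mid]
  field_simp
  ring

lemma sum_qp_F_of_ne_id {n : ℕ} {D : Diagram n n} (hD : D ≠ idD n) (t) :
    ∑ s, qp τ s * FD τ D s t = 0 := by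
  obtain ⟨i, j, rfl, v, hv⟩ := factor hτ hd hD
  have h : ∀ s, FD τ D s t = ∑ r, F τ (cupI i j) s r * F τ v r t := fun s => by
    rw [← F_single, hv, F_comp hτ hd]; rfl
  simp only [h, Finset.mul_sum, ← mul_assoc]
  rw [Finset.sum_comm]
  simp only [← Finset.sum_mul, sum_qp_cupI hτ, zero_mul, Finset.sum_const_zero]

lemma sum_qp_F_eq {n : ℕ} (x : Hom ℂ n n) (t) :
    ∑ s, qp τ s * F τ x s t = x (idD n) * qp τ t := by
  simp only [F, Finset.mul_sum, mul_left_comm (qp τ _)]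
  rw [Finset.sum_comm]
  simp only [← Finset.mul_sum]
  rw [Finset.sum_eq_single (idD n) (fun D _ hD => by rw [sum_qp_F_of_ne_id hτ hd hD, mul_zero])
    (by simp)]
  have := fun s => F_id hτ (n := n) s t
  simp only [← F_single, show single (idD n) = idHom ℂ n from rfl, this]
  simp

/-- The trace of a killed endomorphism on each weight space is its identity coefficient. -/
lemma Killed.sum_weight {n : ℕ} {x : Hom ℂ n n} (hx : Killed τ x) {w : ℕ} (hw : w ≤ n) :
    ∑ s with n - cnt s = w, F τ x s s = x (idD n) := by
  obtain ⟨t, ht⟩ := exists_cnt (n := n) (w := n - w) (by omega)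
  refine mul_right_cancel₀ (qp_ne hτ t) ?_
  rw [← sum_qp_F_eq hτ hd, Finset.sum_mul, Finset.sum_filter]
  refine Finset.sum_congr rfl fun s _ => ?_
  have hs := cnt_le s
  split_ifs with h
  · rw [hx.eq hτ hd s (t' := t) (by omega), mul_comm]
  · have : F τ x s t = 0 := by
      by_contra h0
      have := F_weight h0
      omega
    rw [this, mul_zero]

lemma Killed.Tr_eq_zero {ℓ n : ℕ} (hℓ : 1 < ℓ) (hprim : IsPrimitiveRoot (τ ^ 2) ℓ) (hn : n + 1 = ℓ)
    {x : Hom ℂ n n} (hx : Killed τ x) : Tr (τ + τ⁻¹) x = 0 := by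
  refine (mul_eq_zero.1 (?_ : τ ^ n * _ = 0)).resolve_left (pow_ne_zero _ hτ)
  rw [F_trace hτ hd, Finset.mul_sum]
  have h1 : ∀ s : Fin n → Bool,
      τ ^ n * (Kw τ s * F τ x s s) = (τ ^ 2) ^ (n - cnt s) * F τ x s s := by
    intro s
    have hs := cnt_le s
    have e : τ ^ n = τ ^ cnt s * τ ^ (n - cnt s) := by
      rw [← pow_add, Nat.add_sub_cancel' hs]
    rw [Kw_eq, e, inv_pow]
    field_simp
    ring
  rw [Finset.sum_congr rfl fun s _ => h1 s, ← Finset.sum_fiberwise_of_maps_to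
    (t := Finset.range ℓ) (g := fun s => n - cnt s) (fun s _ => Finset.mem_range.2 (by omega))]
  have h2 : ∀ w ∈ Finset.range ℓ, (∑ s with n - cnt s = w, (τ ^ 2) ^ (n - cnt s) * F τ x s s) =
      (τ ^ 2) ^ w * x (idD n) := by
    intro w hw
    rw [Finset.mem_range] at hw
    rw [← hx.sum_weight hτ hd (w := w) (by omega), Finset.mul_sum]
    refine Finset.sum_congr rfl fun s hs => ?_
    rw [(Finset.mem_filter.1 hs).2]
  rw [Finset.sum_congr rfl h2, ← Finset.sum_mul, hprim.geom_sum_eq_zero hℓ, zero_mul]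

lemma Tr_comp_eq_sum {n : ℕ} (b x : Hom ℂ n n) : Tr (τ + τ⁻¹) (comp (τ + τ⁻¹) b x) =
    ∑ D, b D * Tr (τ + τ⁻¹) (comp (τ + τ⁻¹) (single D) x) := by
  simp only [F_trace hτ hd, F_comp hτ hd, F_single]
  have h : ∀ t s, F τ b t s = ∑ D, b D * FD τ D t s := fun _ _ => rfl
  simp only [h, Finset.mul_sum]
  rw [Finset.sum_congr rfl fun s _ => Finset.sum_comm, Finset.sum_comm]
  exact Finset.sum_congr rfl fun D _ => Finset.sum_congr rfl fun s _ =>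
    Finset.sum_congr rfl fun t _ => by ring

lemma exists_orthogonal (n : ℕ) : ∃ x : Hom ℂ n n, x ≠ 0 ∧
    ∀ b, Tr (τ + τ⁻¹) (comp (τ + τ⁻¹) b x) = b (idD n) * Tr (τ + τ⁻¹) x := by
  let f : Hom ℂ n n →ₗ[ℂ] ({D : Diagram n n // D ≠ idD n} → ℂ) :=
    { toFun := fun x D => Tr (τ + τ⁻¹) (comp (τ + τ⁻¹) (single D.1) x)
      map_add' := fun x y => by
        funext D; simp only [comp_add' hτ hd, Tr_add' hτ hd, Pi.add_apply]
      map_smul' := fun c x => by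
        funext D
        simp only [comp_smul' hτ hd, Tr_smul' hτ hd, Pi.smul_apply, RingHom.id_apply, smul_eq_mul] }
  have hf : LinearMap.ker f ≠ ⊥ := by
    apply LinearMap.ker_ne_bot_of_finrank_lt
    rw [Module.finrank_fintype_fun_eq_card, Module.finrank_fintype_fun_eq_card]
    exact Fintype.card_subtype_lt (x := idD n) (by simp)
  obtain ⟨x, hx, hx0⟩ := (Submodule.ne_bot_iff _).1 hf
  refine ⟨x, hx0, fun b => ?_⟩
  rw [Tr_comp_eq_sum hτ hd, Finset.sum_eq_single (idD n)]
  · rw [show single (idD n) = idHom ℂ n from rfl, id_comp' hτ hd]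
  · intro D _ hD
    have := congrFun (LinearMap.mem_ker.1 hx) ⟨D, hD⟩
    rw [show Tr (τ + τ⁻¹) (comp (τ + τ⁻¹) (single D) x) = 0 from this, mul_zero]
  · simp

omit hd in
lemma F_cupI_top (i j : ℕ) (t) : F τ (cupI i j) (fun _ => true) t = 0 := by
  obtain ⟨a', b', rfl⟩ : ∃ (a' : Fin i → Bool) (b' : Fin j → Bool), t = Fin.append a' b' :=
    ⟨fun k => t (k.castAdd j), fun k => t (k.natAdd i), (Fin.append_castAdd_natAdd).symm⟩
  by_contra h
  obtain ⟨a, x, y, b, hs⟩ := exists_mid (i := i) (j := j) fun _ => true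
  rw [hs, F_cupI hτ] at h
  have h3 := mid_left a x y b (by omega)
  have h4 := mid_right a x y b (by omega)
  rw [← hs] at h3 h4
  subst h3 h4
  simp at h

lemma Negl_nonzero {ℓ : ℕ} (hodd : Odd ℓ) (hℓ : 3 ≤ ℓ) (hprim : IsPrimitiveRoot (τ ^ 2) ℓ) :
    IdealNonzeroEv (Negl (τ + τ⁻¹)) := by
  obtain ⟨e, he⟩ := hodd
  obtain ⟨x, hx0, hx⟩ := exists_orthogonal hτ hd (2 * e)
  by_cases hk : Killed τ x
  · refine ⟨2 * e, 2 * e, even_two_mul _, even_two_mul _, x, fun b => ?_, hx0⟩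
    rw [hx, hk.Tr_eq_zero hτ hd (by omega) hprim he.symm, mul_zero]
  · simp only [Killed, not_forall] at hk
    obtain ⟨i, j, h, hne⟩ := hk
    have hij : Even (i + j) := ⟨e - 1, by omega⟩
    refine ⟨2 * e, i + j, even_two_mul _, hij, _, fun c => ?_, hne⟩
    rw [comp_assoc' hτ hd, hx, ← F_top hτ (comp _ _ _), F_comp hτ hd, Finset.sum_eq_zero, zero_mul]
    intro t _
    rw [F_castH]
    exact mul_eq_zero_of_left (F_cupI_top hτ i j _) _
end negl
end

section
variable {τ : ℂ}

/-! ### Negligible morphisms lie in every nonzero proper ideal -/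

section main
variable (hτ : τ ≠ 0) (hd : τ + τ⁻¹ ≠ 0)
include hτ hd

lemma comp_tensor_id {l m n b : ℕ} (u : Hom ℂ l m) (v : Hom ℂ m n) :
    tensor (comp (τ + τ⁻¹) v u) (idHom ℂ b) =
      comp (τ + τ⁻¹) (tensor v (idHom ℂ b)) (tensor u (idHom ℂ b)) := by
  refine F_inj hτ fun s t => ?_
  simp [F_comp hτ hd, F_tensor, sum_append, F_id hτ]

lemma comp_tensor_id_eq_sum {l m n b : ℕ} (c : Hom ℂ m n) (y : Hom ℂ l (m + b)) :
    comp (τ + τ⁻¹) (tensor c (idHom ℂ b)) y =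
      ∑ D, c D • comp (τ + τ⁻¹) (tensor (single D) (idHom ℂ b)) y := by
  have hs : ∀ (S : Finset (Diagram m n)) (f : Diagram m n → Hom ℂ l (n + b)) (s t),
      F τ (∑ D ∈ S, f D) s t = ∑ D ∈ S, F τ (f D) s t := by
    intro S f s t
    induction S using Finset.induction_on with
    | empty => simp [F_zero]
    | insert D S hD ih => rw [Finset.sum_insert hD, Finset.sum_insert hD, F_add, ih]
  refine F_inj hτ fun s t => ?_
  have h : ∀ p q, F τ c p q = ∑ D, c D * FD τ D p q := fun _ _ => rfl
  simp only [hs, F_smul, F_comp hτ hd, F_tensor, F_single, h, Finset.sum_mul, Finset.mul_sum]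
  rw [Finset.sum_comm]
  exact Finset.sum_congr rfl fun D _ => Finset.sum_congr rfl fun p _ => by ring

variable {J : ∀ m n : ℕ, Set (Hom ℂ m n)} (hJ : IsIdealEv (τ + τ⁻¹) J) {ℓ : ℕ}
  (hodd : Odd ℓ) (hℓ : 3 ≤ ℓ) (hprim : IsPrimitiveRoot (τ ^ 2) ℓ)
include hJ

lemma exists_endo {n : ℕ} (hn : Even n) {x : Hom ℂ 0 (n + n)} (hx : x ∈ J 0 (n + n)) (hx0 : x ≠ 0)
    (hk : Killed τ x) : ∃ c ∈ J n n, c (idD n) ≠ 0 := by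
  refine ⟨comp (τ + τ⁻¹) (cupR n n) (castH (Nat.zero_add n) rfl (tensor x (idHom ℂ n))), ?_, ?_⟩
  · exact hJ.comp_mem_left hn ((hn.add hn).add hn) hn _ _
      (castH_mem.2 (hJ.tensor_mem_left Even.zero (hn.add hn) hn hn _ _ hx))
  obtain ⟨u, t, ht⟩ := exists_F_ne hτ hx0
  have hw := F_weight ht
  have hu := cnt_le u
  have key : ∀ t' : Fin (n + n) → Bool, cnt t' = n → F τ x Fin.elim0 t' ≠ 0 := fun t' ht' h0 => by
    have := hk.eq hτ hd u (t := t) (t' := t') (by omega)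
    rw [Subsingleton.elim u Fin.elim0] at this ht
    rw [h0, zero_mul] at this
    exact mul_ne_zero ht (qp_ne hτ t') this
  have e : ∀ (s : Fin n → Bool) (w : Fin (n + n) → Bool) (r : Fin n → Bool),
      F τ (castH (Nat.zero_add n) rfl (tensor x (idHom ℂ n))) s (Fin.append w r) =
        if s = r then F τ x Fin.elim0 w else 0 := by
    intro s w r
    rw [F_castH, cast_empty_append]
    refine (F_tensor_append _ _ _ _ _ _).trans ?_
    rw [F_id hτ, mul_ite, mul_one, mul_zero]
  have h := key (Fin.append (fun _ => true) (rbar fun _ => true)) (by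
    rw [cnt_append, cnt_const_true]
    have : (rbar fun _ : Fin n => true) = fun _ => false := rfl
    rw [this, cnt_const_false, add_zero])
  rw [← F_top hτ (comp _ _ _), F_comp hτ hd]
  simp only [sum_append (a := _ + _), sum_append (a := n), e, F_cupR hτ]
  rw [Finset.sum_eq_single (fun _ => true), Finset.sum_eq_single (rbar fun _ => true),
    Finset.sum_eq_single (fun _ => true)]
  · simpa [rbar_rbar] using ⟨h, cupW_ne hτ _⟩
  · intro r _ hr
    simp [Ne.symm hr]
  · simp
  · intro w _ hw
    refine Finset.sum_eq_zero fun r _ => ?_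
    have h1 : (fun _ => true) = r → ¬ r = rbar w := fun h1 h2 =>
      hw (by rw [h1, h2, rbar_rbar])
    by_cases h2 : (fun _ => true) = r
    · simp [h1 h2]
    · simp [h2]
  · simp
  · intro v _ hv
    simp [hv]
  · simp

include hodd hℓ hprim in
lemma Negl_le_of_endo {n : ℕ} (hn : n + 1 = ℓ) {c : Hom ℂ n n} (hc : c ∈ J n n)
    (hc0 : c (idD n) ≠ 0) : ∀ N, Even N → Negl (τ + τ⁻¹) 0 N ⊆ J 0 N := by
  have hne : Even n := by
    rw [← hn] at hodd
    exact (Nat.even_add_one.not.1 (Nat.not_even_iff_odd.2 hodd) |> not_not.1)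
  intro N
  induction N using Nat.strong_induction_on with
  | _ N ih =>
    intro hN y hy
    by_cases hlt : N < 2 * n
    · obtain ⟨k, rfl⟩ := even_iff_exists_two_mul.1 hN
      rw [eq_zero_of_lt hτ hd (Negl_isIdealEv hτ hd) hodd hℓ hprim
        (fun x => Negl_zero_zero hτ hd) k (by omega) y hy]
      exact hJ.zero_mem _ _ Even.zero hN
    obtain ⟨b, rfl⟩ : ∃ b, N = n + b := ⟨N - n, by omega⟩
    have hb : Even b := (Nat.even_add.1 hN).1 hne
    let S : Submodule ℂ (Hom ℂ 0 (n + b)) :=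
      { carrier := J 0 (n + b)
        zero_mem' := hJ.zero_mem _ _ Even.zero hN
        add_mem' := fun {x y} hx hy => hJ.add_mem _ _ Even.zero hN x hx y hy
        smul_mem' := fun a x hx => hJ.smul_mem _ _ Even.zero hN a x hx }
    have h1 : comp (τ + τ⁻¹) (tensor c (idHom ℂ b)) y ∈ S :=
      hJ.comp_mem_right Even.zero hN hN _ _ (hJ.tensor_mem_left hne hne hb hb _ _ hc)
    rw [comp_tensor_id_eq_sum hτ hd, ← Finset.add_sum_erase _ _ (Finset.mem_univ (idD n))] at h1
    have h2 : ∑ D ∈ Finset.univ.erase (idD n),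
        c D • comp (τ + τ⁻¹) (tensor (single D) (idHom ℂ b)) y ∈ S := by
      refine S.sum_mem fun D hD => S.smul_mem _ ?_
      obtain ⟨i, j, h, v, hv⟩ := factor hτ hd (Finset.ne_of_mem_erase hD)
      have hij : Even (i + j) := by
        obtain ⟨e, he⟩ := hne
        exact ⟨e - 1, by omega⟩
      rw [hv, comp_tensor_id hτ hd, ← comp_assoc' hτ hd]
      exact hJ.comp_mem_left Even.zero (hij.add hb) hN _ _
        (ih (i + j + b) (by omega) (hij.add hb) (Negl_comp_left hτ hd _ hy))
    have h3 := (S.add_mem_iff_left h2).1 h1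
    rw [S.smul_mem_iff hc0] at h3
    have h4 : comp (τ + τ⁻¹) (tensor (single (idD n)) (idHom ℂ b)) y = y := by
      refine F_inj hτ fun s t => ?_
      have h5 : ∀ s t, F τ (single (idD n)) s t = if s = t then 1 else 0 := F_id hτ
      obtain ⟨t₁, t₂, rfl⟩ : ∃ (t₁ : Fin n → Bool) (t₂ : Fin b → Bool), t = Fin.append t₁ t₂ :=
        ⟨fun k => t (k.castAdd b), fun k => t (k.natAdd n), (Fin.append_castAdd_natAdd).symm⟩
      simp [F_comp hτ hd, sum_append, F_tensor_append, F_id hτ, h5]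
    rwa [h4] at h3

include hodd hℓ hprim in
lemma eq_Negl (hne : IdealNonzeroEv J) (hp : IdealProperEv J) {m n : ℕ} (hm : Even m)
    (hn : Even n) : J m n = Negl (τ + τ⁻¹) m n := by
  refine (le_Negl_of_proper hτ hd hJ hp hm hn).antisymm fun y hy => ?_
  have hex := exists_killed hτ hd hJ hodd hℓ hprim (fun x hx =>
    Negl_zero_zero hτ hd (le_Negl_of_proper hτ hd hJ hp Even.zero Even.zero hx)) hne
  obtain ⟨e, he⟩ := id hodd
  have h2 : 2 * (ℓ - 1) = 2 * e + 2 * e := by omega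
  rw [h2] at hex
  obtain ⟨x, hx, hx0, hk⟩ := hex
  obtain ⟨c, hc, hc0⟩ := exists_endo hτ hd hJ (even_two_mul e) hx hx0 hk
  exact mem_of_bend_mem hτ hd hJ hm hn
    (Negl_le_of_endo hτ hd hJ hodd hℓ hprim he.symm hc hc0 _ (hm.add hn)
      (bend_mem (Negl_isIdealEv hτ hd) hm hn hy))
end main

lemma add_inv_ne_zero {τ : ℂ} {ℓ : ℕ} (hτ : τ ≠ 0) (hodd : Odd ℓ)
    (hprim : IsPrimitiveRoot (τ ^ 2) ℓ) : τ + τ⁻¹ ≠ 0 := by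
  intro h
  have h1 : τ ^ 2 = -1 := by
    field_simp at h
    linear_combination h
  have := hprim.pow_eq_one
  rw [h1, hodd.neg_one_pow] at this
  norm_num at this
end

/-- Let `τ ∈ ℂ` be such that `τ²` is a primitive `ℓ`-th root of
unity with `ℓ` odd, `ℓ ≥ 3`.  Then the negligible morphisms between even
objects form the unique nonzero proper ideal of the even Temperley–Lieb
category `TL^{ev}(τ)`. -/
theorem stmt8 (τ : ℂ) (ℓ : ℕ) (hodd : Odd ℓ) (hℓ : 3 ≤ ℓ)
    (hprim : IsPrimitiveRoot (τ ^ 2) ℓ) :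
    (IsIdealEv (τ + τ⁻¹) (Negl (τ + τ⁻¹)) ∧
      IdealNonzeroEv (Negl (τ + τ⁻¹)) ∧ IdealProperEv (Negl (τ + τ⁻¹))) ∧
    (∀ J : ∀ m n : ℕ, Set (Hom ℂ m n), IsIdealEv (τ + τ⁻¹) J →
      IdealNonzeroEv J → IdealProperEv J →
      ∀ m n : ℕ, Even m → Even n → J m n = Negl (τ + τ⁻¹) m n) := by
  have hτ : τ ≠ 0 := by
    rintro rfl
    exact hprim.ne_zero (by omega) (by simp)
  have hd := add_inv_ne_zero hτ hodd hprim
  exact ⟨⟨Negl_isIdealEv hτ hd, Negl_nonzero hτ hd hodd hℓ hprim, Negl_proper hτ hd⟩,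
    fun J hJ hne hp m n hm hn => eq_Negl hτ hd hJ hodd hℓ hprim hne hp hm hn⟩

end TL
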